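/- arXiv:1612.02210 — 7 statements merged into one kernel-verified Lean document; each statement's English description precedes it below -/
import Mathlib

section
/- For a sequence a = (a_k)_{k≥0} of real numbers, the following are equivalent: (a) for every n ≥ 1, the n-by-n Hankel matrix H_n^{(0)}(a) = (a_{i+j})_{0≤i,j≤n−1} is totally positive; (b) for every n ≥ 1, both H_n^{(0)}(a) and H_n^{(1)}(a) = (a_{i+j+1})_{0≤i,j≤n−1} are positive definite; (c) for every n ≥ 1, det H_n^{(0)}(a) > 0 and det H_n^{(1)}(a) > 0; (d) there exists a positive measure μ on [0,∞) whose support is an infinite set, such that a_k = ∫ x^k dμ(x) for all k ≥ 0. -/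
/-- `A` is totally nonnegative of order `r`: every minor of size at most `r` is nonnegative. -/
def IsTNr {m n : ℕ} (A : Matrix (Fin m) (Fin n) ℝ) (r : ℕ) : Prop :=
  ∀ (k : ℕ), k ≤ r → ∀ (f : Fin k → Fin m) (g : Fin k → Fin n),
    StrictMono f → StrictMono g → 0 ≤ (A.submatrix f g).det

/-- `A` is totally positive of order `r`: every minor of size at most `r` is positive. -/
def IsTPr {m n : ℕ} (A : Matrix (Fin m) (Fin n) ℝ) (r : ℕ) : Prop :=
  ∀ (k : ℕ), k ≤ r → ∀ (f : Fin k → Fin m) (g : Fin k → Fin n),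
    StrictMono f → StrictMono g → 0 < (A.submatrix f g).det

/-- The contiguous `k`-by-`k` submatrix of `A` with rows `a, a+1, …, a+k-1`
and columns `b, b+1, …, b+k-1`. -/
def ctgSub {m n : ℕ} (A : Matrix (Fin m) (Fin n) ℝ) (k a b : ℕ)
    (ha : a + k ≤ m) (hb : b + k ≤ n) : Matrix (Fin k) (Fin k) ℝ :=
  Matrix.of fun i j => A ⟨a + i.1, by omega⟩ ⟨b + j.1, by omega⟩

/-- `A` is a Hankel matrix: the entry `A i j` depends only on `i + j`. -/
def IsHankel {m n : ℕ} (A : Matrix (Fin m) (Fin n) ℝ) : Prop :=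
  ∀ (i i' : Fin m) (j j' : Fin n), i.1 + j.1 = i'.1 + j'.1 → A i j = A i' j'

/-- The Hadamard (entrywise) power `A^{∘t}` with real exponent `t` (via `Real.rpow`). -/
noncomputable def hadPow {m n : ℕ} (A : Matrix (Fin m) (Fin n) ℝ) (t : ℝ) :
    Matrix (Fin m) (Fin n) ℝ :=
  Matrix.of fun i j => (A i j) ^ t

theorem hk_sylvester (b : ℕ → ℝ)
    (h : ∀ n : ℕ, 1 ≤ n → 0 < (Matrix.of fun i j : Fin n => b (i.1 + j.1)).det) (n : ℕ) :
    (Matrix.of fun i j : Fin n => b (i.1 + j.1)).PosDef := by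
  induction n with
  | zero =>
    refine Matrix.PosDef.of_dotProduct_mulVec_pos (by ext i; exact i.elim0) ?_
    intro x hx
    exact absurd (Subsingleton.elim x 0) hx
  | succ n ih =>
    have hd := h (n+1) (by omega)
    set M := (Matrix.of fun i j : Fin (n+1) => b (i.1 + j.1)) with hM
    set A := (Matrix.of fun i j : Fin n => b (i.1 + j.1)) with hA
    have hAdet : 0 < A.det := ih.det_pos
    set B : Matrix (Fin n) (Fin 1) ℝ := Matrix.of fun i j => b (i.1 + n) with hB
    set D : Matrix (Fin 1) (Fin 1) ℝ := Matrix.of fun i j => b (n + n) with hD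
    have hBl : Matrix.fromBlocks A B B.conjTranspose D = M.submatrix finSumFinEquiv finSumFinEquiv := by
      ext i j
      rcases i with i | i <;> rcases j with j | j <;>
        simp [hA, hB, hD, hM, add_comm]
    have : Invertible A := A.invertibleOfIsUnitDet (isUnit_iff_ne_zero.mpr hAdet.ne')
    have h1 := Matrix.det_fromBlocks₁₁ A B B.conjTranspose D
    rw [hBl, Matrix.det_submatrix_equiv_self] at h1
    have h2 : 0 < (D - B.conjTranspose * ⅟A * B).det := by
      rw [h1] at hd
      exact pos_of_mul_pos_right hd hAdet.le
    have h3 : (D - B.conjTranspose * A⁻¹ * B).PosSemidef := by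
      rw [← Matrix.invOf_eq_nonsing_inv]
      rw [Matrix.det_fin_one] at h2
      generalize (D - B.conjTranspose * ⅟A * B) = E at h2
      have : E = Matrix.diagonal (fun _ => E 0 0) := by
        ext i j; fin_cases i; fin_cases j; simp
      rw [this]
      exact Matrix.PosSemidef.diagonal (fun _ => h2.le)
    have h4 := (Matrix.PosDef.fromBlocks₁₁ B D ih).mpr h3
    rw [hBl, Matrix.posSemidef_submatrix_equiv] at h4
    exact h4.posDef_iff_det_ne_zero.mpr hd.ne'

open Matrix in
theorem hk_quad (a : ℕ → ℝ) (n : ℕ)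
    (h0 : (Matrix.of fun i j : Fin (n+1) => a (i.1 + j.1)).PosDef)
    (h1 : (Matrix.of fun i j : Fin (n+1) => a (i.1 + j.1 + 1)).PosDef) :
    ∃ w x : Fin (n+1) → ℝ, (∀ i, 0 < x i) ∧ (∀ i, 0 ≤ w i) ∧
      ∀ k, k ≤ n → a k = ∑ i, w i * x i ^ k := by
  set G := (Matrix.of fun i j : Fin (n+1) => a (i.1 + j.1)) with hG
  set H := (Matrix.of fun i j : Fin (n+1) => a (i.1 + j.1 + 1)) with hH
  obtain ⟨B, hBG⟩ : ∃ B : Matrix (Fin (n+1)) (Fin (n+1)) ℝ, G = Bᴴ * B := by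
    open scoped MatrixOrder in
    exact CStarAlgebra.nonneg_iff_eq_star_mul_self.mp h0.posSemidef.nonneg
  have hdet : B.det ≠ 0 := by
    intro h
    have := h0.det_pos
    rw [hBG, Matrix.det_mul, h] at this
    simp at this
  have hBu : IsUnit B.det := isUnit_iff_ne_zero.mpr hdet
  have hC : ((B⁻¹)ᴴ * H * B⁻¹).PosDef := by
    apply h1.conjTranspose_mul_mul_same
    apply Matrix.mulVec_injective_of_isUnit
    rw [Matrix.isUnit_nonsing_inv_iff]
    exact (Matrix.isUnit_iff_isUnit_det _).mpr hBu
  set C := (B⁻¹)ᴴ * H * B⁻¹ with hCdef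
  have hsp := hC.isHermitian.spectral_theorem
  set x := hC.isHermitian.eigenvalues with hx
  set U := (hC.isHermitian.eigenvectorUnitary : Matrix (Fin (n+1)) (Fin (n+1)) ℝ) with hU
  have hUU : U * Uᴴ = 1 := by
    have := (hC.isHermitian.eigenvectorUnitary).2
    exact (Matrix.mem_unitaryGroup_iff).mp this
  have hUU' : Uᴴ * U = 1 := by
    have := (hC.isHermitian.eigenvectorUnitary).2
    exact (Matrix.mem_unitaryGroup_iff').mp this
  have hCs : C = U * diagonal x * Uᴴ := by
    rw [Unitary.conjStarAlgAut_apply] at hsp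
    exact hsp
  set Q := Uᴴ * B with hQ
  have hGQ : G = Qᴴ * Q := by
    rw [hQ, Matrix.conjTranspose_mul, Matrix.conjTranspose_conjTranspose, hBG]
    calc Bᴴ * B = Bᴴ * 1 * B := by simp
      _ = _ := by rw [← hUU]; simp only [Matrix.mul_assoc]
  have hHQ : H = Qᴴ * (diagonal x * Q) := by
    have e1 : Bᴴ * C * B = H := by
      rw [hCdef]
      have : Bᴴ * (B⁻¹)ᴴ = 1 := by
        rw [← Matrix.conjTranspose_mul, Matrix.nonsing_inv_mul _ hBu, Matrix.conjTranspose_one]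
      calc Bᴴ * ((B⁻¹)ᴴ * H * B⁻¹) * B = (Bᴴ * (B⁻¹)ᴴ) * H * (B⁻¹ * B) := by
            simp only [Matrix.mul_assoc]
        _ = H := by rw [this, Matrix.nonsing_inv_mul _ hBu]; simp
    rw [← e1, hCs, hQ, Matrix.conjTranspose_mul, Matrix.conjTranspose_conjTranspose]
    simp only [Matrix.mul_assoc]
  have hQu : IsUnit (Qᴴ).det := by
    rw [isUnit_iff_ne_zero]
    intro h
    have := h0.det_pos
    rw [hGQ, Matrix.det_mul, h] at this
    simp at this
  have hstep : ∀ k (hk : k + 1 ≤ n) (l : Fin (n+1)),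
      Q l ⟨k+1, by omega⟩ = x l * Q l ⟨k, by omega⟩ := by
    intro k hk l
    have hv : Qᴴ *ᵥ (fun l => Q l ⟨k+1, by omega⟩) = Qᴴ *ᵥ (fun l => x l * Q l ⟨k, by omega⟩) := by
      ext i
      have e1 := congrFun (congrFun hGQ i) ⟨k+1, by omega⟩
      have e2 := congrFun (congrFun hHQ i) ⟨k, by omega⟩
      rw [Matrix.mul_apply] at e1 e2
      simp only [Matrix.diagonal_mul] at e2
      simp only [Matrix.mulVec, dotProduct]
      rw [← e1, ← e2]
      simp [hG, hH, add_assoc]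
    have := Matrix.mulVec_injective_of_isUnit ((Matrix.isUnit_iff_isUnit_det _).mpr hQu) hv
    exact congrFun this l
  have hpow : ∀ k (hk : k ≤ n) (l : Fin (n+1)), Q l ⟨k, by omega⟩ = x l ^ k * Q l 0 := by
    intro k
    induction k with
    | zero => intro _ l; simp
    | succ k ih => intro hk l; rw [hstep k hk, ih (by omega)]; ring
  refine ⟨fun l => Q l 0 ^ 2, x, fun i => hC.eigenvalues_pos i, fun i => sq_nonneg _, ?_⟩
  intro k hk
  have e1 := congrFun (congrFun hGQ 0) ⟨k, by omega⟩
  rw [Matrix.mul_apply] at e1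
  simp only [hG, Matrix.of_apply, Fin.val_zero, zero_add] at e1
  rw [e1]
  apply Finset.sum_congr rfl
  intro l _
  rw [hpow k hk, Matrix.conjTranspose_apply]
  simp; ring


open Polynomial in
theorem hk_signVar (P : ℝ[X]) (hP : P ≠ 0) : P.signVariations + 1 ≤ P.support.card := by
  induction h : P.support.card using Nat.strong_induction_on generalizing P with
  | _ m ih =>
    subst h
    have hc := P.eraseLead_support_card_lt hP
    by_cases h0 : P.eraseLead = 0
    · have h1 : P = monomial P.natDegree P.leadingCoeff := by
        conv_lhs => rw [← eraseLead_add_monomial_natDegree_leadingCoeff P, h0, zero_add]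
      rw [h1, signVariations_monomial, ← h1]
      omega
    · have := ih _ hc P.eraseLead h0 rfl
      have := signVariations_le_eraseLead_succ P
      omega

open Polynomial in
theorem hk_vander (k : ℕ) : ∀ (x : Fin k → ℝ) (f : Fin k → ℕ), (∀ i, 0 < x i) → StrictMono x →
    StrictMono f → 0 < (Matrix.of fun i j => x i ^ f j).det := by
  induction k with
  | zero => intro x f _ _ _; simp
  | succ k ih =>
    intro x f hx hxm hfm
    set D : Fin (k+1) → ℝ := fun j =>
      (Matrix.of fun (i : Fin k) (l : Fin k) => x i.castSucc ^ f (j.succAbove l)).det with hD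
    have hDpos : ∀ j, 0 < D j := fun j =>
      ih (fun i => x i.castSucc) (fun l => f (j.succAbove l)) (fun i => hx _)
        (fun i j h => hxm (by simpa using h))
        (fun i l h => hfm (Fin.strictMono_succAbove j h))
    let p : ℝ[X] := ∑ j : Fin (k+1), monomial (f j) ((-1) ^ (k + j.1) * D j)
    have hdet : ∀ y : ℝ, p.eval y =
        (Matrix.of fun i j => (Fin.snoc (fun i : Fin k => x i.castSucc) y : Fin (k+1) → ℝ) i ^ f j).det := by
      intro y
      rw [Matrix.det_succ_row _ (Fin.last k)]
      simp only [p, eval_finsetSum, eval_monomial]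
      apply Finset.sum_congr rfl
      intro j _
      have : (Matrix.of fun i j => (Fin.snoc (fun i : Fin k => x i.castSucc) y : Fin (k+1) → ℝ) i ^ f j).submatrix
          (Fin.last k).succAbove j.succAbove = (Matrix.of fun (i : Fin k) (l : Fin k) => x i.castSucc ^ f (j.succAbove l)) := by
        ext i l; simp
      rw [this]
      simp [hD]; ring
    have hcoeff : ∀ j, p.coeff (f j) = (-1) ^ (k + j.1) * D j := by
      intro j
      simp only [p, finsetSum_coeff, coeff_monomial, hfm.injective.eq_iff]
      simp
    have hp0 : p ≠ 0 := by
      intro h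
      have := hcoeff 0
      rw [h] at this
      simp at this
      exact (hDpos 0).ne' this
    have hsupp : p.support.card ≤ k + 1 := by
      have : p.support ⊆ Finset.univ.image f := by
        intro m hm
        rw [mem_support_iff] at hm
        by_contra hn
        apply hm
        simp only [p, finsetSum_coeff, coeff_monomial]
        apply Finset.sum_eq_zero
        intro j _
        rw [if_neg]
        intro h; exact hn (by simp; exact ⟨j, h⟩)
      calc _ ≤ _ := Finset.card_le_card this
        _ ≤ _ := Finset.card_image_le
        _ = k + 1 := by simp
    have hroots : p.roots.countP (0 < ·) ≤ k := by
      have := roots_countP_pos_le_signVariations (P := p)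
      have := hk_signVar p hp0
      omega
    have hlc : f (Fin.last k) = p.natDegree := by
      apply le_antisymm
      · apply le_natDegree_of_ne_zero
        rw [hcoeff]
        exact mul_ne_zero (by simp) (hDpos _).ne'
      · apply natDegree_sum_le_of_forall_le
        intro j _
        exact (natDegree_monomial_le _).trans (hfm.monotone (Fin.le_last j))
    have hlead : 0 < p.leadingCoeff := by
      rw [leadingCoeff, ← hlc, hcoeff]
      simp [← two_mul, hDpos]
    have hroot : ∀ i : Fin k, p.eval (x i.castSucc) = 0 := by
      intro i
      rw [hdet]
      apply Matrix.det_zero_of_row_eq (i := i.castSucc) (j := Fin.last k)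
      · exact (Fin.castSucc_lt_last i).ne
      · ext j; simp
    have hnr : ∀ y, x (Fin.last k) ≤ y → p.eval y ≠ 0 := by
      intro y hy h0
      let s : Fin (k+1) → ℝ := Fin.snoc (fun i : Fin k => x i.castSucc) y
      have hs : Function.Injective s := by
        rw [Fin.snoc_injective_iff]
        refine ⟨fun i j h => by simpa using hxm.injective h, ?_⟩
        rintro ⟨i, hi⟩
        have := hxm (Fin.castSucc_lt_last i)
        simp only at hi
        linarith
      have hsub : (Finset.univ.image s).val ≤ p.roots.filter (0 < ·) := by
        rw [Finset.val_le_iff_val_subset]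
        intro z hz
        simp only [Finset.mem_val, Finset.mem_image, Finset.mem_univ, true_and] at hz
        obtain ⟨i, rfl⟩ := hz
        rw [Multiset.mem_filter, mem_roots hp0]
        refine Fin.lastCases ?_ (fun i => ?_) i
        · simp only [s, Fin.snoc_last]
          exact ⟨h0, (hx _).trans_le hy⟩
        · simp only [s, Fin.snoc_castSucc]
          exact ⟨hroot i, hx _⟩
      have := Multiset.card_le_card hsub
      rw [Finset.card_val, Finset.card_image_of_injective _ hs, ← Multiset.countP_eq_card_filter] at this
      simp at this
      omega
    have hsn : (Fin.snoc (fun i : Fin k => x i.castSucc) (x (Fin.last k)) : Fin (k+1) → ℝ) = x := by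
      exact Fin.snoc_init_self x
    have key := hdet (x (Fin.last k))
    rw [hsn] at key
    rw [← key]
    by_contra hneg
    have hlt : p.eval (x (Fin.last k)) < 0 :=
      lt_of_le_of_ne (not_lt.mp hneg) (hnr _ le_rfl)
    by_cases hk : 0 < p.degree
    · have ht := p.tendsto_atTop_of_leadingCoeff_nonneg hk hlead.le
      obtain ⟨y, hy1, hy2⟩ := ((ht.eventually_gt_atTop 0).and (Filter.eventually_ge_atTop (x (Fin.last k)))).exists
      have := intermediate_value_Icc hy2 (p.continuous.continuousOn (s := Set.Icc _ _))
      obtain ⟨z, hz, hz0⟩ := this ⟨hlt.le, hy1.le⟩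
      exact hnr z hz.1 hz0
    · have := eq_C_of_degree_le_zero (not_lt.mp hk)
      rw [this] at hlt hlead
      simp at hlt hlead
      linarith


/-- Andreief identity, finite version. -/
theorem hk_andreief {k N : ℕ} (w : Fin N → ℝ) (F G : Fin k → Fin N → ℝ) :
    (k.factorial : ℝ) * (Matrix.of fun i j => ∑ l, w l * (F i l * G j l)).det =
      ∑ s : Fin k → Fin N, (∏ i, w (s i)) *
        ((Matrix.of fun i j => F j (s i)).det * (Matrix.of fun i j => G j (s i)).det) := by
  have h1 : (Matrix.of fun i j => ∑ l, w l * (F i l * G j l)).det =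
      ∑ s : Fin k → Fin N, (∏ i, w (s i)) *
        ((Matrix.of fun i j => F j (s i)).det * (∏ i, G i (s i))) := by
    simp only [Matrix.det_apply' (Matrix.of fun i j => ∑ l, w l * (F i l * G j l)), Matrix.of_apply,
      Finset.prod_univ_sum, Finset.mul_sum, Fintype.piFinset_univ]
    rw [Finset.sum_comm]
    apply Finset.sum_congr rfl
    intro s _
    rw [← Matrix.det_transpose, Matrix.det_apply', Finset.sum_mul, Finset.mul_sum]
    apply Finset.sum_congr rfl
    intro σ _
    simp only [Finset.prod_mul_distrib, Matrix.transpose_apply, Matrix.of_apply]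
    ring
  have h2 : ∀ τ : Equiv.Perm (Fin k), (Matrix.of fun i j => ∑ l, w l * (F i l * G j l)).det =
      ∑ s : Fin k → Fin N, (∏ i, w (s i)) * ((Matrix.of fun i j => F j (s i)).det *
        ((Equiv.Perm.sign τ : ℤ) * ∏ i, G i (s (τ i)))) := by
    intro τ
    rw [h1, ← (Equiv.arrowCongr τ.symm (Equiv.refl (Fin N))).sum_comp]
    apply Finset.sum_congr rfl
    intro s _
    have e1 : ∀ i, (Equiv.arrowCongr τ.symm (Equiv.refl (Fin N))) s i = s (τ i) := fun i => by simp
    simp only [e1]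
    rw [Equiv.prod_comp τ (fun i => w (s i))]
    have := Matrix.det_permute τ (Matrix.of fun i j => F j (s i))
    have e2 : (Matrix.of fun i j => F j (s i)).submatrix τ id = (Matrix.of fun i j => F j (s (τ i))) := by
      ext i j; simp
    rw [e2] at this
    rw [this]
    ring
  have h3 : (k.factorial : ℝ) * (Matrix.of fun i j => ∑ l, w l * (F i l * G j l)).det =
      ∑ τ : Equiv.Perm (Fin k), (Matrix.of fun i j => ∑ l, w l * (F i l * G j l)).det := by
    simp [Fintype.card_perm]
  rw [h3, Finset.sum_congr rfl (fun τ _ => h2 τ), Finset.sum_comm]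
  apply Finset.sum_congr rfl
  intro s _
  rw [← Finset.mul_sum, ← Finset.mul_sum]
  congr 2
  exact (Matrix.det_apply' (Matrix.of fun i j => G j (s i))).symm

theorem hk_sorted {k : ℕ} (y : Fin k → ℝ) (hy : ∀ i, 0 < y i) (f g : Fin k → ℕ)
    (hf : StrictMono f) (hg : StrictMono g) :
    0 ≤ (Matrix.of fun i j => y i ^ f j).det * (Matrix.of fun i j => y i ^ g j).det ∧
    (Function.Injective y →
      0 < (Matrix.of fun i j => y i ^ f j).det * (Matrix.of fun i j => y i ^ g j).det) := by
  have key : Function.Injective y →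
      0 < (Matrix.of fun i j => y i ^ f j).det * (Matrix.of fun i j => y i ^ g j).det := by
    intro hi
    have hm : StrictMono (y ∘ Tuple.sort y) :=
      (Tuple.monotone_sort y).strictMono_of_injective (hi.comp (Equiv.injective _))
    have h1 : ∀ f : Fin k → ℕ, StrictMono f →
        0 < (Equiv.Perm.sign (Tuple.sort y) : ℤ) * (Matrix.of fun i j => y i ^ f j).det := by
      intro f hf
      have := hk_vander k _ f (fun i => hy _) hm hf
      have e := Matrix.det_permute (Tuple.sort y) (Matrix.of fun i j => y i ^ f j)
      have e2 : (Matrix.of fun i j => y i ^ f j).submatrix (Tuple.sort y) id =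
        (Matrix.of fun i j => (y ∘ Tuple.sort y) i ^ f j) := by
          ext i j; simp
      rw [e2] at e
      rw [← e]
      exact this
    have h2 := mul_pos (h1 f hf) (h1 g hg)
    rcases Int.units_eq_one_or (Equiv.Perm.sign (Tuple.sort y)) with h | h <;> rw [h] at h2 <;>
      simpa using h2
  refine ⟨?_, key⟩
  by_cases hi : Function.Injective y
  · exact (key hi).le
  · obtain ⟨i, j, hij, hne⟩ : ∃ i j, y i = y j ∧ i ≠ j := by
      simpa [Function.Injective] using hi
    rw [Matrix.det_zero_of_row_eq hne (by ext l; simp [hij])]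
    simp

theorem hk_tp (a : ℕ → ℝ) (h : ∀ n : ℕ, 1 ≤ n →
         (Matrix.of fun i j : Fin n => a (i.1 + j.1)).PosDef ∧
         (Matrix.of fun i j : Fin n => a (i.1 + j.1 + 1)).PosDef)
    (k : ℕ) (f g : Fin k → ℕ) (hf : StrictMono f) (hg : StrictMono g) :
    0 < (Matrix.of fun i j => a (f i + g j)).det := by
  obtain ⟨n, hn1, hn2⟩ : ∃ n, (∀ i j, f i + g j ≤ n) ∧ (∀ i j : Fin k, i.1 + j.1 ≤ n) := by
    refine ⟨(∑ i, f i) + (∑ i, g i) + k + k, fun i j => ?_, fun i j => ?_⟩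
    · have := Finset.single_le_sum (f := f) (fun _ _ => Nat.zero_le _) (Finset.mem_univ i)
      have := Finset.single_le_sum (f := g) (fun _ _ => Nat.zero_le _) (Finset.mem_univ j)
      omega
    · omega
  obtain ⟨w, x, hx, hw, ha⟩ := hk_quad a n (h (n+1) (by omega)).1 (h (n+1) (by omega)).2
  have rep : ∀ f g : Fin k → ℕ, (∀ i j, f i + g j ≤ n) →
      (k.factorial : ℝ) * (Matrix.of fun i j => a (f i + g j)).det =
      ∑ s : Fin k → Fin (n+1), (∏ i, w (s i)) *
        ((Matrix.of fun i j => x (s i) ^ f j).det * (Matrix.of fun i j => x (s i) ^ g j).det) := by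
    intro f g hfg
    rw [← hk_andreief w (fun i l => x l ^ f i) (fun j l => x l ^ g j)]
    congr 3
    ext i j
    rw [ha _ (hfg i j)]
    simp only [pow_add]
  have hfac : (0:ℝ) < k.factorial := by exact_mod_cast Nat.factorial_pos k
  have hdet : 0 < (Matrix.of fun i j : Fin k => a (i.1 + j.1)).det := by
    rcases Nat.eq_zero_or_pos k with rfl | hk
    · simp
    · exact (h k hk).1.det_pos
  have hid := rep (fun i => i.1) (fun i => i.1) hn2
  obtain ⟨s, -, hs⟩ : ∃ s ∈ (Finset.univ : Finset (Fin k → Fin (n+1))), (∏ i, w (s i)) *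
        ((Matrix.of fun i j : Fin k => x (s i) ^ j.1).det * (Matrix.of fun i j : Fin k => x (s i) ^ j.1).det) ≠ 0 := by
    apply Finset.exists_ne_zero_of_sum_ne_zero
    rw [← hid]
    positivity
  have hinj : Function.Injective (fun i => x (s i)) := by
    intro i j hij
    by_contra hne
    apply hs
    rw [Matrix.det_zero_of_row_eq hne (by ext l; simp only [Matrix.of_apply]; rw [show x (s i) = x (s j) from hij])]
    simp
  have hws : 0 < ∏ i, w (s i) :=
    lt_of_le_of_ne (Finset.prod_nonneg fun i _ => hw _) (left_ne_zero_of_mul hs).symm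
  have hpos : 0 < (k.factorial : ℝ) * (Matrix.of fun i j => a (f i + g j)).det := by
    rw [rep f g hn1]
    apply Finset.sum_pos'
    · intro t _
      exact mul_nonneg (Finset.prod_nonneg fun i _ => hw _)
        (hk_sorted (fun i => x (t i)) (fun i => hx _) f g hf hg).1
    · exact ⟨s, Finset.mem_univ _, mul_pos hws
        ((hk_sorted (fun i => x (s i)) (fun i => hx _) f g hf hg).2 hinj)⟩
  exact pos_of_mul_pos_right hpos hfac.le

section
open MeasureTheory

theorem hk_form (a : ℕ → ℝ) (μ : Measure ℝ)
    (hk : ∀ k : ℕ, Integrable (fun x => x ^ k) μ ∧ a k = ∫ x, x ^ k ∂μ) (m n : ℕ) (c : Fin n → ℝ) :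
    Integrable (fun x => x ^ m * (∑ i, c i * x ^ i.1) ^ 2) μ ∧
    c ⬝ᵥ ((Matrix.of fun i j : Fin n => a (i.1 + j.1 + m)).mulVec c) =
      ∫ x, x ^ m * (∑ i, c i * x ^ i.1) ^ 2 ∂μ := by
  have e : (fun x : ℝ => x ^ m * (∑ i, c i * x ^ i.1) ^ 2) =
      fun x => ∑ i, ∑ j, c i * c j * x ^ (i.1 + j.1 + m) := by
    ext x
    rw [sq, Finset.sum_mul_sum, Finset.mul_sum]
    apply Finset.sum_congr rfl
    intro i _
    rw [Finset.mul_sum]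
    apply Finset.sum_congr rfl
    intro j _
    ring
  have hi : ∀ i j : Fin n, Integrable (fun x => c i * c j * x ^ (i.1 + j.1 + m)) μ :=
    fun i j => (hk _).1.const_mul _
  rw [e]
  refine ⟨integrable_finsetSum _ fun i _ => integrable_finsetSum _ fun j _ => hi i j, ?_⟩
  rw [integral_finsetSum _ fun i _ => integrable_finsetSum _ fun j _ => hi i j]
  simp only [dotProduct, Matrix.mulVec]
  apply Finset.sum_congr rfl
  intro i _
  rw [integral_finsetSum _ fun j _ => hi i j, Finset.mul_sum]
  apply Finset.sum_congr rfl
  intro j _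
  rw [integral_const_mul, ← (hk _).2]
  simp only [Matrix.of_apply]; ring

open Polynomial in
theorem hk_posdef (a : ℕ → ℝ) (μ : Measure ℝ) (h0 : μ (Set.Iio 0) = 0)
    (hs : ∀ s : Finset ℝ, μ (↑s : Set ℝ)ᶜ ≠ 0)
    (hk : ∀ k : ℕ, Integrable (fun x => x ^ k) μ ∧ a k = ∫ x, x ^ k ∂μ) (m n : ℕ) :
    (Matrix.of fun i j : Fin n => a (i.1 + j.1 + m)).PosDef := by
  refine Matrix.PosDef.of_dotProduct_mulVec_pos ?_ ?_
  · ext i j; simp [add_comm]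
  · intro c hc
    obtain ⟨hint, hval⟩ := hk_form a μ hk m n c
    rw [star_trivial, hval]
    have hnn : 0 ≤ᵐ[μ] fun x => x ^ m * (∑ i, c i * x ^ i.1) ^ 2 := by
      have : ∀ᵐ x ∂μ, x ∉ Set.Iio (0:ℝ) := measure_eq_zero_iff_ae_notMem.mp h0
      filter_upwards [this] with x hx
      have : 0 ≤ x := by simpa using hx
      simp only [Pi.zero_apply]
      positivity
    rw [integral_pos_iff_support_of_nonneg_ae hnn hint]
    let p : ℝ[X] := ∑ i : Fin n, monomial i.1 (c i)
    have hp : p ≠ 0 := by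
      obtain ⟨j, hj⟩ := Function.ne_iff.mp hc
      intro h
      have : p.coeff j.1 = c j := by
        simp [p, coeff_monomial, Fin.val_inj]
      rw [h] at this
      exact hj (by simpa using this.symm)
    have hev : ∀ x, p.eval x = ∑ i, c i * x ^ i.1 := by
      intro x; simp [p, eval_finsetSum]
    refine lt_of_lt_of_le (pos_iff_ne_zero.mpr (hs (insert 0 p.roots.toFinset))) (measure_mono ?_)
    intro x hx
    simp [hp] at hx
    rw [Function.mem_support, ← hev]
    exact mul_ne_zero (pow_ne_zero _ hx.1) (pow_ne_zero _ hx.2)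

open Filter Topology CompactlySupported NNReal

theorem hk_exists (a : ℕ → ℝ)
    (h : ∀ n : ℕ, ∃ w x : Fin (n+1) → ℝ, (∀ i, 0 < x i) ∧ (∀ i, 0 ≤ w i) ∧
      ∀ k, k ≤ n → a k = ∑ i, w i * x i ^ k) :
    ∃ μ : Measure ℝ, μ (Set.Iio 0) = 0 ∧
         ∀ k : ℕ, Integrable (fun x => x ^ k) μ ∧ a k = ∫ x, x ^ k ∂μ := by
  choose w x hx hw ha using h
  let y : ∀ n, Fin (n+1) → ℝ≥0 := fun n i => ⟨x n i, (hx n i).le⟩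
  let S : ℕ → (ℝ≥0 → ℝ) → ℝ := fun n f => ∑ i, w n i * f (y n i)
  have hlim : ∀ f : C_c(ℝ≥0, ℝ), ∃ L, Tendsto (fun n => S n f) (hyperfilter ℕ : Filter ℕ) (𝓝 L) := by
    intro f
    obtain ⟨C, hC⟩ := f.hasCompactSupport.exists_bound_of_continuous f.continuous
    have hb : ∀ n, S n f ∈ Set.Icc (-(C * a 0)) (C * a 0) := by
      intro n
      rw [Set.mem_Icc, ← abs_le]
      have h0 := ha n 0 (Nat.zero_le _)
      simp only [pow_zero, mul_one] at h0
      rw [h0, Finset.mul_sum]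
      refine (Finset.abs_sum_le_sum_abs _ _).trans (Finset.sum_le_sum fun i _ => ?_)
      rw [abs_mul, abs_of_nonneg (hw n i), mul_comm]
      exact mul_le_mul_of_nonneg_right (hC _) (hw n i)
    obtain ⟨L, -, hL⟩ := (isCompact_Icc (a := -(C * a 0)) (b := C * a 0)).ultrafilter_le_nhds
      ((hyperfilter ℕ).map (fun n => S n f)) (by
        rw [Ultrafilter.coe_map]
        exact le_principal_iff.mpr (mem_map.mpr (Filter.univ_mem' hb)))
    exact ⟨L, hL⟩
  choose Λ hΛ using hlim
  let T : C_c(ℝ≥0, ℝ) →ₗ[ℝ] ℝ :=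
    { toFun := Λ
      map_add' := fun f g => by
        refine tendsto_nhds_unique (hΛ (f + g)) (((hΛ f).add (hΛ g)).congr fun n => ?_)
        simp [S, mul_add, Finset.sum_add_distrib]
      map_smul' := fun c f => by
        refine tendsto_nhds_unique (hΛ (c • f)) (((hΛ f).const_mul c).congr fun n => ?_)
        simp only [S, Finset.mul_sum]
        apply Finset.sum_congr rfl
        intro i _
        simp; ring }
  let P : C_c(ℝ≥0, ℝ) →ₚ[ℝ] ℝ := PositiveLinearMap.mk₀ T (by
    intro f hf
    refine ge_of_tendsto' (hΛ f) fun n => Finset.sum_nonneg fun i _ => mul_nonneg (hw n i) (hf _))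
  have hP : ∀ f, P f = Λ f := fun f => rfl
  let ν := RealRMK.rieszMeasure P
  have hν : ∀ f : C_c(ℝ≥0, ℝ), ∫ t, f t ∂ν = Λ f := fun f => by
    rw [← hP]; exact RealRMK.integral_rieszMeasure P f
  -- cutoffs
  have hcut : ∀ k R : ℕ, ∃ f : C_c(ℝ≥0, ℝ), ∀ t : ℝ≥0,
      f t = (t:ℝ) ^ k * max 0 (min 1 (2 - (t:ℝ) / (R + 1))) := by
    intro k R
    refine ⟨⟨⟨fun t : ℝ≥0 => (t:ℝ) ^ k * max 0 (min 1 (2 - (t:ℝ) / (R + 1))), by fun_prop⟩, ?_⟩,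
      fun t => rfl⟩
    apply HasCompactSupport.intro (isCompact_Icc (a := (0:ℝ≥0)) (b := 2 * (R + 1)))
    intro t ht
    have ht2 : 2 * ((R:ℝ) + 1) < t := by
      have : 2 * ((R:ℝ≥0) + 1) < t := by simpa using ht
      exact_mod_cast this
    have hR : (0:ℝ) < R + 1 := by positivity
    have : 2 - (t:ℝ) / (R + 1) ≤ 0 := by
      rw [sub_nonpos, le_div_iff₀ hR]; exact ht2.le
    simp only [ContinuousMap.coe_mk]
    rw [max_eq_left ((min_le_right _ _).trans this), mul_zero]
  choose F hF using hcut
  have hF0 : ∀ k R t, 0 ≤ F k R t := by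
    intro k R t; rw [hF]; positivity
  have hF1 : ∀ k R t, F k R t ≤ (t:ℝ) ^ k := by
    intro k R t; rw [hF]
    exact mul_le_of_le_one_right (by positivity) (max_le zero_le_one (min_le_left _ _))
  have hF2 : ∀ (k R : ℕ) (t : ℝ≥0), (t:ℝ) ^ k - (t:ℝ) ^ (k+1) / (R + 1) ≤ F k R t := by
    intro k R t; rw [hF]
    have hR : (0:ℝ) < R + 1 := by positivity
    have : 1 - (t:ℝ) / (R+1) ≤ max 0 (min 1 (2 - (t:ℝ) / (R + 1))) := by
      apply le_max_of_le_right
      apply le_min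
      · have : 0 ≤ (t:ℝ) / (R+1) := by positivity
        linarith
      · linarith
    calc _ = (t:ℝ) ^ k * (1 - (t:ℝ) / (R+1)) := by field_simp; ring
      _ ≤ _ := mul_le_mul_of_nonneg_left this (by positivity)
  have hSk : ∀ k n, k ≤ n → S n (fun t => (t:ℝ) ^ k) = a k := fun k n hkn => (ha n k hkn).symm
  have hev : ∀ k, ∀ᶠ n in (hyperfilter ℕ : Filter ℕ), k ≤ n := fun k => by
    have h1 : (hyperfilter ℕ : Filter ℕ) ≤ atTop := by
      rw [← Nat.cofinite_eq_atTop]; exact hyperfilter_le_cofinite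
    exact h1 (eventually_ge_atTop k)
  have hSmono : ∀ n (f g : ℝ≥0 → ℝ), (∀ t, f t ≤ g t) → S n f ≤ S n g := fun n f g hfg =>
    Finset.sum_le_sum fun i _ => mul_le_mul_of_nonneg_left (hfg _) (hw n i)
  have hΛle : ∀ k R, Λ (F k R) ≤ a k := by
    intro k R
    apply le_of_tendsto (hΛ (F k R))
    filter_upwards [hev k] with n hn
    rw [← hSk k n hn]
    exact hSmono n _ _ (hF1 k R)
  have hΛge : ∀ k (R : ℕ), a k - a (k+1) / (R + 1) ≤ Λ (F k R) := by
    intro k R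
    apply ge_of_tendsto (hΛ (F k R))
    filter_upwards [hev (k+1)] with n hn
    rw [← hSk k n (by omega), ← hSk (k+1) n hn]
    refine le_trans (le_of_eq ?_) (hSmono n _ _ (hF2 k R))
    simp only [S, mul_sub, Finset.sum_sub_distrib, Finset.sum_div, mul_div_assoc]
  have hΛt : ∀ k, Tendsto (fun R => Λ (F k R)) atTop (𝓝 (a k)) := by
    intro k
    refine tendsto_of_tendsto_of_tendsto_of_le_of_le ?_ tendsto_const_nhds (hΛge k) (hΛle k)
    have := (tendsto_one_div_add_atTop_nhds_zero_nat (𝕜 := ℝ)).const_mul (a (k+1))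
    have := (tendsto_const_nhds (x := a k)).sub this
    simpa [div_eq_mul_inv] using this
  have ha0 : ∀ k, 0 ≤ a k := by
    intro k
    rw [ha k k le_rfl]
    exact Finset.sum_nonneg fun i _ => mul_nonneg (hw _ _) (pow_nonneg (hx _ _).le _)
  have hlint : ∀ k, ∫⁻ t, ENNReal.ofReal ((t:ℝ) ^ k) ∂ν = ENNReal.ofReal (a k) := by
    intro k
    have h1 : Tendsto (fun R => ∫⁻ t, ENNReal.ofReal (F k R t) ∂ν) atTop
        (𝓝 (∫⁻ t, ENNReal.ofReal ((t:ℝ) ^ k) ∂ν)) := by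
      apply lintegral_tendsto_of_tendsto_of_monotone
      · intro R
        exact (ENNReal.measurable_ofReal.comp (F k R).continuous.measurable).aemeasurable
      · refine Eventually.of_forall fun t => ?_
        intro R R' hRR
        apply ENNReal.ofReal_le_ofReal
        rw [hF, hF]
        have : (R:ℝ) ≤ R' := by exact_mod_cast hRR
        gcongr
      · refine Eventually.of_forall fun t => ?_
        apply (ENNReal.continuous_ofReal.tendsto _).comp
        refine tendsto_of_tendsto_of_tendsto_of_le_of_le ?_ tendsto_const_nhds
          (fun R => hF2 k R t) (fun R => hF1 k R t)
        have := (tendsto_one_div_add_atTop_nhds_zero_nat (𝕜 := ℝ)).const_mul ((t:ℝ) ^ (k+1))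
        have := (tendsto_const_nhds (x := (t:ℝ) ^ k)).sub this
        simpa [div_eq_mul_inv] using this
    have h2 : ∀ R, ∫⁻ t, ENNReal.ofReal (F k R t) ∂ν = ENNReal.ofReal (Λ (F k R)) := by
      intro R
      rw [← hν, ofReal_integral_eq_lintegral_ofReal]
      · exact (F k R).continuous.integrable_of_hasCompactSupport (F k R).hasCompactSupport
      · exact Eventually.of_forall (hF0 k R)
    simp only [h2] at h1
    exact tendsto_nhds_unique h1 ((ENNReal.continuous_ofReal.tendsto _).comp (hΛt k))
  have hcoe : Measurable ((↑) : ℝ≥0 → ℝ) := measurable_coe_nnreal_real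
  refine ⟨ν.map (↑), ?_, ?_⟩
  · rw [Measure.map_apply hcoe measurableSet_Iio]
    have : ((↑) : ℝ≥0 → ℝ) ⁻¹' Set.Iio 0 = ∅ := by
      ext t; simp
    rw [this]; simp
  · intro k
    have hm : AEStronglyMeasurable (fun x : ℝ => x ^ k) (ν.map ((↑) : ℝ≥0 → ℝ)) :=
      (continuous_pow k).aestronglyMeasurable
    have hint : Integrable (fun t : ℝ≥0 => (t:ℝ) ^ k) ν := by
      refine ⟨(by fun_prop : Continuous fun t : ℝ≥0 => (t:ℝ) ^ k).aestronglyMeasurable, ?_⟩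
      rw [hasFiniteIntegral_iff_ofReal (Eventually.of_forall fun t => by positivity), hlint]
      exact ENNReal.ofReal_lt_top
    refine ⟨(integrable_map_measure hm hcoe.aemeasurable).mpr hint, ?_⟩
    rw [integral_map hcoe.aemeasurable hm, integral_eq_lintegral_of_nonneg_ae
      (Eventually.of_forall fun t => by positivity) hint.1, hlint, ENNReal.toReal_ofReal (ha0 k)]

end

open MeasureTheory Polynomial in
theorem hk_infinite (a : ℕ → ℝ) (μ : Measure ℝ)
    (h : ∀ n : ℕ, 1 ≤ n → (Matrix.of fun i j : Fin n => a (i.1 + j.1)).PosDef)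
    (hk : ∀ k : ℕ, Integrable (fun x => x ^ k) μ ∧ a k = ∫ x, x ^ k ∂μ) (s : Finset ℝ) :
    μ (↑s : Set ℝ)ᶜ ≠ 0 := by
  intro hs
  let p : ℝ[X] := ∏ r ∈ s, (X - C r)
  have hp : p.Monic := monic_prod_of_monic _ _ fun r _ => monic_X_sub_C r
  let c : Fin (p.natDegree + 1) → ℝ := fun i => p.coeff i.1
  have hc : c ≠ 0 := by
    intro h0
    have := congrFun h0 (Fin.last _)
    simp only [c, Fin.val_last, Pi.zero_apply, hp.coeff_natDegree] at this
    exact one_ne_zero this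
  have hev : ∀ x, ∑ i, c i * x ^ i.1 = p.eval x := by
    intro x
    rw [eval_eq_sum_range, Finset.sum_range]
  have hpos := (h (p.natDegree + 1) (by omega)).dotProduct_mulVec_pos hc
  have hval := (hk_form a μ hk 0 (p.natDegree + 1) c).2
  simp only [add_zero] at hval
  rw [star_trivial, hval] at hpos
  apply hpos.ne'
  apply integral_eq_zero_of_ae
  have hae : ∀ᵐ x ∂μ, x ∉ (↑s : Set ℝ)ᶜ := measure_eq_zero_iff_ae_notMem.mp hs
  filter_upwards [hae] with x hx
  have hxs : x ∈ s := by simpa using hx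
  rw [hev]
  have : p.eval x = 0 := by
    simp only [p, eval_prod]
    exact Finset.prod_eq_zero hxs (by simp)
  simp [this]

open MeasureTheory in
/-- Theorem 2.9. For a real sequence `a`, the following are equivalent:
(a) every Hankel matrix `H_n^{(0)}(a)` is totally positive;
(b) `H_n^{(0)}(a)` and `H_n^{(1)}(a)` are positive definite for all `n ≥ 1`;
(c) `det H_n^{(0)}(a) > 0` and `det H_n^{(1)}(a) > 0` for all `n ≥ 1`;
(d) `a` is the moment sequence of a positive measure on `[0,∞)` with infinite support. -/
theorem hankel_stieltjes_tfae (a : ℕ → ℝ) :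
    List.TFAE
      [∀ n : ℕ, 1 ≤ n →
         IsTPr (Matrix.of fun i j : Fin n => a (i.1 + j.1)) n,
       ∀ n : ℕ, 1 ≤ n →
         (Matrix.of fun i j : Fin n => a (i.1 + j.1)).PosDef ∧
         (Matrix.of fun i j : Fin n => a (i.1 + j.1 + 1)).PosDef,
       ∀ n : ℕ, 1 ≤ n →
         0 < (Matrix.of fun i j : Fin n => a (i.1 + j.1)).det ∧
         0 < (Matrix.of fun i j : Fin n => a (i.1 + j.1 + 1)).det,
       ∃ μ : Measure ℝ,
         μ (Set.Iio 0) = 0 ∧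
         (∀ s : Finset ℝ, μ (↑s : Set ℝ)ᶜ ≠ 0) ∧
         ∀ k : ℕ, Integrable (fun x => x ^ k) μ ∧ a k = ∫ x, x ^ k ∂μ] := by
  tfae_have 1 → 3 := by
    intro h n hn
    refine ⟨?_, ?_⟩
    · exact h n hn n le_rfl id id strictMono_id strictMono_id
    · have := h (n+1) (by omega) n (by omega) Fin.castSucc Fin.succ
        (Fin.strictMono_castSucc) (Fin.strictMono_succ)
      have e : (Matrix.of fun i j : Fin (n+1) => a (i.1 + j.1)).submatrix Fin.castSucc Fin.succ =
          (Matrix.of fun i j : Fin n => a (i.1 + j.1 + 1)) := by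
        ext i j; simp [add_assoc]
      rwa [e] at this
  tfae_have 3 → 2 := by
    intro h n _
    refine ⟨hk_sylvester a (fun n hn => (h n hn).1) n, ?_⟩
    exact hk_sylvester (fun k => a (k + 1)) (fun n hn => (h n hn).2) n
  tfae_have 2 → 1 := by
    intro h n _ k _ f g hf hg
    exact hk_tp a h k (fun i => (f i).1) (fun i => (g i).1) hf hg
  tfae_have 4 → 2 := by
    rintro ⟨μ, h0, hs, hk⟩ n _
    exact ⟨hk_posdef a μ h0 hs hk 0 n, hk_posdef a μ h0 hs hk 1 n⟩
  tfae_have 2 → 4 := by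
    intro h
    obtain ⟨μ, h0, hk⟩ := hk_exists a
      (fun n => hk_quad a n (h (n+1) (by omega)).1 (h (n+1) (by omega)).2)
    refine ⟨μ, h0, hk_infinite a μ (fun n hn => (h n hn).1) hk, hk⟩
  tfae_finish
end

section
/- Let A be an n-by-n Hankel matrix of real numbers, all of whose contiguous minors of size at most r are nonnegative. Then A is totally nonnegative of order r (TN_r). -/
open Matrix

lemma hk_quad_add {k : ℕ} (H : Matrix (Fin k) (Fin k) ℝ) (hs : H.IsSymm) (y z : Fin k → ℝ) (t : ℝ) :
    (y + t • z) ⬝ᵥ H *ᵥ (y + t • z) =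
      y ⬝ᵥ H *ᵥ y + 2 * t * (y ⬝ᵥ H *ᵥ z) + t ^ 2 * (z ⬝ᵥ H *ᵥ z) := by
  have h1 : z ⬝ᵥ H *ᵥ y = y ⬝ᵥ H *ᵥ z := by
    rw [dotProduct_mulVec, ← mulVec_transpose, hs.eq, dotProduct_comm]
  simp only [mulVec_add, mulVec_smul, dotProduct_add, add_dotProduct, smul_dotProduct,
    dotProduct_smul, smul_eq_mul, h1]
  ring

lemma hk_dot_single {k : ℕ} (i0 : Fin k) (y u : Fin k → ℝ) (hu : ∀ i, i ≠ i0 → u i = 0) :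
    y ⬝ᵥ u = y i0 * u i0 := by
  unfold dotProduct
  rw [Finset.sum_eq_single i0]
  · intro b _ hb; rw [hu b hb, mul_zero]
  · simp

lemma hk_red {k : ℕ} (H : Matrix (Fin k) (Fin k) ℝ) (hs : H.IsSymm) (i0 : Fin k) (z : Fin k → ℝ)
    (hz : z i0 ≠ 0) (hu : ∀ i, i ≠ i0 → (H *ᵥ z) i = 0) (hp : 0 ≤ z i0 * (H *ᵥ z) i0)
    (hq : ∀ x : Fin k → ℝ, x i0 = 0 → 0 ≤ x ⬝ᵥ H *ᵥ x) (x : Fin k → ℝ) :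
    0 ≤ x ⬝ᵥ H *ᵥ x := by
  have e : x = (x - (x i0 / z i0) • z) + (x i0 / z i0) • z := by simp
  have h0 : (x - (x i0 / z i0) • z) i0 = 0 := by simp [hz]
  rw [e, hk_quad_add H hs, hk_dot_single i0 _ _ hu, hk_dot_single i0 _ _ hu, h0]
  have := hq _ h0
  have := mul_nonneg (sq_nonneg (x i0 / z i0)) hp
  linarith

/-- singular case -/
lemma hk_sing {k : ℕ} (H : Matrix (Fin (k+1)) (Fin (k+1)) ℝ) (hs : H.IsSymm)
    (hH : ∀ i j : Fin k, H i.castSucc j.succ = H i.succ j.castSucc)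
    (hl : ∀ x : Fin (k+1) → ℝ, x (Fin.last k) = 0 → 0 ≤ x ⬝ᵥ H *ᵥ x)
    (ht : ∀ x : Fin (k+1) → ℝ, x 0 = 0 → 0 ≤ x ⬝ᵥ H *ᵥ x)
    (hd : H.det = 0) (x : Fin (k+1) → ℝ) : 0 ≤ x ⬝ᵥ H *ᵥ x := by
  by_contra hx
  have key : ∀ z : Fin (k+1) → ℝ, (∀ i, i ≠ 0 → (H *ᵥ z) i = 0) → 0 ≤ z 0 * (H *ᵥ z) 0 →
      z 0 = 0 := by
    intro z hu hp
    by_contra hz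
    exact hx (hk_red H hs 0 z hz hu hp ht x)
  obtain ⟨v, hv, hv0⟩ := Matrix.exists_mulVec_eq_zero_iff.2 hd
  have main : ∀ j : ℕ, ∀ hj : j < k + 1, ∀ v : Fin (k+1) → ℝ, H *ᵥ v = 0 → v ⟨j, hj⟩ = 0 := by
    intro j
    induction j with
    | zero =>
      intro hj v hv
      exact key v (by simp [hv]) (by simp [hv])
    | succ j ih =>
      intro hj v hv
      have h0 : v 0 = 0 := key v (by simp [hv]) (by simp [hv])
      set w : Fin (k+1) → ℝ := Fin.snoc (fun i : Fin k => v i.succ) 0 with hw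
      have hwl : w (Fin.last k) = 0 := by simp [hw]
      have hwc : ∀ i : Fin k, w i.castSucc = v i.succ := by intro i; simp [hw]
      have hHw : ∀ i, i ≠ 0 → (H *ᵥ w) i = 0 := by
        intro i hi
        obtain ⟨i, rfl⟩ := Fin.exists_succ_eq.2 hi
        have := congrFun hv i.castSucc
        simp only [mulVec, dotProduct, Pi.zero_apply] at this ⊢
        rw [Fin.sum_univ_succ, h0] at this
        rw [Fin.sum_univ_castSucc, hwl]
        simp only [hwc, ← hH]
        linarith
      have hQ := hk_dot_single 0 w _ hHw
      have hw0 : w 0 = 0 := key w hHw (hQ ▸ hl w hwl)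
      have hb : (H *ᵥ w) 0 = 0 := by
        have hne : Fin.last k ≠ 0 := by
          intro h; have := congrArg Fin.val h; simp at this; omega
        have hall : ∀ t : ℝ, 0 ≤ 2 * t * (H *ᵥ w) 0 + t ^ 2 * H 0 0 := by
          intro t
          have h1 := hl (w + t • Pi.single 0 1) (by simp [hwl, hne])
          rw [hk_quad_add H hs, hQ, hw0] at h1
          have h2 : w ⬝ᵥ H *ᵥ Pi.single 0 1 = (H *ᵥ w) 0 := by
            rw [dotProduct_mulVec, ← mulVec_transpose, hs.eq]; simp
          have h3 : (Pi.single 0 1 : Fin (k+1) → ℝ) ⬝ᵥ H *ᵥ Pi.single 0 1 = H 0 0 := by simp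
          rw [h2, h3] at h1
          linarith
        set b := (H *ᵥ w) 0
        have ha : 0 ≤ H 0 0 := by nlinarith [hall 1, hall (-1)]
        have h1 := hall (- b / (H 0 0 + 1))
        have h2 : 2 * (- b / (H 0 0 + 1)) * b + (- b / (H 0 0 + 1)) ^ 2 * H 0 0
            = - (b ^ 2 * (H 0 0 + 2)) / (H 0 0 + 1) ^ 2 := by
          field_simp; ring
        rw [h2, le_div_iff₀ (by positivity)] at h1
        have : b ^ 2 = 0 := by nlinarith [sq_nonneg b]
        exact pow_eq_zero_iff (two_ne_zero) |>.1 this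
      have hker : H *ᵥ w = 0 := by
        funext i
        by_cases hi : i = 0
        · rw [hi, hb]; rfl
        · exact hHw i hi
      have := ih (by omega) w hker
      rw [show (⟨j, by omega⟩ : Fin (k+1)) = (⟨j, by omega⟩ : Fin k).castSucc from rfl, hwc] at this
      exact this
  exact hv (funext fun i => main i.1 i.2 v hv0)

lemma hk_lead {k : ℕ} (H : Matrix (Fin (k+1)) (Fin (k+1)) ℝ) (x : Fin (k+1) → ℝ)
    (hx : x (Fin.last k) = 0) : x ⬝ᵥ H *ᵥ x =
      (x ∘ Fin.castSucc) ⬝ᵥ (H.submatrix Fin.castSucc Fin.castSucc) *ᵥ (x ∘ Fin.castSucc) := by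
  simp [dotProduct, mulVec, Fin.sum_univ_castSucc, hx]

lemma hk_trail {k : ℕ} (H : Matrix (Fin (k+1)) (Fin (k+1)) ℝ) (x : Fin (k+1) → ℝ)
    (hx : x 0 = 0) : x ⬝ᵥ H *ᵥ x =
      (x ∘ Fin.succ) ⬝ᵥ (H.submatrix Fin.succ Fin.succ) *ᵥ (x ∘ Fin.succ) := by
  simp [dotProduct, mulVec, Fin.sum_univ_succ, hx]

lemma hk_psd {k : ℕ} (H : Matrix (Fin k) (Fin k) ℝ) (hs : H.IsSymm)
    (h : ∀ x : Fin k → ℝ, 0 ≤ x ⬝ᵥ H *ᵥ x) : H.PosSemidef := by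
  refine Matrix.PosSemidef.of_dotProduct_mulVec_nonneg ?_ ?_
  · rw [Matrix.IsHermitian, conjTranspose_eq_transpose_of_trivial]; exact hs
  · simpa using h

/-- positive determinant case -/
lemma hk_pos {k : ℕ} (H : Matrix (Fin (k+1)) (Fin (k+1)) ℝ) (hs : H.IsSymm)
    (hl : (H.submatrix Fin.castSucc Fin.castSucc).PosSemidef)
    (hd : 0 < H.det) (x : Fin (k+1) → ℝ) : 0 ≤ x ⬝ᵥ H *ᵥ x := by
  have hstep : ∀ ε : ℝ, 0 < ε → 0 < (H + ε • (1 : Matrix _ _ ℝ)).det →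
      0 ≤ x ⬝ᵥ (H + ε • (1 : Matrix _ _ ℝ)) *ᵥ x := by
    intro ε hε hdet
    set P := H + ε • (1 : Matrix (Fin (k+1)) (Fin (k+1)) ℝ) with hP
    have hPs : P.IsSymm := by
      unfold Matrix.IsSymm at *
      simp [hP, hs]
    have hsub : P.submatrix Fin.castSucc Fin.castSucc =
        H.submatrix Fin.castSucc Fin.castSucc + ε • (1 : Matrix (Fin k) (Fin k) ℝ) := by
      ext i j
      simp [hP, Matrix.one_apply]
    have hPD : (P.submatrix Fin.castSucc Fin.castSucc).PosDef := by
      rw [hsub]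
      exact Matrix.PosDef.posSemidef_add hl (Matrix.PosDef.one.smul hε)
    have hmul : ∀ i, (P *ᵥ (fun j => P.adjugate j (Fin.last k))) i =
        P.det * (1 : Matrix (Fin (k+1)) (Fin (k+1)) ℝ) i (Fin.last k) := by
      intro i
      have := congrFun (congrFun (Matrix.mul_adjugate P) i) (Fin.last k)
      simpa [Matrix.mul_apply, mulVec, dotProduct] using this
    have hz : P.adjugate (Fin.last k) (Fin.last k) =
        (P.submatrix Fin.castSucc Fin.castSucc).det := by
      rw [Matrix.adjugate_fin_succ_eq_det_submatrix]
      simp [Fin.succAbove_last]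
    have hzp : 0 < P.adjugate (Fin.last k) (Fin.last k) := hz ▸ hPD.det_pos
    refine hk_red P hPs (Fin.last k) (fun j => P.adjugate j (Fin.last k)) hzp.ne' ?_ ?_ ?_ x
    · intro i hi
      rw [hmul, Matrix.one_apply_ne hi, mul_zero]
    · rw [hmul, Matrix.one_apply_eq]; positivity
    · intro y hy
      rw [hk_lead P y hy]
      simpa using hPD.posSemidef.dotProduct_mulVec_nonneg (y ∘ Fin.castSucc)
  have hc : Continuous fun ε : ℝ => (H + ε • (1 : Matrix (Fin (k+1)) (Fin (k+1)) ℝ)) := by fun_prop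
  have hcd := hc.matrix_det
  have hcq : Continuous fun ε : ℝ =>
      x ⬝ᵥ (H + ε • (1 : Matrix (Fin (k+1)) (Fin (k+1)) ℝ)) *ᵥ x := by
    simp only [add_mulVec, smul_mulVec, dotProduct_add, dotProduct_smul]
    fun_prop
  have h1 : ∀ᶠ ε in nhdsWithin (0:ℝ) (Set.Ioi 0),
      0 < (H + ε • (1 : Matrix (Fin (k+1)) (Fin (k+1)) ℝ)).det := by
    apply Filter.Tendsto.eventually_const_lt _ (hcd.continuousWithinAt (x := 0))
    simpa using hd
  have h2 := (hcq.continuousWithinAt (s := Set.Ioi 0) (x := 0)).tendsto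
  have := ge_of_tendsto h2 (b := 0) (by
    filter_upwards [h1, self_mem_nhdsWithin] with ε h1 h2
    exact hstep ε h2 h1)
  simpa using this

def hkM (s : ℕ → ℝ) (c k : ℕ) : Matrix (Fin k) (Fin k) ℝ := Matrix.of fun i j => s (c + i.1 + j.1)

lemma hkM_psd (s : ℕ → ℝ) (k : ℕ) : ∀ c : ℕ,
    (∀ k' c', k' ≤ k → c ≤ c' → c' + 2 * k' ≤ c + 2 * k → 0 ≤ (hkM s c' k').det) →
    (hkM s c k).PosSemidef := by
  induction k with
  | zero =>
    intro c _
    exact hk_psd _ (by ext i; exact i.elim0) (by simp [dotProduct])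
  | succ k ih =>
    intro c h
    have hs : (hkM s c (k+1)).IsSymm := by
      ext i j; simp [hkM]; congr 1; omega
    have e1 : (hkM s c (k+1)).submatrix Fin.castSucc Fin.castSucc = hkM s c k := by
      ext i j; simp [hkM]
    have e2 : (hkM s c (k+1)).submatrix Fin.succ Fin.succ = hkM s (c+2) k := by
      ext i j; simp [hkM]; congr 1; omega
    have p1 := ih c (fun k' c' a b d => h k' c' (by omega) b (by omega))
    have p2 := ih (c+2) (fun k' c' a b d => h k' c' (by omega) (by omega) (by omega))
    refine hk_psd _ hs ?_
    rcases (h (k+1) c le_rfl le_rfl le_rfl).eq_or_lt with hd | hd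
    · refine hk_sing _ hs ?_ ?_ ?_ hd.symm
      · intro i j; simp [hkM]; congr 1; omega
      · intro x hx
        rw [hk_lead _ x hx, e1]
        simpa using p1.dotProduct_mulVec_nonneg (x ∘ Fin.castSucc)
      · intro x hx
        rw [hk_trail _ x hx, e2]
        simpa using p2.dotProduct_mulVec_nonneg (x ∘ Fin.succ)
    · exact hk_pos _ hs (e1 ▸ p1) hd

lemma hkM_pd (n c k : ℕ) (hk : k ≤ n) :
    (hkM (fun m => ∑ t : Fin n, ((t.1 : ℝ) + 1) ^ m) c k).PosDef := by
  have hs : (hkM (fun m => ∑ t : Fin n, ((t.1 : ℝ) + 1) ^ m) c k).IsSymm := by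
    ext i j; simp [hkM]; refine Finset.sum_congr rfl fun t _ => ?_; congr 1; omega
  have hQ : ∀ x : Fin k → ℝ, x ⬝ᵥ hkM (fun m => ∑ t : Fin n, ((t.1 : ℝ) + 1) ^ m) c k *ᵥ x =
      ∑ t : Fin n, ((t.1 : ℝ) + 1) ^ c * (∑ i, x i * ((t.1 : ℝ) + 1) ^ i.1) ^ 2 := by
    intro x
    simp only [dotProduct, mulVec, hkM, Matrix.of_apply, sq, Finset.mul_sum, Finset.sum_mul]
    rw [Finset.sum_congr rfl fun _ _ => Finset.sum_comm, Finset.sum_comm]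
    refine Finset.sum_congr rfl fun t _ => ?_
    rw [Finset.sum_comm]
    refine Finset.sum_congr rfl fun i _ => ?_
    refine Finset.sum_congr rfl fun j _ => ?_
    rw [pow_add, pow_add]; ring
  refine Matrix.PosDef.of_dotProduct_mulVec_pos ?_ ?_
  · rw [Matrix.IsHermitian, conjTranspose_eq_transpose_of_trivial]; exact hs
  · intro x hx
    simp only [star_trivial]
    rw [hQ]
    have h0 : ∀ t : Fin n, 0 ≤ ((t.1 : ℝ) + 1) ^ c * (∑ i, x i * ((t.1 : ℝ) + 1) ^ i.1) ^ 2 :=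
      fun t => by positivity
    refine lt_of_le_of_ne (Finset.sum_nonneg fun t _ => h0 t) ?_
    intro h
    apply hx
    have h1 := (Finset.sum_eq_zero_iff_of_nonneg (fun t _ => h0 t)).1 h.symm
    refine Matrix.eq_zero_of_forall_index_sum_mul_pow_eq_zero
      (f := fun t : Fin k => ((t.1 : ℝ) + 1)) ?_ ?_
    · intro a b hab; simpa [Fin.ext_iff] using hab
    · intro j
      have := h1 (Fin.castLE hk j) (Finset.mem_univ _)
      have hne : ((j.1 : ℝ) + 1) ^ c ≠ 0 := by positivity
      simp only [Fin.val_castLE, mul_eq_zero, hne, false_or] at this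
      simpa using this

/-- moving a column to the front -/
lemma fk_front {m : ℕ} {κ : Type*} (N : Matrix (Fin (m+1)) κ ℝ) (g : Fin (m+1) → κ) (p : Fin (m+1)) :
    (N.submatrix id (Fin.cons (g p) (g ∘ p.succAbove) : Fin (m+1) → κ)).det =
      (-1) ^ p.1 * (N.submatrix id g).det := by
  rw [Matrix.det_succ_column _ 0, Matrix.det_succ_column _ p, Finset.mul_sum]
  refine Finset.sum_congr rfl fun i _ => ?_
  have e : (N.submatrix id (Fin.cons (g p) (g ∘ p.succAbove) : Fin (m+1) → κ)).submatrix
      i.succAbove (Fin.succAbove 0) = (N.submatrix id g).submatrix i.succAbove p.succAbove := by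
    ext a b; simp
  rw [e]
  have : ((-1:ℝ) ^ p.1) * (-1) ^ p.1 = 1 := by rw [← mul_pow]; simp
  simp only [Matrix.submatrix_apply, Fin.cons_zero, id, pow_add, Fin.val_zero, pow_zero]
  linear_combination (-(-1) ^ i.1 * N i (g p) *
    (((N.submatrix id g).submatrix i.succAbove p.succAbove).det)) * this

/-- kernel vector of a `k × (k+1)` matrix -/
lemma fk_ker {k : ℕ} (M : Matrix (Fin k) (Fin (k+1)) ℝ) (i : Fin k) :
    ∑ c, (-1 : ℝ) ^ c.1 * (M.submatrix id c.succAbove).det * M i c = 0 := by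
  have h : (Matrix.of (Fin.cons (M i) M : Fin (k+1) → Fin (k+1) → ℝ)).det = 0 := by
    refine Matrix.det_zero_of_row_eq (i := 0) (j := i.succ) (Fin.succ_ne_zero i).symm ?_
    funext c; rfl
  rw [Matrix.det_succ_row_zero] at h
  rw [← h]
  refine Finset.sum_congr rfl fun c _ => ?_
  have : (Matrix.of (Fin.cons (M i) M : Fin (k+1) → Fin (k+1) → ℝ)).submatrix Fin.succ c.succAbove
      = M.submatrix id c.succAbove := by
    ext a b; rfl
  have h0 : (Matrix.of (Fin.cons (M i) M : Fin (k+1) → Fin (k+1) → ℝ)) 0 c = M i c := rfl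
  rw [this, h0]; ring

lemma fk_identity {m : ℕ} (M : Matrix (Fin (m+2)) (Fin (m+3)) ℝ) (q : Fin (m+1)) :
    let N := M.submatrix Fin.castSucc id
    let σ : Fin m → Fin (m+3) := fun i => (q.succAbove i).castSucc.succ
    (M.submatrix id (q.castSucc.succ).succAbove).det *
        (N.submatrix id (fun i : Fin (m+1) => i.castSucc.succ)).det =
      (M.submatrix id Fin.succ).det * (N.submatrix id (Fin.cons 0 σ : Fin (m+1) → Fin (m+3))).det +
      (M.submatrix id Fin.castSucc).det *
        (N.submatrix id (Fin.snoc σ (Fin.last (m+2)) : Fin (m+1) → Fin (m+3))).det := by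
  intro N σ
  set y : Fin (m+3) → ℝ := fun c => (N.submatrix id (Fin.cons c σ : Fin (m+1) → Fin (m+3))).det
    with hy
  set x : Fin (m+3) → ℝ := fun c => (-1 : ℝ) ^ c.1 * (M.submatrix id c.succAbove).det with hx
  have hsum : ∑ c, x c * y c = 0 := by
    have hyc : ∀ c, y c = ∑ i : Fin (m+1), ((-1 : ℝ) ^ i.1 *
        ((N.submatrix id σ).submatrix i.succAbove id).det) * M i.castSucc c := by
      intro c
      simp only [hy]
      rw [Matrix.det_succ_column_zero]
      refine Finset.sum_congr rfl fun i _ => ?_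
      have : (N.submatrix id (Fin.cons c σ : Fin (m+1) → Fin (m+3))).submatrix i.succAbove Fin.succ
          = (N.submatrix id σ).submatrix i.succAbove id := by
        ext a b; simp
      rw [this]; simp [N]; ring
    simp only [hyc, Finset.mul_sum]
    rw [Finset.sum_comm]
    refine Finset.sum_eq_zero fun i _ => ?_
    have := fk_ker M i.castSucc
    calc _ = ((-1 : ℝ) ^ i.1 * ((N.submatrix id σ).submatrix i.succAbove id).det) *
        ∑ c, (-1 : ℝ) ^ c.1 * (M.submatrix id c.succAbove).det * M i.castSucc c := by
          rw [Finset.mul_sum]; refine Finset.sum_congr rfl fun c _ => ?_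
          simp only [hx]; ring
      _ = 0 := by rw [this, mul_zero]
  have hzero : ∀ i : Fin m, y (σ i) = 0 := by
    intro i
    refine Matrix.det_zero_of_column_eq (i := 0) (j := i.succ) (Fin.succ_ne_zero i).symm ?_
    intro a; simp
  have hyp : y q.castSucc.succ = (-1) ^ q.1 *
      (N.submatrix id (fun i : Fin (m+1) => i.castSucc.succ)).det := by
    rw [← fk_front]; rfl
  have hyl : y (Fin.last (m+2)) = (-1) ^ m *
      (N.submatrix id (Fin.snoc σ (Fin.last (m+2)) : Fin (m+1) → Fin (m+3))).det := by
    have := fk_front N (Fin.snoc σ (Fin.last (m+2)) : Fin (m+1) → Fin (m+3)) (Fin.last m)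
    rw [Fin.val_last] at this
    rw [← this, hy]
    simp only [Fin.snoc_last]
    congr 2
    congr 1
    funext i
    simp [Fin.succAbove_last]
  rw [Fin.sum_univ_succ, Fin.sum_univ_castSucc, Fin.sum_univ_succAbove _ q] at hsum
  have hz : ∑ i : Fin m, x (q.succAbove i).castSucc.succ * y (q.succAbove i).castSucc.succ = 0 :=
    Finset.sum_eq_zero fun i _ => by rw [hzero i, mul_zero]
  rw [hz, Fin.succ_last, hyp, hyl] at hsum
  have a1 : ((-1:ℝ) ^ q.1) * (-1) ^ q.1 = 1 := by rw [← mul_pow]; simp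
  have a2 : ((-1:ℝ) ^ m) * (-1) ^ m = 1 := by rw [← mul_pow]; simp
  have x0 : x 0 = (M.submatrix id Fin.succ).det := by
    simp only [hx, Fin.val_zero, pow_zero, one_mul]; rfl
  have xl : x (Fin.last (m+2)) = (-1) ^ m * (M.submatrix id Fin.castSucc).det := by
    simp only [hx, Fin.val_last, pow_add]; simp
  have xp : x q.castSucc.succ = - ((-1) ^ q.1 * (M.submatrix id (q.castSucc.succ).succAbove).det) := by
    simp only [hx, Fin.val_succ, Fin.val_castSucc, pow_succ]; ring
  rw [x0, xl, xp] at hsum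
  have y0 : y 0 = (N.submatrix id (Fin.cons 0 σ : Fin (m+1) → Fin (m+3))).det := rfl
  rw [y0] at hsum
  set D1 := (N.submatrix id (fun i : Fin (m+1) => i.castSucc.succ)).det
  set D2 := (N.submatrix id (Fin.snoc σ (Fin.last (m+2)) : Fin (m+1) → Fin (m+3))).det
  linear_combination (-1) * hsum - (M.submatrix id (q.castSucc.succ).succAbove).det * D1 * a1 +
    (M.submatrix id Fin.castSucc).det * D2 * a2

lemma fk_gap {m : ℕ} (g : Fin (m+2) → ℕ)
    (h : ∀ q : Fin (m+1), g q.succ ≤ g q.castSucc + 1) (hg : StrictMono g) :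
    ∀ j : Fin (m+2), g j = g 0 + j.1 := by
  intro j
  induction j using Fin.induction with
  | zero => simp
  | succ q ih =>
    have h1 := h q
    have h2 := hg (Fin.castSucc_lt_succ (i := q))
    simp only [Fin.val_succ, Fin.val_castSucc] at *
    omega

lemma fk_col {m : ℕ} (n : ℕ) (a : Fin (m+2) → ℕ → ℝ)
    (hsmall : ∀ g : Fin (m+1) → ℕ, StrictMono g → (∀ i, g i < n) →
      0 < (Matrix.of fun i j => a (Fin.castSucc i) (g j)).det)
    (hctg : ∀ b, b + (m + 2) ≤ n →
      0 < (Matrix.of fun (i j : Fin (m+2)) => a i (b + j.1)).det) :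
    ∀ (d : ℕ) (g : Fin (m+2) → ℕ), g (Fin.last _) ≤ g 0 + d → StrictMono g → (∀ i, g i < n) →
      0 < (Matrix.of fun i j => a i (g j)).det := by
  intro d
  induction d with
  | zero =>
    intro g h hg _
    have := hg (show (0 : Fin (m+2)) < Fin.last _ from Fin.last_pos)
    omega
  | succ d ih =>
    intro g hd hg hn
    by_cases hgap : ∀ q : Fin (m+1), g q.succ ≤ g q.castSucc + 1
    · have h1 := fk_gap g hgap hg
      have h2 : g = fun j => g 0 + j.1 := funext h1
      have h3 := hn (Fin.last _)
      rw [h1] at h3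
      have := hctg (g 0) (by simp at h3; omega)
      rw [h2]; simpa using this
    · push Not at hgap
      obtain ⟨q, hq⟩ := hgap
      set β : Fin (m+3) → ℕ := Fin.insertNth q.castSucc.succ (g q.castSucc + 1) g with hβ
      have hβp : β q.castSucc.succ = g q.castSucc + 1 := by simp [hβ]
      have hβs : ∀ i, β (q.castSucc.succ.succAbove i) = g i := by intro i; simp [hβ]
      have hβlo : ∀ i : Fin (m+2), i ≤ q.castSucc → β i.castSucc = g i := by
        intro i hi
        rw [← hβs i, Fin.succAbove_of_castSucc_lt]
        simp only [Fin.lt_def, Fin.le_def, Fin.val_succ, Fin.val_castSucc] at *; omega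
      have hβhi : ∀ i : Fin (m+2), q.castSucc < i → β i.succ = g i := by
        intro i hi
        rw [← hβs i, Fin.succAbove_of_le_castSucc]
        simp only [Fin.lt_def, Fin.le_def, Fin.val_succ, Fin.val_castSucc] at *; omega
      have hβm : StrictMono β := by
        rw [Fin.strictMono_iff_lt_succ]
        intro i
        rcases lt_trichotomy i q.castSucc with hi | hi | hi
        · rw [hβlo i hi.le]
          have : i.1 + 1 < m + 2 := by simp only [Fin.lt_def, Fin.val_castSucc] at hi; omega
          have e : i.succ = (⟨i.1 + 1, this⟩ : Fin (m+2)).castSucc := rfl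
          rw [e, hβlo]
          · exact hg (by simp [Fin.lt_def])
          · simp only [Fin.lt_def, Fin.le_def, Fin.val_castSucc] at *; omega
        · rw [hi, hβp, hβlo _ le_rfl]; omega
        · rw [hβhi i hi]
          by_cases hi2 : i = q.succ
          · have e : i.castSucc = q.castSucc.succ := by
              rw [hi2]; rfl
            rw [e, hβp, hi2]; omega
          · simp only [Fin.lt_def, Fin.ext_iff, Fin.val_succ, Fin.val_castSucc] at hi hi2
            have e : i.castSucc = (⟨i.1 - 1, by omega⟩ : Fin (m+2)).succ := by
              ext; simp; omega
            rw [e, hβhi]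
            · exact hg (by rw [Fin.lt_def]; simp only; omega)
            · simp only [Fin.lt_def, Fin.val_castSucc]; omega
      have hβ0 : β 0 = g 0 := hβlo 0 (Fin.zero_le _)
      have hβl : β (Fin.last _) = g (Fin.last _) :=
        hβhi (Fin.last _) (Fin.castSucc_lt_last q)
      have hβn : ∀ i, β i < n := fun i =>
        lt_of_le_of_lt ((hβm.monotone (Fin.le_last i)).trans_eq hβl) (hn _)
      have hid := fk_identity (Matrix.of fun i c => a i (β c)) q
      simp only at hid
      have d0 : 0 < ((Matrix.of fun i c => a i (β c)).submatrix id Fin.succ).det := by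
        refine ih (β ∘ Fin.succ) ?_ (hβm.comp Fin.strictMono_succ) (fun i => hβn _)
        have := hβm (show (0 : Fin (m+3)) < Fin.succ 0 from Fin.succ_pos 0)
        change β (Fin.last (m+2)) ≤ β (Fin.succ 0) + d
        omega
      have dl : 0 < ((Matrix.of fun i c => a i (β c)).submatrix id Fin.castSucc).det := by
        refine ih (β ∘ Fin.castSucc) ?_ (hβm.comp Fin.strictMono_castSucc) (fun i => hβn _)
        have := hβm (Fin.castSucc_lt_last (Fin.last (m+1)))
        change β (Fin.last (m+1)).castSucc ≤ β 0 + d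
        change β (Fin.last (m+1)).castSucc < β (Fin.last (m+2)) at this
        omega
      have hN : ∀ τ : Fin (m+1) → Fin (m+3), StrictMono τ →
          0 < (((Matrix.of fun i c => a i (β c)).submatrix Fin.castSucc id).submatrix id τ).det :=
        fun τ hτ => hsmall (β ∘ τ) (hβm.comp hτ) (fun i => hβn _)
      have hσ : StrictMono fun i : Fin m => (q.succAbove i).castSucc.succ :=
        Fin.strictMono_succ.comp (Fin.strictMono_castSucc.comp (Fin.strictMono_succAbove q))
      have D1 := hN (fun i => i.castSucc.succ) (Fin.strictMono_succ.comp Fin.strictMono_castSucc)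
      have D2 := hN (Fin.cons 0 fun i : Fin m => (q.succAbove i).castSucc.succ) (by
        intro i j hij
        induction j using Fin.cases with
        | zero => exact absurd hij (Fin.not_lt_zero i)
        | succ j =>
          induction i using Fin.cases with
          | zero => simp [Fin.lt_def]
          | succ i => simpa using hσ (Fin.succ_lt_succ_iff.1 hij))
      have D3 := hN (Fin.snoc (fun i : Fin m => (q.succAbove i).castSucc.succ)
          (Fin.last (m+2)) : Fin (m+1) → Fin (m+3)) (by
        intro i j hij
        induction i using Fin.lastCases with
        | last => exact absurd hij (not_lt.2 (Fin.le_last j))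
        | cast i =>
          induction j using Fin.lastCases with
          | last =>
            have := (q.succAbove i).2
            simp only [Fin.snoc_castSucc, Fin.snoc_last, Fin.lt_def, Fin.val_succ,
              Fin.val_castSucc, Fin.val_last]
            omega
          | cast j => simpa using hσ (Fin.castSucc_lt_castSucc_iff.1 hij))
      have hT : 0 < ((Matrix.of fun i c => a i (β c)).submatrix id
          (q.castSucc.succ).succAbove).det := by
        by_contra hcon
        have := mul_nonpos_of_nonpos_of_nonneg (not_lt.1 hcon) D1.le
        have := mul_pos d0 D2
        have := mul_pos dl D3
        linarith
      have e : ((Matrix.of fun i c => a i (β c)).submatrix id (q.castSucc.succ).succAbove)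
          = Matrix.of fun i j => a i (g j) := by
        ext i j; simp [hβs]
      rwa [e] at hT

lemma fk_all (n r : ℕ) (a : ℕ → ℕ → ℝ)
    (h : ∀ k b c, k ≤ r → b + k ≤ n → c + k ≤ n →
      0 < (Matrix.of fun (i j : Fin k) => a (b + i.1) (c + j.1)).det) :
    ∀ k, k ≤ r → ∀ f g : Fin k → ℕ, StrictMono f → StrictMono g → (∀ i, f i < n) →
      (∀ i, g i < n) → 0 < (Matrix.of fun i j => a (f i) (g j)).det := by
  intro k
  induction k with
  | zero => intro _ f g _ _ _ _; simp
  | succ k ih =>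
    intro hk f g hf hg hfn hgn
    rcases k with _ | m
    · have := h 1 (f 0) (g 0) hk (hfn 0) (hgn 0)
      simpa using this
    · have ih := ih (by omega)
      have step1 : ∀ b, b + (m+2) ≤ n → ∀ g : Fin (m+2) → ℕ, StrictMono g → (∀ i, g i < n) →
          0 < (Matrix.of fun (i j : Fin (m+2)) => a (b + i.1) (g j)).det := by
        intro b hb g hg hgn
        refine fk_col n (fun i c => a (b + i.1) c) ?_ ?_ (g (Fin.last _)) g (by omega) hg hgn
        · intro g hg hgn
          exact ih (fun i => b + i.1) g (fun i j hij => by simpa using hij) hg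
            (fun i => by have := i.2; omega) hgn
        · intro c hc
          exact h (m+2) b c hk hb hc
      have := fk_col n (fun j c => a c (g j)) ?_ ?_ (f (Fin.last _)) f (by omega) hf hfn
      · rw [← Matrix.det_transpose]; exact this
      · intro f hf hfn
        rw [← Matrix.det_transpose]
        exact ih f (fun j => g j.castSucc) hf (hg.comp Fin.strictMono_castSucc) hfn (fun _ => hgn _)
      · intro b hb
        rw [← Matrix.det_transpose]
        exact step1 b hb g hg hgn

lemma hk_seq {n : ℕ} (A : Matrix (Fin n) (Fin n) ℝ) (hH : IsHankel A) :
    ∃ s : ℕ → ℝ, ∀ i j : Fin n, A i j = s (i.1 + j.1) := by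
  refine ⟨fun m => if h : min m (n-1) < n ∧ m - min m (n-1) < n then A ⟨_, h.1⟩ ⟨_, h.2⟩ else 0, ?_⟩
  intro i j
  have hi := i.2
  have hj := j.2
  have hc : min (i.1 + j.1) (n-1) < n ∧ (i.1 + j.1) - min (i.1 + j.1) (n-1) < n := by omega
  simp only
  rw [dif_pos hc]
  exact hH _ _ _ _ (by simp only; omega)

/-- Theorem 3.2(a). A Hankel matrix all of whose contiguous minors of
size at most `r` are nonnegative is totally nonnegative of order `r`. -/
theorem hankel_contiguous_nonneg_imp_TNr {n : ℕ} (r : ℕ)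
    (A : Matrix (Fin n) (Fin n) ℝ) (hH : IsHankel A)
    (h : ∀ (k a b : ℕ) (ha : a + k ≤ n) (hb : b + k ≤ n),
      k ≤ r → 0 ≤ (ctgSub A k a b ha hb).det) :
    IsTNr A r := by
  obtain ⟨s, hs⟩ := hk_seq A hH
  have hdet : ∀ k c, k ≤ r → c + 2 * k ≤ 2 * n → 0 ≤ (hkM s c k).det := by
    intro k c hk hc
    have h1 := h k (min c (n - k)) (c - min c (n - k)) (by omega) (by omega) hk
    have e : ctgSub A k (min c (n - k)) (c - min c (n - k)) (by omega) (by omega) = hkM s c k := by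
      ext i j
      simp only [ctgSub, hkM, Matrix.of_apply, hs]
      congr 1; omega
    rwa [e] at h1
  have hpsd : ∀ k c, k ≤ r → c + 2 * k ≤ 2 * n → (hkM s c k).PosSemidef := fun k c hk hc =>
    hkM_psd s k c fun k' c' h1 _ h3 => hdet k' c' (by omega) (by omega)
  set sB : ℕ → ℝ := fun m => ∑ t : Fin n, ((t.1 : ℝ) + 1) ^ m with hsB
  intro k hk f g hf hg
  have hpos : ∀ ε : ℝ, 0 < ε →
      0 < (A.submatrix f g + ε • Matrix.of fun i j => sB ((f i).1 + (g j).1)).det := by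
    intro ε hε
    have := fk_all n r (fun b c => s (b + c) + ε * sB (b + c)) ?_ k hk (fun i => (f i).1)
      (fun i => (g i).1) (fun i j hij => hf hij) (fun i j hij => hg hij)
      (fun i => (f i).2) (fun i => (g i).2)
    · convert this using 2
      ext i j
      simp [hs]
    · intro k b c hk hb hc
      have hPD : (hkM s (b + c) k + ε • hkM sB (b + c) k).PosDef :=
        Matrix.PosDef.posSemidef_add (hpsd k (b+c) hk (by omega))
          ((hkM_pd n (b+c) k (by omega)).smul hε)
      have hM : (Matrix.of fun (i j : Fin k) => s (b + i.1 + (c + j.1)) +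
          ε * sB (b + i.1 + (c + j.1))) = hkM s (b + c) k + ε • hkM sB (b + c) k := by
        ext i j
        have e : b + i.1 + (c + j.1) = b + c + i.1 + j.1 := by omega
        simp [hkM, e]
      rw [hM]
      exact hPD.det_pos
  have hc : Continuous fun ε : ℝ =>
      (A.submatrix f g + ε • Matrix.of fun i j => sB ((f i).1 + (g j).1)).det := by
    apply Continuous.matrix_det
    fun_prop
  have h2 := (hc.continuousWithinAt (s := Set.Ioi 0) (x := 0)).tendsto
  have := ge_of_tendsto h2 (b := 0) (by
    filter_upwards [self_mem_nhdsWithin] with ε h2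
    exact (hpos ε h2).le)
  simpa using this
end

section
/- Let A and B be n-by-n Hankel matrices of real numbers, all of whose contiguous minors of size at most r are nonnegative. Then A + B is totally nonnegative of order r (TN_r). -/
/-- Minor of the array `u` with row indices below `j` and points `α`. -/
noncomputable def minorD (u : ℕ → ℕ → ℝ) (j : ℕ) (α : Fin j → ℕ) : ℝ :=
  (Matrix.of fun (b a : Fin j) => u a (α b)).det

theorem minorD_succ (u : ℕ → ℕ → ℝ) (j : ℕ) (α : Fin (j + 1) → ℕ)
    (h : ∀ b, u 0 (α b) ≠ 0) :
    minorD u (j + 1) α = (∏ b, u 0 (α b)) *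
      (Matrix.of fun (b a : Fin j) => u (a + 1) (α b.succ) / u 0 (α b.succ)
        - u (a + 1) (α b.castSucc) / u 0 (α b.castSucc)).det := by
  have h1 : minorD u (j + 1) α = (∏ b, u 0 (α b)) *
      (Matrix.of fun (b a : Fin (j + 1)) => u a (α b) / u 0 (α b)).det := by
    rw [← Matrix.det_mul_column]
    unfold minorD
    congr 1
    ext b a
    have := h b
    simp only [Matrix.of_apply]
    field_simp
  rw [h1]
  congr 1
  rw [Matrix.det_eq_of_forall_row_eq_smul_add_pred
    (B := Matrix.of (Fin.cons (fun a : Fin (j + 1) => u a (α 0) / u 0 (α 0))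
      (fun (b : Fin j) (a : Fin (j + 1)) => u a (α b.succ) / u 0 (α b.succ)
        - u a (α b.castSucc) / u 0 (α b.castSucc)))) (fun _ => 1)]
  · rw [Matrix.det_succ_column_zero, Fin.sum_univ_succ]
    have h0 := h 0
    rw [Finset.sum_eq_zero]
    · simp [h0]
      congr 1
    · intro i _
      have h2 := h i.succ
      have h3 := h i.castSucc
      simp [h2, h3]
  · intro a
    simp
  · intro b a
    simp

theorem minorD_pos (m : ℕ) : ∀ (n : ℕ) (u : ℕ → ℕ → ℝ),
    (∀ j ≤ m, ∀ b, b + j ≤ n → 0 < minorD u j (fun i => b + i)) →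
    ∀ j ≤ m, ∀ α : Fin j → ℕ, StrictMono α → (∀ i, α i < n) → 0 < minorD u j α := by
  induction m with
  | zero =>
    intro n u _ j hj α _ _
    obtain rfl : j = 0 := by omega
    simp [minorD]
  | succ m ih =>
    intro n u hu j hj α hα hn
    rcases j with _ | j
    · simp [minorD]
    obtain ⟨n, rfl⟩ : ∃ n', n = n' + 1 := ⟨n - 1, by have := hn 0; omega⟩
    have hpos : ∀ b < n + 1, 0 < u 0 b := by
      intro b hb
      have := hu 1 (by omega) b (by omega)
      simpa [minorD] using this
    rw [minorD_succ u j α (fun b => (hpos _ (hn b)).ne')]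
    refine mul_pos (Finset.prod_pos fun b _ => hpos _ (hn b)) ?_
    set u' : ℕ → ℕ → ℝ := fun a b => u (a + 1) (b + 1) / u 0 (b + 1) - u (a + 1) b / u 0 b with hu'
    have key := ih n u' (by
      intro i hi b hb
      have h1 := hu (i + 1) (by omega) b (by omega)
      rw [minorD_succ _ _ _ (fun c => (hpos _ (by have := c.2; omega)).ne')] at h1
      have h2 : 0 < ∏ c : Fin (i + 1), u 0 (b + c) :=
        Finset.prod_pos fun c _ => hpos _ (by have := c.2; omega)
      have h3 := pos_of_mul_pos_right h1 h2.le
      exact h3) j (by omega)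
    have hsum : (Matrix.of fun (b a : Fin j) => u (a + 1) (α b.succ) / u 0 (α b.succ)
        - u (a + 1) (α b.castSucc) / u 0 (α b.castSucc))
        = fun b => ∑ c ∈ Finset.Ico (α b.castSucc) (α b.succ), (fun a : Fin j => u' a c) := by
      ext b a
      rw [Finset.sum_apply]
      simp only [hu', Matrix.of_apply]
      rw [Finset.sum_Ico_sub (fun c => u (a + 1) c / u 0 c)]
      exact (hα (Fin.castSucc_lt_succ)).le
    have hdet : (Matrix.of fun (b a : Fin j) => u (a + 1) (α b.succ) / u 0 (α b.succ)
        - u (a + 1) (α b.castSucc) / u 0 (α b.castSucc)).det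
        = ∑ r ∈ Fintype.piFinset (fun b : Fin j => Finset.Ico (α b.castSucc) (α b.succ)),
          minorD u' j r := by
      rw [hsum]
      exact (Matrix.detRowAlternating (R := ℝ) (n := Fin j)).toMultilinearMap.map_sum_finset
        (fun b c => (fun a : Fin j => u' a c)) (fun b : Fin j => Finset.Ico (α b.castSucc) (α b.succ))
    rw [hdet]
    apply Finset.sum_pos
    · intro r hr
      rw [Fintype.mem_piFinset] at hr
      simp only [Finset.mem_Ico] at hr
      apply key
      · intro x y hxy
        have h1 := (hr x).2
        have h2 := (hr y).1
        have h3 : α x.succ ≤ α y.castSucc := hα.monotone (by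
          rw [Fin.le_def]; simp; omega)
        omega
      · intro i
        have := (hr i).2
        have := hn i.succ
        omega
    · refine ⟨fun b => α b.castSucc, ?_⟩
      rw [Fintype.mem_piFinset]
      intro b
      simp only [Finset.mem_Ico, le_refl, true_and]
      exact hα (Fin.castSucc_lt_succ)

/-- The `k`-by-`k` Hankel matrix of the sequence `s` starting at `c`. -/
def hank (s : ℕ → ℝ) (k c : ℕ) : Matrix (Fin k) (Fin k) ℝ :=
  Matrix.of fun i j => s (c + i + j)

theorem hank_herm (s : ℕ → ℝ) (k c : ℕ) : (hank s k c).IsHermitian := by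
  ext i j
  simp [hank, add_right_comm]

theorem hank_middle_pd (s : ℕ → ℝ) (k c : ℕ)
    (hL : (hank s (k + 1) c).PosSemidef) (hT : (hank s (k + 1) (c + 2)).PosSemidef)
    (hN : (hank s k (c + 2)).PosDef) (hdet : 0 ≤ (hank s (k + 2) c).det) :
    (hank s (k + 2) c).PosSemidef := by
  let e0 : Fin k ⊕ Fin 2 → Fin (k + 2) :=
    Sum.elim (fun i => i.castSucc.succ) ![0, Fin.last _]
  have he0 : Function.Bijective e0 := by
    rw [Fintype.bijective_iff_injective_and_card]
    refine ⟨?_, by simp⟩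
    rintro (x | x) (y | y) h
    · simpa [e0] using h
    · have := x.2
      fin_cases y <;> simp [e0, Fin.ext_iff] at h
      omega
    · have := y.2
      fin_cases x <;> simp [e0, Fin.ext_iff] at h
      omega
    · fin_cases x <;> fin_cases y <;> simp [e0, Fin.ext_iff] at h ⊢
  let e : Fin k ⊕ Fin 2 ≃ Fin (k + 2) := Equiv.ofBijective e0 he0
  set M := (hank s (k + 2) c).submatrix e e with hM
  rw [← Matrix.posSemidef_submatrix_equiv e]
  rw [← Matrix.det_submatrix_equiv_self e] at hdet
  rw [← hM] at hdet ⊢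
  have hMh : M.IsHermitian := (hank_herm s (k + 2) c).submatrix e
  set N := hank s k (c + 2) with hNdef
  have hMN : M.toBlocks₁₁ = N := by
    ext i j
    simp only [hM, Matrix.toBlocks₁₁, hNdef, hank, Matrix.of_apply, Matrix.submatrix_apply]
    congr 1
    simp [e, e0]; omega
  have hMb : M = Matrix.fromBlocks N M.toBlocks₁₂ (M.toBlocks₁₂).conjTranspose M.toBlocks₂₂ := by
    conv_lhs => rw [← Matrix.fromBlocks_toBlocks M]
    rw [hMN]
    congr 1
    ext i j
    simp only [Matrix.conjTranspose_apply, Matrix.toBlocks₁₂, Matrix.toBlocks₂₁, Matrix.of_apply]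
    exact (hMh.apply _ _).symm
  set B := M.toBlocks₁₂ with hB
  set D := M.toBlocks₂₂ with hD
  have : Invertible N := hN.isUnit.invertible
  have hdiag : ∀ t : Fin 2, (∃ d : ℕ, ∃ f : Fin k ⊕ Unit → Fin (k + 1),
      (hank s (k + 1) d).PosSemidef ∧
      (hank s (k + 1) d).submatrix f f = M.submatrix (Sum.map id (fun _ => t))
      (Sum.map id (fun _ => t))) → 0 ≤ (D - B.conjTranspose * N⁻¹ * B) t t := by
    rintro t ⟨d, f, h1, h2⟩
    have h3 := h1.submatrix f
    rw [h2, hMb] at h3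
    have h4 : (Matrix.fromBlocks N B B.conjTranspose D).submatrix (Sum.map id (fun _ : Unit => t))
      (Sum.map id (fun _ => t)) = Matrix.fromBlocks N (B.submatrix id (fun _ : Unit => t))
        (B.submatrix id (fun _ : Unit => t)).conjTranspose
        (D.submatrix (fun _ : Unit => t) (fun _ : Unit => t)) := by
      ext (i | i) (j | j) <;> simp
    rw [h4, Matrix.PosDef.fromBlocks₁₁ _ _ hN] at h3
    have h5 := h3.diag_nonneg (i := ())
    simpa [Matrix.mul_apply] using h5
  have h0 : 0 ≤ (D - B.conjTranspose * N⁻¹ * B) 0 0 := by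
    apply hdiag
    refine ⟨c, Sum.elim (fun i => i.succ) (fun _ => 0), hL, ?_⟩
    ext (i | i) (j | j) <;> simp [hM, hank, e, e0]
  have h1 : 0 ≤ (D - B.conjTranspose * N⁻¹ * B) 1 1 := by
    apply hdiag
    refine ⟨c + 2, Sum.elim (fun i => i.castSucc) (fun _ => Fin.last _), hT, ?_⟩
    ext (i | i) (j | j) <;> simp [hM, hank, e, e0] <;> congr 1 <;> omega
  have hS : 0 ≤ (D - B.conjTranspose * N⁻¹ * B).det := by
    rw [hMb, Matrix.det_fromBlocks₁₁, Matrix.invOf_eq_nonsing_inv] at hdet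
    exact nonneg_of_mul_nonneg_right hdet hN.det_pos
  have hSh : (D - B.conjTranspose * N⁻¹ * B).IsHermitian := by
    have := hMh
    rw [hMb, Matrix.IsHermitian.fromBlocks₁₁ _ _ hN.isHermitian] at this
    exact this
  rw [hMb, Matrix.PosDef.fromBlocks₁₁ _ _ hN]
  generalize D - B.conjTranspose * N⁻¹ * B = S at *
  refine Matrix.PosSemidef.of_dotProduct_mulVec_nonneg hSh ?_
  intro x
  have h10 : S 1 0 = S 0 1 := by simpa using hSh.apply 0 1
  rw [Matrix.det_fin_two, h10] at hS
  simp [Matrix.mulVec, dotProduct, Fin.sum_univ_two, h10]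
  generalize S 0 0 = p at *
  generalize S 1 1 = q at *
  generalize S 0 1 = b at *
  generalize x 0 = X at *
  generalize x 1 = Y at *
  rcases h0.eq_or_lt with h | h
  · have : b = 0 := by
      subst h
      nlinarith
    subst this
    subst h
    nlinarith [mul_nonneg h1 (mul_self_nonneg Y)]
  · have : 0 ≤ p * (X * (p * X + b * Y) + Y * (b * X + q * Y)) := by
      nlinarith [mul_self_nonneg (p * X + b * Y), mul_nonneg hS (mul_self_nonneg Y)]
    exact nonneg_of_mul_nonneg_right this h

theorem hank_mulVec (s : ℕ → ℝ) (k c : ℕ) (z : Fin k → ℝ) (i : Fin k) :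
    (hank s k c).mulVec z i = ∑ j : Fin k, s (c + i + j) * z j := by
  simp [hank, Matrix.mulVec, dotProduct]

theorem hank_ker_shift (s : ℕ → ℝ) (k c : ℕ)
    (hL : (hank s (k + 1) c).PosSemidef) (hT : (hank s (k + 1) (c + 2)).PosSemidef)
    (z : Fin k → ℝ) (hz : (hank s k (c + 2)).mulVec z = 0) (a : ℕ) (ha : a ≤ k + 1) :
    ∑ j : Fin k, s (c + 1 + a + j) * z j = 0 := by
  have hz' : ∀ i : Fin k, ∑ j : Fin k, s (c + 2 + i + j) * z j = 0 := by
    intro i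
    rw [← hank_mulVec, hz]; rfl
  have h1 : (hank s (k + 1) c).mulVec (Fin.cons 0 z) = 0 := by
    rw [← hL.dotProduct_mulVec_zero_iff]
    simp only [dotProduct, hank_mulVec]
    rw [Fin.sum_univ_succ]
    simp only [Fin.sum_univ_succ, Pi.star_apply, star_trivial, Fin.cons_zero, Fin.cons_succ, zero_mul,
      mul_zero, zero_add]
    apply Finset.sum_eq_zero
    intro i _
    have : ∑ j : Fin k, s (c + i.succ + j.succ) * z j = 0 := by
      rw [← hz' i]
      refine Finset.sum_congr rfl fun j _ => ?_
      congr 2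
      simp; omega
    rw [this, mul_zero]
  have h2 : (hank s (k + 1) (c + 2)).mulVec (Fin.snoc z 0 : Fin (k + 1) → ℝ) = 0 := by
    rw [← hT.dotProduct_mulVec_zero_iff]
    simp only [dotProduct, hank_mulVec]
    rw [Fin.sum_univ_castSucc]
    simp only [Fin.sum_univ_castSucc, Pi.star_apply, star_trivial, Fin.snoc_castSucc, Fin.snoc_last,
      zero_mul, mul_zero, add_zero]
    apply Finset.sum_eq_zero
    intro i _
    have : ∑ j : Fin k, s (c + 2 + i.castSucc + j.castSucc) * z j = 0 := by
      rw [← hz' i]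
      rfl
    rw [this, mul_zero]
  rcases Nat.lt_or_ge a (k + 1) with h | h
  · have := congrFun h1 ⟨a, h⟩
    rw [hank_mulVec, Fin.sum_univ_succ] at this
    simp only [Fin.cons_zero, Fin.cons_succ, mul_zero, zero_add, Pi.zero_apply] at this
    rw [← this]
    refine Finset.sum_congr rfl fun j _ => ?_
    congr 2
    simp; omega
  · have := congrFun h2 ⟨k, by omega⟩
    rw [hank_mulVec, Fin.sum_univ_castSucc] at this
    simp only [Fin.snoc_castSucc, Fin.snoc_last, mul_zero, add_zero, Pi.zero_apply] at this
    rw [← this]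
    refine Finset.sum_congr rfl fun j _ => ?_
    congr 2
    simp; omega

theorem hank_ker_head (s : ℕ → ℝ) (k c : ℕ)
    (hL : (hank s (k + 2) c).PosSemidef) (hT : (hank s (k + 2) (c + 2)).PosSemidef) (l : ℕ) :
    ∀ z : Fin (k + 1) → ℝ, (hank s (k + 1) (c + 2)).mulVec z = 0 →
      (∃ i : Fin (k + 1), i.1 = l ∧ z i ≠ 0) →
      ∃ z : Fin (k + 1) → ℝ, (hank s (k + 1) (c + 2)).mulVec z = 0 ∧ z 0 ≠ 0 := by
  induction l with
  | zero =>
    rintro z hz ⟨i, hi, hzi⟩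
    obtain rfl : i = 0 := Fin.ext hi
    exact ⟨z, hz, hzi⟩
  | succ l ih =>
    rintro z hz ⟨i, hi, hzi⟩
    by_cases h0 : z 0 = 0
    · apply ih (Fin.snoc (Fin.tail z) 0 : Fin (k + 1) → ℝ)
      · ext i
        have := hank_ker_shift s (k + 1) c hL hT z hz i (by omega)
        rw [Fin.sum_univ_succ, h0, mul_zero, zero_add] at this
        rw [hank_mulVec, Fin.sum_univ_castSucc]
        simp only [Fin.snoc_castSucc, Fin.snoc_last, mul_zero, add_zero, Pi.zero_apply]
        rw [← this]
        refine Finset.sum_congr rfl fun j _ => ?_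
        simp only [Fin.tail]
        congr 2
        simp; omega
      · have hl : l < k := by have := i.2; omega
        refine ⟨(⟨l, hl⟩ : Fin k).castSucc, rfl, ?_⟩
        rw [Fin.snoc_castSucc]
        have : i = (⟨l, hl⟩ : Fin k).succ := Fin.ext hi
        rw [this] at hzi
        exact hzi
    · exact ⟨z, hz, h0⟩

theorem hank_middle_sing (s : ℕ → ℝ) (k c : ℕ)
    (hL : (hank s (k + 1) c).PosSemidef) (hT : (hank s (k + 1) (c + 2)).PosSemidef)
    (hN : (hank s k (c + 2)).det = 0) :
    (hank s (k + 2) c).PosSemidef := by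
  obtain ⟨z, hz0, hz⟩ := Matrix.exists_mulVec_eq_zero_iff.mpr hN
  obtain ⟨i, hi⟩ := Function.ne_iff.mp hz0
  rcases k with _ | k
  · exact i.elim0
  obtain ⟨z, hz, hz0⟩ := hank_ker_head s k c hL hT i.1 z hz ⟨i, rfl, hi⟩
  have hsh := hank_ker_shift s (k + 1) c hL hT z hz
  set M := hank s (k + 1 + 2) c with hM
  set y : Fin (k + 3) → ℝ := (Fin.snoc (Fin.snoc z 0 : Fin (k + 2) → ℝ) 0 : Fin (k + 3) → ℝ) with hy
  have hy0 : y 0 = z 0 := by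
    have : (0 : Fin (k + 3)) = (0 : Fin (k + 1)).castSucc.castSucc := rfl
    rw [this, hy, Fin.snoc_castSucc, Fin.snoc_castSucc]
  set α := ∑ j : Fin (k + 1), s (c + j) * z j with hα
  have hMy : M.mulVec y = Pi.single 0 α := by
    ext i
    rw [hM, hank_mulVec, Fin.sum_univ_castSucc, Fin.sum_univ_castSucc]
    simp only [hy, Fin.snoc_castSucc, Fin.snoc_last, mul_zero, add_zero]
    refine Fin.cases ?_ (fun i => ?_) i
    · simp [hα]
    · have := hsh i (by omega)
      rw [Pi.single_eq_of_ne (Fin.succ_ne_zero i), ← this]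
      refine Finset.sum_congr rfl fun j _ => ?_
      congr 2
      simp; omega
  have hpos : 0 ≤ α * z 0 := by
    have h1 := hL.dotProduct_mulVec_nonneg (Fin.snoc z 0 : Fin (k + 2) → ℝ)
    have h2 : (hank s (k + 1 + 1) c).mulVec (Fin.snoc z 0 : Fin (k + 2) → ℝ) = Pi.single 0 α := by
      ext i
      rw [hank_mulVec, Fin.sum_univ_castSucc]
      simp only [Fin.snoc_castSucc, Fin.snoc_last, mul_zero, add_zero]
      refine Fin.cases ?_ (fun i => ?_) i
      · simp [hα]
      · have := hsh i (by omega)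
        rw [Pi.single_eq_of_ne (Fin.succ_ne_zero i), ← this]
        refine Finset.sum_congr rfl fun j _ => ?_
        congr 2
        simp; omega
    rw [h2] at h1
    have h3 : (Fin.snoc z 0 : Fin (k + 2) → ℝ) 0 = z 0 := by
      have : (0 : Fin (k + 2)) = (0 : Fin (k + 1)).castSucc := rfl
      rw [this, Fin.snoc_castSucc]
    simp [h3] at h1
    linarith
  have hMh := hank_herm s (k + 1 + 2) c
  refine Matrix.PosSemidef.of_dotProduct_mulVec_nonneg hMh ?_
  intro q
  set lam := q 0 / z 0 with hlam
  obtain ⟨p, hp⟩ : ∃ p : Fin (k + 2) → ℝ, q = (Fin.cons 0 p : Fin (k + 3) → ℝ) + lam • y := by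
    refine ⟨Fin.tail (q - lam • y), ?_⟩
    ext i
    refine Fin.cases ?_ (fun i => ?_) i
    · simp [hy0, hlam, hz0]
    · simp [Fin.tail]
  have hpT : 0 ≤ (Fin.cons 0 p : Fin (k + 3) → ℝ) ⬝ᵥ M.mulVec (Fin.cons 0 p) := by
    have h1 := hT.dotProduct_mulVec_nonneg p
    refine h1.trans_eq (Eq.symm ?_)
    simp only [dotProduct, hM, hank_mulVec]
    rw [Fin.sum_univ_succ]
    rw [Fin.cons_zero, zero_mul, zero_add]
    refine Finset.sum_congr rfl fun i _ => ?_
    rw [Fin.cons_succ, Pi.star_apply, star_trivial]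
    congr 1
    rw [Fin.sum_univ_succ, Fin.cons_zero, mul_zero, zero_add]
    refine Finset.sum_congr rfl fun j _ => ?_
    rw [Fin.cons_succ]
    congr 2
    simp; omega
  have hsymm : y ⬝ᵥ M.mulVec (Fin.cons 0 p) = 0 := by
    have hMt : M.transpose = M := by
      ext i j
      simp [hM, hank, add_right_comm]
    rw [Matrix.dotProduct_mulVec, ← Matrix.mulVec_transpose, hMt, hMy]
    simp
  have e : star q = q := by ext; simp
  rw [e, hp, Matrix.mulVec_add, Matrix.mulVec_smul, hMy]
  simp only [add_dotProduct, dotProduct_add, smul_dotProduct, dotProduct_smul, hsymm]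
  simp only [dotProduct_single, Fin.cons_zero, hy0, smul_eq_mul]
  nlinarith [mul_nonneg hpos (mul_self_nonneg lam)]

theorem hank_psd (s : ℕ → ℝ) (r n : ℕ)
    (h : ∀ k ≤ r, ∀ c, c + 2 * k ≤ 2 * n → 0 ≤ (hank s k c).det) (k : ℕ) :
    k ≤ r → ∀ c, c + 2 * k ≤ 2 * n → (hank s k c).PosSemidef := by
  induction k using Nat.strong_induction_on with
  | _ k ih =>
    intro hk c hc
    rcases k with _ | _ | k
    · rw [Subsingleton.elim (hank s 0 c) 0]
      exact Matrix.PosSemidef.zero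
    · refine Matrix.PosSemidef.of_dotProduct_mulVec_nonneg (hank_herm _ _ _) ?_
      intro x
      have := h _ hk c hc
      simp [hank] at this
      simp [hank, Matrix.mulVec, dotProduct]
      nlinarith [mul_nonneg this (mul_self_nonneg (x 0))]
    · have hL := ih (k + 1) (by omega) (by omega) c (by omega)
      have hT := ih (k + 1) (by omega) (by omega) (c + 2) (by omega)
      have hN := ih k (by omega) (by omega) (c + 2) (by omega)
      by_cases hd : (hank s k (c + 2)).det = 0
      · exact hank_middle_sing s k c hL hT hd
      · refine hank_middle_pd s k c hL hT ?_ (h _ hk c hc)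
        rw [hN.posDef_iff_isUnit]
        rw [Matrix.isUnit_iff_isUnit_det]
        exact isUnit_iff_ne_zero.mpr hd

/-- Moments of a discrete measure with `n` atoms. -/
noncomputable def momSeq (n : ℕ) (c : ℕ) : ℝ := ∑ x : Fin n, ((x : ℝ) + 1) ^ c

theorem hank_mom_pd (n k c : ℕ) (hk : k ≤ n) : (hank (momSeq n) k c).PosDef := by
  refine Matrix.PosDef.of_dotProduct_mulVec_pos (hank_herm _ _ _) ?_
  intro v hv
  have h1 : star v ⬝ᵥ (hank (momSeq n) k c).mulVec v
      = ∑ x : Fin n, ((x : ℝ) + 1) ^ c * (∑ i : Fin k, ((x : ℝ) + 1) ^ (i : ℕ) * v i) ^ 2 := by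
    simp only [dotProduct, hank_mulVec, momSeq, Pi.star_apply, star_trivial]
    simp only [sq, Finset.sum_mul, Finset.mul_sum]
    rw [Finset.sum_comm' (t' := Finset.univ) (s' := fun _ => Finset.univ) (by simp)]
    conv_rhs => rw [Finset.sum_comm]
    refine Finset.sum_congr rfl fun i _ => ?_
    conv_rhs => rw [Finset.sum_comm]
    refine Finset.sum_congr rfl fun j _ => ?_
    refine Finset.sum_congr rfl fun x _ => ?_
    ring
  rw [h1]
  apply lt_of_le_of_ne
  · exact Finset.sum_nonneg fun x _ => by positivity
  · intro h0
    apply hv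
    rw [eq_comm, Finset.sum_eq_zero_iff_of_nonneg (fun x _ => by positivity)] at h0
    apply Matrix.eq_zero_of_forall_index_sum_pow_mul_eq_zero
      (f := fun x : Fin k => (x : ℝ) + 1)
    · intro x y hxy
      simpa [Fin.ext_iff] using hxy
    · intro j
      have := h0 (Fin.castLE hk j) (Finset.mem_univ _)
      have hp : (0 : ℝ) < ((Fin.castLE hk j : Fin n) : ℝ) + 1 := by positivity
      have h2 := (mul_eq_zero.mp this).resolve_left (pow_pos hp c).ne'
      simpa using h2

theorem hank_TP (S : ℕ → ℝ) (r n : ℕ)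
    (h : ∀ k ≤ r, ∀ c, c + 2 * k ≤ 2 * n → 0 < (hank S k c).det)
    (k : ℕ) (hk : k ≤ r) (f g : Fin k → Fin n) (hf : StrictMono f) (hg : StrictMono g) :
    0 < (Matrix.of fun i j : Fin k => S ((f i : ℕ) + g j)).det := by
  have step1 : ∀ m ≤ r, ∀ a, a + m ≤ n → ∀ α : Fin m → ℕ, StrictMono α → (∀ i, α i < n) →
      0 < minorD (fun i b => S (a + i + b)) m α := by
    intro m hm a ha
    refine minorD_pos m n _ ?_ m le_rfl
    intro j hj b hb
    have := h j (by omega) (a + b) (by omega)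
    convert this using 1
    unfold minorD hank
    congr 1
    ext x y
    simp only [Matrix.of_apply]
    congr 1
    omega
  have hkk : k ≤ n := by simpa using Fintype.card_le_of_injective f hf.injective
  let F : ℕ → ℕ := fun a => if h : a < k then (f ⟨a, h⟩ : ℕ) else 0
  have step2 := minorD_pos k n (fun a b => S (b + F a)) (by
    intro j hj b hb
    have := step1 j (by omega) b hb (fun i => F i) (by
      intro x y hxy
      have hx : x.1 < k := by omega
      have hy : y.1 < k := by omega
      simp only [F, hx, hy, dif_pos]
      exact hf hxy) (by
      intro i
      have hx : i.1 < k := by omega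
      simp only [F, hx, dif_pos]
      exact (f _).2)
    convert this using 1
    unfold minorD
    rw [← Matrix.det_transpose]
    rfl) k le_rfl (fun i => (g i : ℕ)) hg (fun i => (g i).2)
  convert step2 using 1
  unfold minorD
  rw [← Matrix.det_transpose]
  congr 1
  ext x y
  simp [F, add_comm]

theorem exists_hank_seq {n : ℕ} (r : ℕ) (A : Matrix (Fin n) (Fin n) ℝ) (hH : IsHankel A)
    (hA : ∀ (k a b : ℕ) (ha : a + k ≤ n) (hb : b + k ≤ n),
      k ≤ r → 0 ≤ (ctgSub A k a b ha hb).det) :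
    ∃ s : ℕ → ℝ, (∀ i j, A i j = s (i + j)) ∧
      ∀ k ≤ r, ∀ c, c + 2 * k ≤ 2 * n → (hank s k c).PosSemidef := by
  classical
  let s : ℕ → ℝ := fun c =>
    if h : ∃ p : Fin n × Fin n, p.1.1 + p.2.1 = c then A h.choose.1 h.choose.2 else 0
  have hs : ∀ i j, A i j = s (i + j) := by
    intro i j
    have h : ∃ p : Fin n × Fin n, p.1.1 + p.2.1 = i.1 + j.1 := ⟨(i, j), rfl⟩
    simp only [s, dif_pos h]
    exact hH _ _ _ _ h.choose_spec.symm
  refine ⟨s, hs, fun k hk c hc => hank_psd s r n ?_ k hk c hc⟩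
  intro k hk c hc
  have h1 := hA k (min c (n - k)) (c - min c (n - k)) (by omega) (by omega) hk
  convert h1 using 2
  ext x y
  simp only [hank, ctgSub, Matrix.of_apply, hs]
  congr 1
  omega

/-- Theorem 3.2(b). If `A` and `B` are Hankel matrices all of whose
contiguous minors of size at most `r` are nonnegative, then `A + B` is TN_r. -/
theorem hankel_sum_contiguous_nonneg_imp_TNr {n : ℕ} (r : ℕ)
    (A B : Matrix (Fin n) (Fin n) ℝ) (hHA : IsHankel A) (hHB : IsHankel B)
    (hA : ∀ (k a b : ℕ) (ha : a + k ≤ n) (hb : b + k ≤ n),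
      k ≤ r → 0 ≤ (ctgSub A k a b ha hb).det)
    (hB : ∀ (k a b : ℕ) (ha : a + k ≤ n) (hb : b + k ≤ n),
      k ≤ r → 0 ≤ (ctgSub B k a b ha hb).det) :
    IsTNr (A + B) r := by
  obtain ⟨s, hs, hsp⟩ := exists_hank_seq r A hHA hA
  obtain ⟨t, ht, htp⟩ := exists_hank_seq r B hHB hB
  intro k hk f g hf hg
  let W : ℝ → Matrix (Fin k) (Fin k) ℝ := fun ε =>
    Matrix.of fun i j => s (f i + g j) + t (f i + g j) + ε * momSeq n (f i + g j)
  have hW : ∀ ε > 0, 0 < (W ε).det := by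
    intro ε hε
    refine hank_TP (fun c => s c + t c + ε * momSeq n c) r n ?_ k hk f g hf hg
    intro m hm c hc
    have h1 : hank (fun c => s c + t c + ε * momSeq n c) m c
        = (hank s m c + hank t m c) + ε • hank (momSeq n) m c := by
      ext i j
      simp [hank]
    rw [h1]
    apply Matrix.PosDef.det_pos
    exact Matrix.PosDef.posSemidef_add ((hsp m hm c hc).add (htp m hm c hc))
      ((hank_mom_pd n m c (by omega)).smul hε)
  have hc : Continuous fun ε => (W ε).det := by
    apply Continuous.matrix_det
    apply continuous_matrix
    intro i j
    simp only [W, Matrix.of_apply]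
    fun_prop
  have h0 : (A + B).submatrix f g = W 0 := by
    ext i j
    simp [W, hs, ht]
  rw [h0]
  have hlim : Filter.Tendsto (fun ε => (W ε).det) (nhdsWithin 0 (Set.Ioi 0)) (nhds (W 0).det) :=
    (hc.tendsto 0).mono_left nhdsWithin_le_nhds
  refine ge_of_tendsto hlim ?_
  filter_upwards [self_mem_nhdsWithin] with ε hε
  exact (hW ε hε).le
end

section
/- Let A and B be n-by-n Hankel matrices of real numbers such that all contiguous minors of A of size at most r are nonnegative and all contiguous minors of B of size at most r are positive. Then A + B is totally positive of order r (TP_r). -/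
namespace HankelTP
open Matrix

theorem form_expand {ι : Type*} [Fintype ι] (M : Matrix ι ι ℝ) (hM : Mᵀ = M) (x w : ι → ℝ) (t : ℝ) :
    (x + t • w) ⬝ᵥ M *ᵥ (x + t • w)
      = x ⬝ᵥ M *ᵥ x + 2 * t * (x ⬝ᵥ M *ᵥ w) + t ^ 2 * (w ⬝ᵥ M *ᵥ w) := by
  have h : w ⬝ᵥ M *ᵥ x = x ⬝ᵥ M *ᵥ w := by
    rw [dotProduct_mulVec, ← mulVec_transpose, hM, dotProduct_comm]
  simp only [mulVec_add, mulVec_smul, dotProduct_add, add_dotProduct, smul_dotProduct,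
    dotProduct_smul, smul_eq_mul, h]
  ring

theorem dot_last {k : ℕ} (x y : Fin (k+1) → ℝ) (hy : ∀ i : Fin k, y i.castSucc = 0) :
    x ⬝ᵥ y = x (Fin.last k) * y (Fin.last k) := by
  simp [dotProduct, Fin.sum_univ_castSucc, hy]

theorem lemX {k : ℕ} (M : Matrix (Fin (k+1)) (Fin (k+1)) ℝ) (hM : Mᵀ = M)
    (hL : ∀ x : Fin (k+1) → ℝ, x (Fin.last k) = 0 → 0 ≤ x ⬝ᵥ M *ᵥ x)
    (w : Fin (k+1) → ℝ) (hw : w (Fin.last k) ≠ 0)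
    (h0 : ∀ i : Fin k, (M *ᵥ w) i.castSucc = 0)
    (h1 : 0 ≤ w (Fin.last k) * (M *ᵥ w) (Fin.last k)) (z : Fin (k+1) → ℝ) :
    0 ≤ z ⬝ᵥ M *ᵥ z := by
  set t := z (Fin.last k) / w (Fin.last k) with ht
  have hz : z = (z - t • w) + t • w := by simp
  have hl : (z - t • w) (Fin.last k) = 0 := by
    simp [ht, hw]
  rw [hz, form_expand M hM, dot_last _ _ h0, dot_last _ _ h0, hl]
  have := hL _ hl
  have := mul_nonneg (sq_nonneg t) h1
  linarith

theorem shiftLem {k : ℕ} (M : Matrix (Fin (k+1)) (Fin (k+1)) ℝ) (hM : Mᵀ = M)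
    (hH : ∀ i j : Fin k, M i.castSucc j.succ = M i.succ j.castSucc)
    (hL : ∀ x : Fin (k+1) → ℝ, x (Fin.last k) = 0 → 0 ≤ x ⬝ᵥ M *ᵥ x)
    (hT : ∀ x : Fin (k+1) → ℝ, x 0 = 0 → 0 ≤ x ⬝ᵥ M *ᵥ x) (t : ℕ) :
    ∀ (u : Fin (k+1) → ℝ) (q : Fin (k+1)), q.1 + t = k → u q ≠ 0 → (∀ i, q < i → u i = 0) →
      M *ᵥ u = 0 → ∀ z, 0 ≤ z ⬝ᵥ M *ᵥ z := by
  induction t with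
  | zero =>
    intro u q hq hu _ hMu z
    have : q = Fin.last k := Fin.ext (by simpa using hq)
    subst this
    exact lemX M hM hL u hu (by simp [hMu]) (by simp [hMu]) z
  | succ t ih =>
    intro u q hq hu hi hMu z
    have hul : u (Fin.last k) = 0 := hi _ (by rw [Fin.lt_def]; simp; omega)
    set w : Fin (k+1) → ℝ := Fin.cons 0 (fun i : Fin k => u i.castSucc) with hw
    have hw0 : w 0 = 0 := rfl
    have hws : ∀ i : Fin k, w i.succ = u i.castSucc := fun i => rfl
    have hMw : ∀ i : Fin k, (M *ᵥ w) i.castSucc = 0 := by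
      intro i
      have := congrFun hMu i.succ
      simp only [mulVec, dotProduct, Fin.sum_univ_castSucc, hul, Pi.zero_apply] at this
      simp only [mulVec, dotProduct, Fin.sum_univ_succ, hw0, hws, hH]
      simpa using this
    have hww := hT w hw0
    rw [dot_last _ _ hMw] at hww
    by_cases hwl : w (Fin.last k) = 0
    · have hz : (M *ᵥ w) (Fin.last k) = 0 := by
        have hl0 : (Fin.last k) ≠ 0 := by
          intro h
          have := congrArg Fin.val h
          simp at this; omega
        have key : ∀ s : ℝ, 0 ≤ 2 * s * (M *ᵥ w) (Fin.last k) + M (Fin.last k) (Fin.last k) := by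
          intro s
          have := hT (Pi.single (Fin.last k) 1 + s • w) (by simp [hw0, Ne.symm hl0])
          rw [form_expand M hM, dot_last _ _ hMw, dot_last _ _ hMw, hwl] at this
          simp at this
          linarith
        by_contra hne
        have := key ((-M (Fin.last k) (Fin.last k) - 1) / (2 * (M *ᵥ w) (Fin.last k)))
        have h2 : 2 * ((-M (Fin.last k) (Fin.last k) - 1) / (2 * (M *ᵥ w) (Fin.last k))) *
          (M *ᵥ w) (Fin.last k) = -M (Fin.last k) (Fin.last k) - 1 := by field_simp
        linarith
      have hM0 : M *ᵥ w = 0 := by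
        funext i
        induction i using Fin.lastCases with
        | last => simpa using hz
        | cast i => simpa using hMw i
      have hqk : q.1 < k := by omega
      refine ih w (Fin.succ ⟨q.1, hqk⟩) (by simp; omega) ?_ ?_ hM0 z
      · rw [hws]; exact hu
      · intro i hqi
        induction i using Fin.cases with
        | zero => rfl
        | succ i =>
          rw [hws]
          apply hi
          rw [Fin.lt_def] at hqi ⊢
          simp at hqi ⊢
          exact hqi
    · exact lemX M hM hL w hwl hMw hww z

theorem perturb {k : ℕ} (M : Matrix (Fin (k+1)) (Fin (k+1)) ℝ) (hM : Mᵀ = M)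
    (hL : ∀ x : Fin (k+1) → ℝ, x (Fin.last k) = 0 → 0 ≤ x ⬝ᵥ M *ᵥ x)
    (hd : 0 < M.det) (z : Fin (k+1) → ℝ) : 0 ≤ z ⬝ᵥ M *ᵥ z := by
  have hc : Continuous (fun e : ℝ => (M + e • (1 : Matrix _ _ ℝ)).det) := by
    apply Continuous.matrix_det; fun_prop
  have hev : ∀ᶠ e in nhds (0:ℝ), 0 < (M + e • (1 : Matrix _ _ ℝ)).det := by
    apply hc.continuousAt.eventually_const_lt; simpa using hd
  have hform : ∀ (e : ℝ) (x : Fin (k+1) → ℝ), x ⬝ᵥ (M + e • (1 : Matrix _ _ ℝ)) *ᵥ x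
      = x ⬝ᵥ M *ᵥ x + e * (x ⬝ᵥ x) := by
    intro e x
    simp [add_mulVec, smul_mulVec, dotProduct_add]
  have hev2 : ∀ᶠ e in nhdsWithin (0:ℝ) (Set.Ioi 0), 0 ≤ z ⬝ᵥ M *ᵥ z + e * (z ⬝ᵥ z) := by
    filter_upwards [nhdsWithin_le_nhds hev, self_mem_nhdsWithin] with e he he0
    have he0 : 0 < e := he0
    rw [← hform]
    set N := M + e • (1 : Matrix (Fin (k+1)) (Fin (k+1)) ℝ) with hN
    have hNs : Nᵀ = N := by simp [hN, hM]
    have hpos : ∀ x : Fin (k+1) → ℝ, x (Fin.last k) = 0 → x ≠ 0 → 0 < x ⬝ᵥ N *ᵥ x := by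
      intro x hx hx0
      rw [hform]
      have h1 : 0 < x ⬝ᵥ x := by
        have := dotProduct_self_eq_zero (v := x)
        have h2 : 0 ≤ x ⬝ᵥ x := Finset.sum_nonneg fun i _ => mul_self_nonneg _
        exact lt_of_le_of_ne h2 (fun h => hx0 (this.1 h.symm))
      have := hL x hx
      positivity
    have hdl : 0 < (N.submatrix Fin.castSucc Fin.castSucc).det := by
      apply Matrix.PosDef.det_pos
      apply Matrix.PosDef.of_dotProduct_mulVec_pos
      · ext i j
        have := congrFun (congrFun hNs i.castSucc) j.castSucc
        simpa using this
      · intro x hx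
        have h := hpos (Fin.snoc x 0) (by simp) (by
          intro h; apply hx; funext i
          have := congrFun h i.castSucc
          simpa using this)
        simp only [mulVec, dotProduct, Fin.sum_univ_castSucc, Fin.snoc_castSucc, Fin.snoc_last] at h
        simpa [mulVec, dotProduct] using h
    have hadj : N *ᵥ (fun i => N.adjugate i (Fin.last k)) = fun i => N.det * (1 : Matrix _ _ ℝ) i (Fin.last k) := by
      funext i
      have := congrFun (congrFun (mul_adjugate N) i) (Fin.last k)
      simpa [mul_apply, mulVec, dotProduct] using this
    have hwl : N.adjugate (Fin.last k) (Fin.last k) = (N.submatrix Fin.castSucc Fin.castSucc).det := by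
      rw [adjugate_fin_succ_eq_det_submatrix]
      simp [Fin.succAbove_last, ← two_mul]
    refine lemX N hNs ?_ (fun i => N.adjugate i (Fin.last k)) ?_ ?_ ?_ z
    · intro x hx
      by_cases h : x = 0
      · simp [h]
      · exact (hpos x hx h).le
    · simp only [hwl]; exact hdl.ne'
    · intro i
      rw [hadj]; simp [(Fin.castSucc_lt_last i).ne]
    · rw [hadj]; simp only [hwl]; simp; positivity
  have hlim : Filter.Tendsto (fun e : ℝ => z ⬝ᵥ M *ᵥ z + e * (z ⬝ᵥ z))
      (nhdsWithin (0:ℝ) (Set.Ioi 0)) (nhds (z ⬝ᵥ M *ᵥ z)) := by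
    have : Continuous (fun e : ℝ => z ⬝ᵥ M *ᵥ z + e * (z ⬝ᵥ z)) := by fun_prop
    have := this.tendsto 0
    simp only [zero_mul, add_zero] at this
    exact this.mono_left nhdsWithin_le_nhds
  exact ge_of_tendsto hlim hev2

theorem coreHankel {k : ℕ} (M : Matrix (Fin (k+1)) (Fin (k+1)) ℝ) (hM : Mᵀ = M)
    (hH : ∀ i j : Fin k, M i.castSucc j.succ = M i.succ j.castSucc)
    (hL : ∀ x : Fin (k+1) → ℝ, x (Fin.last k) = 0 → 0 ≤ x ⬝ᵥ M *ᵥ x)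
    (hT : ∀ x : Fin (k+1) → ℝ, x 0 = 0 → 0 ≤ x ⬝ᵥ M *ᵥ x)
    (hd : 0 ≤ M.det) (z : Fin (k+1) → ℝ) : 0 ≤ z ⬝ᵥ M *ᵥ z := by
  rcases hd.lt_or_eq with hd | hd
  · exact perturb M hM hL hd z
  · obtain ⟨u, hu, hMu⟩ := Matrix.exists_mulVec_eq_zero_iff.2 hd.symm
    obtain ⟨i0, hi0⟩ := Function.ne_iff.1 hu
    set S : Finset (Fin (k+1)) := Finset.univ.filter (fun i => u i ≠ 0) with hS
    have hSn : S.Nonempty := ⟨i0, by simpa [hS] using hi0⟩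
    have hq := S.max'_mem hSn
    refine shiftLem M hM hH hL hT (k - (S.max' hSn).1) u (S.max' hSn) (by omega) ?_ ?_ hMu z
    · simpa [hS] using hq
    · intro i hi
      by_contra h
      have := S.le_max' i (by simp [hS, h])
      exact absurd hi (not_lt.2 this)

/-- Hankel matrix of a sequence. -/
def hk (a : ℕ → ℝ) (s k : ℕ) : Matrix (Fin k) (Fin k) ℝ := Matrix.of fun i j => a (s + i.1 + j.1)

theorem hk_symm (a : ℕ → ℝ) (s k : ℕ) : (hk a s k)ᵀ = hk a s k := by
  ext i j
  simp [hk, add_right_comm]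

theorem hk_psd (a : ℕ → ℝ) (n r : ℕ)
    (h : ∀ k p q : ℕ, p + k ≤ n → q + k ≤ n → k ≤ r → 0 ≤ (hk a (p + q) k).det) (k : ℕ) :
    ∀ p q : ℕ, p + k ≤ n → q + k ≤ n → k ≤ r → ∀ z, 0 ≤ z ⬝ᵥ hk a (p + q) k *ᵥ z := by
  induction k with
  | zero => intro p q _ _ _ z; simp
  | succ k ih =>
    intro p q hp hq hk'
    apply coreHankel _ (hk_symm _ _ _)
    · intro i j
      simp only [hk, of_apply, Fin.val_castSucc, Fin.val_succ]
      congr 1; omega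
    · intro x hx
      have := ih p q (by omega) (by omega) (by omega) (fun i => x i.castSucc)
      simp only [mulVec, dotProduct, Fin.sum_univ_castSucc, hx]
      simpa [mulVec, dotProduct, hk] using this
    · intro x hx
      have := ih (p+1) (q+1) (by omega) (by omega) (by omega) (fun i => x i.succ)
      simp only [mulVec, dotProduct, Fin.sum_univ_succ, hx]
      simp only [mulVec, dotProduct, hk, of_apply] at this
      simp only [hk, of_apply, mul_zero, zero_mul, zero_add, Fin.val_succ]
      have e : ∀ i j : Fin k, p + q + (i.1 + 1) + (j.1 + 1) = p + 1 + (q + 1) + i.1 + j.1 := by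
        intro i j; omega
      simp only [e]
      exact this
    · exact h _ _ _ hp hq hk'

theorem hk_sum (a b : ℕ → ℝ) (n r : ℕ)
    (ha : ∀ k p q : ℕ, p + k ≤ n → q + k ≤ n → k ≤ r → 0 ≤ (hk a (p + q) k).det)
    (hb : ∀ k p q : ℕ, p + k ≤ n → q + k ≤ n → k ≤ r → 0 < (hk b (p + q) k).det)
    (k p q : ℕ) (hp : p + k ≤ n) (hq : q + k ≤ n) (hr : k ≤ r) :
    0 < (hk a (p + q) k + hk b (p + q) k).det := by
  have hA : (hk a (p+q) k).PosSemidef := by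
    apply PosSemidef.of_dotProduct_mulVec_nonneg
    · rw [IsHermitian, conjTranspose_eq_transpose_of_trivial]; exact hk_symm a (p+q) k
    · simpa using hk_psd a n r ha k p q hp hq hr
  have hB : (hk b (p+q) k).PosSemidef := by
    apply PosSemidef.of_dotProduct_mulVec_nonneg
    · rw [IsHermitian, conjTranspose_eq_transpose_of_trivial]; exact hk_symm b (p+q) k
    · simpa using hk_psd b n r (fun k p q h1 h2 h3 => (hb k p q h1 h2 h3).le) k p q hp hq hr
  have hB' : (hk b (p+q) k).PosDef :=
    hB.posDef_iff_isUnit.2 ((isUnit_iff_isUnit_det _).2 (isUnit_iff_ne_zero.2 (hb k p q hp hq hr).ne'))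
  exact (PosDef.posSemidef_add hA hB').det_pos

/-- signed kernel vector: minors of the first `m` rows with columns `i`, `j` deleted -/
noncomputable def pv {m : ℕ} (M : Matrix (Fin (m+1)) (Fin (m+2)) ℝ) (i : Fin (m+2)) : Fin (m+2) → ℝ :=
  i.insertNth (α := fun _ => ℝ) 0 (fun j : Fin (m+1) => (-1 : ℝ) ^ (m + j.1) *
    (M.submatrix Fin.castSucc (i.succAbove ∘ j.succAbove)).det)

/-- pairing of an arbitrary row with `pv` as a determinant -/
theorem pv_dot {m : ℕ} (M : Matrix (Fin (m+1)) (Fin (m+2)) ℝ) (i : Fin (m+2)) (y : Fin (m+2) → ℝ) :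
    y ⬝ᵥ pv M i = ((M.updateRow (Fin.last m) y).submatrix id i.succAbove).det := by
  rw [det_succ_row _ (Fin.last m)]
  simp only [dotProduct, Fin.sum_univ_succAbove _ i, pv, Fin.insertNth_apply_same,
    Fin.insertNth_apply_succAbove, mul_zero, zero_add]
  refine Finset.sum_congr rfl fun j _ => ?_
  have : ((M.updateRow (Fin.last m) y).submatrix id i.succAbove).submatrix (Fin.last m).succAbove
      j.succAbove = M.submatrix Fin.castSucc (i.succAbove ∘ j.succAbove) := by
    ext a b
    simp [Fin.succAbove_last, updateRow_apply, (Fin.castSucc_lt_last a).ne]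
  rw [this]
  simp [updateRow_apply]
  ring

theorem feketeStep {m : ℕ} (M : Matrix (Fin (m+1)) (Fin (m+2)) ℝ)
    (hN : ∀ (i : Fin (m+2)) (j : Fin (m+1)),
      0 < (M.submatrix Fin.castSucc (i.succAbove ∘ j.succAbove)).det)
    (h0 : 0 < (M.submatrix id (Fin.succAbove 0)).det)
    (h1 : 0 < (M.submatrix id (Fin.succAbove (Fin.last (m+1)))).det)
    (h : Fin (m+2)) (hh0 : h ≠ 0) (hhl : h ≠ Fin.last (m+1)) :
    0 < (M.submatrix id h.succAbove).det := by
  have hrow : ∀ i, (M (Fin.last m)) ⬝ᵥ pv M i = (M.submatrix id i.succAbove).det := by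
    intro i; rw [pv_dot, updateRow_eq_self]
  have hker : ∀ i (a : Fin m), M a.castSucc ⬝ᵥ pv M i = 0 := by
    intro i a
    rw [pv_dot]
    apply det_zero_of_row_eq (i := a.castSucc) (j := Fin.last m) (Fin.castSucc_lt_last a).ne
    ext b
    simp [updateRow_apply, (Fin.castSucc_lt_last a).ne]
  have hself : ∀ i, pv M i i = 0 := by intro i; simp [pv]
  have hlast : ∀ i, i ≠ Fin.last (m+1) → 0 < pv M i (Fin.last (m+1)) := by
    intro i hi
    have : Fin.last (m+1) = i.succAbove (Fin.last m) := (Fin.succAbove_ne_last_last hi).symm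
    rw [this, pv, Fin.insertNth_apply_succAbove]
    have := hN i (Fin.last m)
    simp only [Fin.val_last, ← two_mul, pow_mul]
    simpa using this
  have hzero : ∀ i, i ≠ 0 → 0 < (-1 : ℝ) ^ m * pv M i 0 := by
    intro i hi
    have : (0 : Fin (m+2)) = i.succAbove 0 := (Fin.succAbove_ne_zero_zero hi).symm
    rw [this, pv, Fin.insertNth_apply_succAbove]
    have := hN i 0
    simp only [Fin.val_zero, add_zero, ← mul_assoc, ← pow_add, ← two_mul, pow_mul]
    simpa using this
  have hl0 : (0 : Fin (m+2)) ≠ Fin.last (m+1) := by simp [Fin.ext_iff]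
  set α := pv M h (Fin.last (m+1)) / pv M 0 (Fin.last (m+1)) with hα
  set β := pv M h 0 / pv M (Fin.last (m+1)) 0 with hβ
  have hαp : 0 < α := div_pos (hlast h hhl) (hlast 0 hl0)
  have hβp : 0 < β := by
    have := div_pos (hzero h hh0) (hzero (Fin.last (m+1)) hl0.symm)
    rwa [mul_div_mul_left _ _ (by simp)] at this
  set v := pv M h - α • pv M 0 - β • pv M (Fin.last (m+1)) with hv
  have hv0 : v 0 = 0 := by
    have : pv M (Fin.last (m+1)) 0 ≠ 0 := by
      intro h; have := hzero _ hl0.symm; rw [h] at this; simp at this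
    simp [hv, hself, hβ, this]
  have hvl : v (Fin.last (m+1)) = 0 := by
    have := (hlast 0 hl0).ne'
    simp [hv, hself, hα, this]
  have hvk : ∀ a : Fin m, M a.castSucc ⬝ᵥ v = 0 := by
    intro a
    simp [hv, dotProduct_sub, hker]
  have hvz : ∀ b : Fin m, v (b.castSucc.succ) = 0 := by
    have hd := hN 0 (Fin.last m)
    have := Matrix.eq_zero_of_mulVec_eq_zero hd.ne' (v := fun b : Fin m => v (b.castSucc.succ)) (by
      funext a
      have := hvk a
      simp only [dotProduct, Fin.sum_univ_succ (n := m+1), hv0, Fin.sum_univ_castSucc (n := m), Fin.succ_last, hvl] at this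
      simpa [mulVec, dotProduct, Fin.succAbove_last] using this)
    exact fun b => congrFun this b
  have hvv : v = 0 := by
    funext i
    induction i using Fin.cases with
    | zero => exact hv0
    | succ i =>
      induction i using Fin.lastCases with
      | last => exact hvl
      | cast i => exact hvz i
  have hfin : M (Fin.last m) ⬝ᵥ v = 0 := by simp [hvv]
  simp only [hv, dotProduct_sub, dotProduct_smul, hrow, smul_eq_mul] at hfin
  have := mul_pos hαp h0
  have := mul_pos hβp h1
  linarith

theorem feketeCols {p n m : ℕ} (A : Matrix (Fin p) (Fin n) ℝ) (f : Fin (m+1) → Fin p)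
    (hN : ∀ g : Fin m → Fin n, StrictMono g → 0 < (A.submatrix (f ∘ Fin.castSucc) g).det)
    (hC : ∀ g : Fin (m+1) → Fin n, (∀ i, (g i).1 = (g 0).1 + i.1) → 0 < (A.submatrix f g).det)
    (d : ℕ) : ∀ g : Fin (m+1) → Fin n, StrictMono g → (g (Fin.last m)).1 - (g 0).1 ≤ d →
      0 < (A.submatrix f g).det := by
  induction d with
  | zero =>
    intro g hg hd
    apply hC
    have hm : m = 0 := by
      by_contra hm
      have : g 0 < g (Fin.last m) := hg (by rw [Fin.lt_def]; simp; omega)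
      rw [Fin.lt_def] at this; omega
    subst hm
    intro i
    have : i = 0 := Fin.ext (by have := i.2; simp)
    subst this; simp
  | succ d ih =>
    intro g hg hd
    by_cases hc : ∀ i : Fin m, (g i.succ).1 = (g i.castSucc).1 + 1
    · apply hC
      intro i
      induction i using Fin.induction with
      | zero => simp
      | succ i hi => rw [hc, hi]; simp; omega
    · push Not at hc
      obtain ⟨i, hi⟩ := hc
      obtain ⟨l, rfl⟩ : ∃ l, m = l + 1 := ⟨m - 1, by have := i.2; omega⟩
      have hlt : g i.castSucc < g i.succ := hg (Fin.castSucc_lt_succ)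
      rw [Fin.lt_def] at hlt
      set c : Fin n := ⟨(g i.castSucc).1 + 1, by omega⟩ with hcdef
      set h : Fin (l+3) := i.castSucc.succ with hh
      set G : Fin (l+3) → Fin n := h.insertNth (α := fun _ => Fin n) c g with hG
      have hGm : StrictMono G := by
        apply Fin.strictMono_insertNth hg
        · rw [Fin.lt_def]; simp [hcdef]
        · rw [Fin.lt_def]; simp [hcdef]; omega
      have hGg : G ∘ h.succAbove = g := by
        funext j; simp [hG]
      have hs : A.submatrix f g = (A.submatrix f G).submatrix id h.succAbove := by
        rw [← hGg]; rfl
      have hG0 : G 0 = g 0 := by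
        rw [← hGg]; simp [hh]
      have hGl : G (Fin.last _) = g (Fin.last _) := by
        rw [← hGg]; simp only [Function.comp]; rw [Fin.succAbove_ne_last_last]
        simp [hh, Fin.ext_iff]; omega
      rw [hs]
      apply feketeStep
      · intro a b
        exact hN (G ∘ (a.succAbove ∘ b.succAbove)) (hGm.comp
          ((Fin.strictMono_succAbove a).comp (Fin.strictMono_succAbove b)))
      · refine ih (G ∘ Fin.succAbove 0) (hGm.comp (Fin.strictMono_succAbove _)) ?_
        have : G 0 < G 1 := hGm (by simp)
        rw [Fin.lt_def] at this
        simp only [Function.comp, Fin.succAbove_zero, Fin.succ_last, Fin.succ_zero_eq_one, hGl]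
        rw [hG0] at this
        omega
      · refine ih (G ∘ Fin.succAbove (Fin.last _)) (hGm.comp (Fin.strictMono_succAbove _)) ?_
        have : G (Fin.last _).castSucc < G (Fin.last (l+2)) := hGm (Fin.castSucc_lt_last _)
        rw [Fin.lt_def, hGl] at this
        simp only [Function.comp, Fin.succAbove_last, Fin.castSucc_zero, hG0]
        omega
      · simp [hh]
      · simp [hh, Fin.ext_iff]; omega

theorem fekete {n r : ℕ} (A : Matrix (Fin n) (Fin n) ℝ)
    (h : ∀ (k : ℕ), k ≤ r → ∀ f g : Fin k → Fin n,
      (∃ a, ∀ i, (f i).1 = a + i.1) → (∃ b, ∀ i, (g i).1 = b + i.1) → 0 < (A.submatrix f g).det)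
    (k : ℕ) : k ≤ r → ∀ f g : Fin k → Fin n, StrictMono f → StrictMono g →
      0 < (A.submatrix f g).det := by
  induction k with
  | zero => intro _ f g _ _; simp
  | succ m ih =>
    intro hk f g hf hg
    have ih := ih (by omega)
    have smono : ∀ f : Fin (m+1) → Fin n, (∀ i, (f i).1 = (f 0).1 + i.1) → StrictMono f := by
      intro f hf i j hij
      rw [Fin.lt_def] at hij ⊢
      rw [hf i, hf j]; omega
    have hcast : StrictMono (Fin.castSucc : Fin m → Fin (m+1)) := Fin.strictMono_castSucc
    have step1 : ∀ f g : Fin (m+1) → Fin n, (∀ i, (f i).1 = (f 0).1 + i.1) → StrictMono g →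
        0 < (A.submatrix f g).det := by
      intro f g hf hg
      refine feketeCols A f (fun g' hg' => ih _ g' ((smono f hf).comp hcast) hg') ?_ _ g hg le_rfl
      intro g' hg'
      exact h _ hk f g' ⟨_, hf⟩ ⟨_, hg'⟩
    have := feketeCols Aᵀ g (fun f' hf' => by
        rw [← transpose_submatrix, det_transpose]
        exact ih f' _ hf' (hg.comp hcast)) (fun f' hf' => by
        rw [← transpose_submatrix, det_transpose]
        exact step1 f' g hf' hg) _ f hf le_rfl
    rwa [← transpose_submatrix, det_transpose] at this

theorem exists_seq {n : ℕ} (A : Matrix (Fin n) (Fin n) ℝ) (hA : IsHankel A) :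
    ∃ a : ℕ → ℝ, ∀ i j : Fin n, A i j = a (i.1 + j.1) := by
  classical
  refine ⟨fun s => if h : ∃ p : Fin n × Fin n, p.1.1 + p.2.1 = s then
    A h.choose.1 h.choose.2 else 0, fun i j => ?_⟩
  have h : ∃ p : Fin n × Fin n, p.1.1 + p.2.1 = i.1 + j.1 := ⟨(i, j), rfl⟩
  simp only [dif_pos h]
  exact hA _ _ _ _ h.choose_spec.symm

theorem ctgSub_eq {n : ℕ} (A : Matrix (Fin n) (Fin n) ℝ) (a : ℕ → ℝ)
    (hA : ∀ i j : Fin n, A i j = a (i.1 + j.1)) (k p q : ℕ) (hp : p + k ≤ n) (hq : q + k ≤ n) :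
    ctgSub A k p q hp hq = hk a (p + q) k := by
  ext i j
  simp only [ctgSub, hk, of_apply, hA]
  congr 1; omega

end HankelTP


/-- Theorem 3.2(c). If `A` is a Hankel matrix all of whose contiguous
minors of size at most `r` are nonnegative, and `B` is a Hankel matrix all of whose
contiguous minors of size at most `r` are positive, then `A + B` is TP_r. -/
theorem hankel_sum_contiguous_nonneg_pos_imp_TPr {n : ℕ} (r : ℕ)
    (A B : Matrix (Fin n) (Fin n) ℝ) (hHA : IsHankel A) (hHB : IsHankel B)
    (hA : ∀ (k a b : ℕ) (ha : a + k ≤ n) (hb : b + k ≤ n),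
      k ≤ r → 0 ≤ (ctgSub A k a b ha hb).det)
    (hB : ∀ (k a b : ℕ) (ha : a + k ≤ n) (hb : b + k ≤ n),
      k ≤ r → 0 < (ctgSub B k a b ha hb).det) :
    IsTPr (A + B) r := by
  obtain ⟨a, ha⟩ := HankelTP.exists_seq A hHA
  obtain ⟨b, hb⟩ := HankelTP.exists_seq B hHB
  have hsum := HankelTP.hk_sum a b n r
    (fun k p q hp hq hr => by
      rw [← HankelTP.ctgSub_eq A a ha k p q hp hq]; exact hA k p q hp hq hr)
    (fun k p q hp hq hr => by
      rw [← HankelTP.ctgSub_eq B b hb k p q hp hq]; exact hB k p q hp hq hr)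
  refine HankelTP.fekete (A + B) ?_
  rintro k hk f g ⟨p, hp⟩ ⟨q, hq⟩
  rcases Nat.eq_zero_or_pos k with rfl | hk0
  · simp
  · have h1 := (f ⟨k - 1, by omega⟩).2
    have h2 := (g ⟨k - 1, by omega⟩).2
    rw [hp] at h1
    rw [hq] at h2
    simp only at h1 h2
    have := hsum k p q (by omega) (by omega) hk
    convert this using 2
    ext i j
    have e : p + i.1 + (q + j.1) = p + q + i.1 + j.1 := by omega
    simp [HankelTP.hk, ha, hb, hp, hq, e]
end

section
/- Let A and B be n-by-n Hankel matrices of real numbers. (a) If A and B are both TN_r, then A + B is TN_r. (b) If A is TN_r and B is TP_r, then A + B is TP_r. -/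
open Matrix
theorem fk_plucker (m : ℕ) (N : Matrix (Fin (m+3)) (Fin (m+2)) ℝ) (q : Fin (m+1)) :
    (N.submatrix (q.succ.castSucc).succAbove id).det *
      (N.submatrix (fun i : Fin (m+1) => i.castSucc.succ) Fin.castSucc).det =
    (N.submatrix (0 : Fin (m+3)).succAbove id).det *
      (N.submatrix (fun i : Fin (m+1) => (q.succ.succAbove i).castSucc) Fin.castSucc).det +
    (N.submatrix (Fin.last (m+2)).succAbove id).det *
      (N.submatrix (fun i : Fin (m+1) => (q.castSucc.succAbove i).succ) Fin.castSucc).det := by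
  set M := N.submatrix (fun i : Fin (m+1) => i.castSucc.succ) (Fin.castSucc : Fin (m+1) → _) with hM
  let D : Fin (m+3) → ℝ := fun j => (N.submatrix j.succAbove id).det
  let v : Fin (m+3) → Fin (m+1) → ℝ := fun j c => N j c.castSucc
  have hrel : ∀ c, ∑ j : Fin (m+3), (-1 : ℝ)^(j : ℕ) * D j * N j c = 0 := by
    intro c
    have h0 : (Matrix.of (fun i => (Fin.cons (N i c) (N i) : Fin (m+3) → ℝ))).det = 0 := by
      apply Matrix.det_zero_of_column_eq (i := 0) (j := c.succ) (Fin.succ_ne_zero c).symm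
      intro k; simp
    rw [Matrix.det_succ_column_zero] at h0
    rw [← h0]
    refine Finset.sum_congr rfl fun j _ => ?_
    have : (Matrix.of (fun i => (Fin.cons (N i c) (N i) : Fin (m+3) → ℝ))).submatrix
        j.succAbove Fin.succ = N.submatrix j.succAbove id := by
      ext a b; simp
    rw [this]; simp [D]; ring
  let φ : (Fin (m+1) → ℝ) → ℝ := fun x => (M.updateRow q x).det
  have hφ : ∀ x, φ x = (cramer Mᵀ x) q := fun x => (Matrix.cramer_transpose_apply M x q).symm
  have hsum : ∑ j : Fin (m+3), (-1 : ℝ)^(j : ℕ) * D j * φ (v j) = 0 := by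
    have : cramer Mᵀ (∑ j : Fin (m+3), ((-1 : ℝ)^(j : ℕ) * D j) • v j) = 0 := by
      have h0 : (∑ j : Fin (m+3), ((-1 : ℝ)^(j : ℕ) * D j) • v j) = 0 := by
        ext c
        simpa [Finset.sum_apply, v] using hrel c.castSucc
      rw [h0, map_zero]
    have h2 := congrFun this q
    simp only [map_sum, map_smul, Finset.sum_apply, Pi.smul_apply, smul_eq_mul, Pi.zero_apply] at h2
    simpa only [hφ] using h2
  have hin : ∀ i : Fin (m+1), i ≠ q → φ (v i.castSucc.succ) = 0 := by
    intro i hi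
    apply Matrix.det_zero_of_row_eq hi
    rw [Matrix.updateRow_ne hi, Matrix.updateRow_self]
    rfl
  have hq : φ (v q.castSucc.succ) = M.det := by
    have : M.updateRow q (v q.castSucc.succ) = M := by
      have : v q.castSucc.succ = M q := rfl
      rw [this, Matrix.updateRow_eq_self]
    simp only [φ, this]
  have hsubM : ∀ x (c : Fin m → Fin (m+1)), (M.updateRow q x).submatrix q.succAbove c = M.submatrix q.succAbove c := by
    intro x c; ext a b
    simp [Matrix.submatrix_apply]
  have h0 : φ (v 0) = (-1 : ℝ)^(q : ℕ) *
      (N.submatrix (fun i : Fin (m+1) => (q.succ.succAbove i).castSucc) Fin.castSucc).det := by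
    simp only [φ]
    rw [Matrix.det_succ_row _ q, Matrix.det_succ_row _ 0, Finset.mul_sum]
    refine Finset.sum_congr rfl fun c _ => ?_
    rw [hsubM]
    have : (N.submatrix (fun i : Fin (m+1) => (q.succ.succAbove i).castSucc)
        (Fin.castSucc : Fin (m+1) → _)).submatrix (Fin.succAbove 0) c.succAbove =
        M.submatrix q.succAbove c.succAbove := by
      ext a b; simp [hM]
    rw [this]
    simp [v, pow_add]
    ring
  have hl : φ (v (Fin.last (m+2))) = (-1 : ℝ)^((q : ℕ) + m) *
      (N.submatrix (fun i : Fin (m+1) => (q.castSucc.succAbove i).succ) Fin.castSucc).det := by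
    simp only [φ]
    rw [Matrix.det_succ_row _ q, Matrix.det_succ_row _ (Fin.last m), Finset.mul_sum]
    refine Finset.sum_congr rfl fun c _ => ?_
    rw [hsubM]
    have : (N.submatrix (fun i : Fin (m+1) => (q.castSucc.succAbove i).succ)
        (Fin.castSucc : Fin (m+1) → _)).submatrix (Fin.succAbove (Fin.last m)) c.succAbove =
        M.submatrix q.succAbove c.succAbove := by
      ext a b; simp [hM]
    rw [this]
    have e : (q.castSucc.succAbove (Fin.last m)) = Fin.last (m+1) :=
      (Fin.succAbove_of_lt_succ _ _ (by simp [Fin.lt_def]; omega)).trans (by simp)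
    have hm : ((-1:ℝ)^m)*((-1:ℝ)^m) = 1 := by rw [← mul_pow]; simp
    simp only [updateRow_self, submatrix_apply, v, pow_add, Fin.val_last, e, Fin.succ_last]
    linear_combination (-((-1:ℝ)^(q:ℕ) * (-1)^(c:ℕ) * N (Fin.last (m+2)) c.castSucc * (M.submatrix q.succAbove c.succAbove).det)) * hm
  rw [Fin.sum_univ_succ, Fin.sum_univ_castSucc, Finset.sum_eq_single q] at hsum
  · rw [hq, h0, Fin.succ_last, hl] at hsum
    have hm : ((-1:ℝ)^m)*((-1:ℝ)^m) = 1 := by rw [← mul_pow]; simp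
    have hqq : ((-1:ℝ)^(q:ℕ))*((-1:ℝ)^(q:ℕ)) = 1 := by rw [← mul_pow]; simp
    simp only [Fin.val_zero, Fin.val_succ, Fin.val_castSucc, Fin.val_last, Nat.succ_eq_add_one, pow_add, pow_zero] at hsum
    have hDq : (N.submatrix (q.succ.castSucc).succAbove id).det = D q.castSucc.succ := rfl
    rw [hDq]
    change _ = D 0 * _ + D (Fin.last (m+2)) * _
    generalize D (Fin.last (m+2)) = Dl at *
    generalize D 0 = D0 at *
    generalize D q.castSucc.succ = Dq at *
    linear_combination (-(-1:ℝ)^(q:ℕ)) * hsum + (D0 * (N.submatrix (fun i : Fin (m+1) => (q.succ.succAbove i).castSucc) Fin.castSucc).det - Dq * M.det + Dl * (N.submatrix (fun i : Fin (m+1) => (q.castSucc.succAbove i).succ) Fin.castSucc).det * ((-1)^m * (-1)^m)) * hqq + Dl * (N.submatrix (fun i : Fin (m+1) => (q.castSucc.succAbove i).succ) Fin.castSucc).det * hm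
  · intro b _ hb
    rw [hin b hb, mul_zero]
  · simp

/-- Contiguous index selection. -/
def FkContig {k m : ℕ} (f : Fin k → Fin m) : Prop :=
  ∀ i j : Fin k, (f i).1 + j.1 = (f j).1 + i.1

theorem fk_contig_of_step {k m : ℕ} (f : Fin (k+1) → Fin m)
    (h : ∀ i : Fin k, (f i.succ).1 = (f i.castSucc).1 + 1) : FkContig f := by
  have h1 : ∀ i : Fin (k+1), (f i).1 = (f 0).1 + i.1 := by
    intro i
    induction i using Fin.induction with
    | zero => simp
    | succ i ih => rw [h, ih]; simp; omega
  intro i j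
  rw [h1 i, h1 j]; omega

theorem fk_rows {M m : ℕ} (N : Matrix (Fin M) (Fin (m+2)) ℝ)
    (hsmall : ∀ f : Fin (m+1) → Fin M, StrictMono f → 0 < (N.submatrix f Fin.castSucc).det)
    (hcont : ∀ f : Fin (m+2) → Fin M, StrictMono f → FkContig f → 0 < (N.submatrix f id).det) :
    ∀ (d : ℕ) (f : Fin (m+2) → Fin M), StrictMono f → (f (Fin.last _)).1 - (f 0).1 ≤ d →
      0 < (N.submatrix f id).det := by
  intro d
  induction d with
  | zero =>
    intro f hf hd
    have : f 0 < f (Fin.last _) := hf (Fin.last_pos)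
    rw [Fin.lt_def] at this
    omega
  | succ d ih =>
    intro f hf hd
    by_cases hc : ∀ i : Fin (m+1), (f i.succ).1 = (f i.castSucc).1 + 1
    · exact hcont f hf (fk_contig_of_step f hc)
    push Not at hc
    obtain ⟨q, hq⟩ := hc
    have hlt : f q.castSucc < f q.succ := hf (Fin.castSucc_lt_succ)
    rw [Fin.lt_def] at hlt
    let x : Fin M := ⟨(f q.castSucc).1 + 1, by have := (f q.succ).2; omega⟩
    have hx1 : f q.castSucc < x := by simp [Fin.lt_def, x]
    have hx2 : x < f q.succ := by simp only [Fin.lt_def, x]; omega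
    let h : Fin (m+3) → Fin M := Fin.insertNth q.castSucc.succ (α := fun _ => Fin M) x f
    have hh : StrictMono h := Fin.strictMono_insertNth hf q x hx1 hx2
    have hhf : h ∘ (q.succ.castSucc).succAbove = f := by
      funext i
      exact Fin.insertNth_apply_succAbove (α := fun _ => Fin M) _ _ _ _
    have e0 : h 0 = f 0 := by
      have := congrFun hhf 0
      rw [← this]; simp
    have el : h (Fin.last _) = f (Fin.last _) := by
      have := congrFun hhf (Fin.last _)
      rw [← this]; simp
    have h01 : h 0 < h 1 := hh (by simp)
    have hll : h (Fin.last (m+1)).castSucc < h (Fin.last _) := hh (Fin.castSucc_lt_last _)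
    have h1l : h 0 < h (Fin.last (m+1)).castSucc := hh (by simp [Fin.lt_def])
    rw [Fin.lt_def] at h01 hll h1l
    have P := fk_plucker m (N.submatrix h id) q
    simp only [Matrix.submatrix_submatrix, Function.id_comp, hhf] at P
    have d0 : 0 < (N.submatrix (h ∘ Fin.succAbove 0) id).det := by
      apply ih _ (hh.comp (Fin.strictMono_succAbove _))
      have a1 : (h ∘ Fin.succAbove 0) 0 = h 1 := by simp
      have a2 : (h ∘ Fin.succAbove 0) (Fin.last (m+1)) = h (Fin.last _) := by simp
      rw [a1, a2, el]
      rw [e0] at h01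
      omega
    have dl : 0 < (N.submatrix (h ∘ Fin.succAbove (Fin.last _)) id).det := by
      apply ih _ (hh.comp (Fin.strictMono_succAbove _))
      have a1 : (h ∘ Fin.succAbove (Fin.last (m+2))) 0 = h 0 := by simp
      have a2 : (h ∘ Fin.succAbove (Fin.last (m+2))) (Fin.last (m+1)) =
        h (Fin.last (m+1)).castSucc := by simp
      rw [a1, a2, e0]
      rw [e0] at h1l
      rw [el] at hll
      omega
    have s1 := hsmall (h ∘ fun i : Fin (m+1) => i.castSucc.succ)
      (hh.comp (by intro a b hab; simpa using hab))
    have s2 := hsmall (h ∘ fun i : Fin (m+1) => (q.succ.succAbove i).castSucc)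
      (hh.comp (by intro a b hab; simpa using hab))
    have s3 := hsmall (h ∘ fun i : Fin (m+1) => (q.castSucc.succAbove i).succ)
      (hh.comp (by intro a b hab; simpa using hab))
    have := add_pos (mul_pos d0 s2) (mul_pos dl s3)
    rw [← P] at this
    exact (mul_pos_iff_of_pos_right s1).mp this

theorem fk_fekete {m n : ℕ} (A : Matrix (Fin m) (Fin n) ℝ) (r : ℕ)
    (h : ∀ k ≤ r, ∀ (f : Fin k → Fin m) (g : Fin k → Fin n), StrictMono f → StrictMono g →
      FkContig f → FkContig g → 0 < (A.submatrix f g).det) : IsTPr A r := by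
  intro k
  induction k with
  | zero => intro _ f g _ _; simp
  | succ k ih =>
    intro hk f g hf hg
    cases k with
    | zero =>
      apply h 1 hk f g hf hg <;>
      · intro i j
        rw [Subsingleton.elim i j]
    | succ k =>
      have ih' := ih (by omega)
      have stage1 : ∀ (f : Fin (k+2) → Fin m) (g : Fin (k+2) → Fin n), StrictMono f →
          StrictMono g → FkContig g → 0 < (A.submatrix f g).det := by
        intro f g hf hg hgc
        have := fk_rows (A.submatrix id g)
          (fun f' hf' => ih' f' (g ∘ Fin.castSucc) hf' (hg.comp (Fin.strictMono_castSucc)))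
          (fun f' hf' hc => h _ hk f' g hf' hg hc hgc) _ f hf le_rfl
        simpa using this
      have := fk_rows (A.submatrix f id)ᵀ
          (fun g' hg' => by
            have := ih' (f ∘ Fin.castSucc) g' (hf.comp (Fin.strictMono_castSucc)) hg'
            rw [← Matrix.det_transpose] at this
            exact this)
          (fun g' hg' hc => by
            have := stage1 f g' hf hg' hc
            rw [← Matrix.det_transpose] at this
            exact this) _ g hg le_rfl
      rw [← Matrix.det_transpose]
      exact this

theorem fk_psd_of_minors {k : ℕ} (M : Matrix (Fin k) (Fin k) ℝ) (hM : M.IsHermitian)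
    (h : ∀ s : Finset (Fin k),
      0 ≤ (M.submatrix (Subtype.val : s → Fin k) (Subtype.val : s → Fin k)).det) :
    M.PosSemidef := by
  rw [hM.posSemidef_iff_eigenvalues_nonneg]
  intro i
  by_contra hneg
  simp only [Pi.zero_apply, not_le] at hneg
  set μ := hM.eigenvalues i with hμ
  let p : Polynomial ℝ := det (1 + (Polynomial.X : Polynomial ℝ) • M.map Polynomial.C)
  have hcoef : ∀ j, 0 ≤ p.coeff j := by
    intro j
    simp only [p]
    rw [Matrix.coeff_det_one_add_X_smul_eq_sum_minors]
    exact Finset.sum_nonneg fun s _ => h s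
  have hy : 0 < -μ⁻¹ := by
    have := inv_lt_zero.mpr hneg
    linarith
  have heval : ∀ y : ℝ, p.eval y = (1 + y • M).det := by
    intro y
    simp only [p]
    rw [← Polynomial.coe_evalRingHom, RingHom.map_det]
    congr 1
    ext a b
    simp [Matrix.one_apply, apply_ite (Polynomial.eval y)]
    ring
  have hp0 : p.coeff 0 = 1 := by
    rw [Polynomial.coeff_zero_eq_eval_zero, heval]; simp
  have hpos : 0 < p.eval (-μ⁻¹) := by
    rw [Polynomial.eval_eq_sum_range]
    apply Finset.sum_pos' (fun j _ => mul_nonneg (hcoef j) (pow_nonneg hy.le _))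
    exact ⟨0, by simp, by simp [hp0]⟩
  have hz : (1 + (-μ⁻¹) • M).det = 0 := by
    rw [← Matrix.exists_mulVec_eq_zero_iff]
    refine ⟨WithLp.ofLp (hM.eigenvectorBasis i), ?_, ?_⟩
    · intro h0
      apply hM.eigenvectorBasis.toBasis.ne_zero i
      ext a
      simpa using congrFun h0 a
    · rw [Matrix.add_mulVec, Matrix.smul_mulVec, hM.mulVec_eigenvectorBasis, Matrix.one_mulVec,
        ← hμ, smul_smul]
      have : -μ⁻¹ * μ = -1 := by
        rw [neg_mul, inv_mul_cancel₀ hneg.ne]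
      rw [this]; simp
  rw [heval, hz] at hpos
  exact lt_irrefl _ hpos

theorem fk_contig_psd {n r k : ℕ} (A : Matrix (Fin n) (Fin n) ℝ) (hA : IsHankel A)
    (hT : IsTNr A r) (hk : k ≤ r) (f g : Fin k → Fin n) (hf : StrictMono f) (hg : StrictMono g)
    (hfc : FkContig f) (hgc : FkContig g) : (A.submatrix f g).PosSemidef := by
  apply fk_psd_of_minors
  · ext i j
    simp only [Matrix.conjTranspose_apply, Matrix.submatrix_apply, star_trivial]
    apply hA
    have := hfc i j
    have := hgc i j
    omega
  · intro s
    have hc : s.card ≤ k := by simpa using s.card_le_univ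
    let e := s.orderIsoOfFin rfl
    rw [← Matrix.det_submatrix_equiv_self e.toEquiv]
    have := hT s.card (hc.trans hk) (f ∘ fun i => (e i).1) (g ∘ fun i => (e i).1)
      (hf.comp (fun a b hab => e.strictMono hab)) (hg.comp (fun a b hab => e.strictMono hab))
    exact this

/-- A strictly totally positive Hankel matrix, used for perturbation. -/
noncomputable def fkC (n : ℕ) : Matrix (Fin n) (Fin n) ℝ :=
  Matrix.of fun i j => ∑ l : Fin n, (((l : ℝ) + 1)^2) ^ (i.1 + j.1)

theorem fkC_pd {n k : ℕ} (f g : Fin k → Fin n) (hf : StrictMono f)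
    (hfc : FkContig f) (hgc : FkContig g) : ((fkC n).submatrix f g).PosDef := by
  have hkn : k ≤ n := by simpa using Fintype.card_le_of_injective f hf.injective
  obtain ⟨c, hc⟩ : ∃ c : ℕ, ∀ i j : Fin k, (f i).1 + (g j).1 = c + i.1 + j.1 := by
    cases k with
    | zero => exact ⟨0, fun i => i.elim0⟩
    | succ k =>
      refine ⟨(f 0).1 + (g 0).1, fun i j => ?_⟩
      have h1 := hfc i 0
      have h2 := hgc j 0
      simp only [Fin.val_zero] at h1 h2
      omega
  let V : Matrix (Fin n) (Fin k) ℝ :=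
    Matrix.of fun l i => ((l : ℝ) + 1)^c * (((l : ℝ) + 1)^2) ^ i.1
  have hV : (fkC n).submatrix f g = Vᴴ * V := by
    ext i j
    simp only [fkC, V, Matrix.submatrix_apply, Matrix.of_apply, Matrix.mul_apply,
      Matrix.conjTranspose_apply, star_trivial]
    refine Finset.sum_congr rfl fun l _ => ?_
    rw [hc]
    generalize (l : ℝ) + 1 = t
    ring
  rw [hV]
  apply Matrix.PosDef.conjTranspose_mul_self
  rw [← Matrix.coe_mulVecLin, ← LinearMap.ker_eq_bot, LinearMap.ker_eq_bot']
  intro x hx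
  let w : Fin k → ℝ := fun l => ((l : ℝ) + 1)^2
  have hw : Function.Injective w := by
    intro a b hab
    have := (pow_left_inj₀ (by positivity) (by positivity) two_ne_zero).mp hab
    apply Fin.ext
    have h3 : (a.1 : ℝ) = b.1 := by linarith
    exact_mod_cast h3
  apply Matrix.eq_zero_of_mulVec_eq_zero (M := Matrix.vandermonde w)
    (Matrix.det_vandermonde_ne_zero_iff.mpr hw)
  funext l
  have := congrFun hx (Fin.castLE hkn l)
  simp only [Matrix.mulVecLin_apply, Matrix.mulVec, dotProduct, V, Matrix.of_apply,
    Fin.val_castLE, Pi.zero_apply, mul_assoc] at this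
  rw [← Finset.mul_sum] at this
  have h2 := (mul_eq_zero.mp this).resolve_left (by positivity)
  simpa [Matrix.mulVec, dotProduct, Matrix.vandermonde_apply, w] using h2

/-- Corollary 3.3. For `n`-by-`n` Hankel matrices `A` and `B`:
(a) if `A` and `B` are TN_r then `A + B` is TN_r;
(b) if `A` is TN_r and `B` is TP_r then `A + B` is TP_r. -/
theorem hankel_sum_TNr_TPr {n : ℕ} (r : ℕ)
    (A B : Matrix (Fin n) (Fin n) ℝ) (hHA : IsHankel A) (hHB : IsHankel B) :
    (IsTNr A r → IsTNr B r → IsTNr (A + B) r) ∧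
    (IsTNr A r → IsTPr B r → IsTPr (A + B) r) := by
  constructor
  · intro hA hB
    have key : ∀ ε : ℝ, 0 < ε → IsTPr (A + B + ε • fkC n) r := by
      intro ε hε
      apply fk_fekete
      intro k hk f g hf hg hfc hgc
      have h1 := fk_contig_psd A hHA hA hk f g hf hg hfc hgc
      have h2 := fk_contig_psd B hHB hB hk f g hf hg hfc hgc
      have h3 := (fkC_pd f g hf hfc hgc).smul hε
      exact (Matrix.PosDef.posSemidef_add (h1.add h2) h3).det_pos
    intro k hk f g hf hg
    have hcont : Continuous fun ε : ℝ => ((A + B + ε • fkC n).submatrix f g).det := by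
      fun_prop
    have ht := (hcont.tendsto 0).mono_left (nhdsWithin_le_nhds (s := Set.Ioi 0))
    have h0 := ge_of_tendsto (b := 0) ht (by
      filter_upwards [self_mem_nhdsWithin] with ε hε
      exact (key ε hε k hk f g hf hg).le)
    simpa using h0
  · intro hA hB
    apply fk_fekete
    intro k hk f g hf hg hfc hgc
    have h1 := fk_contig_psd A hHA hA hk f g hf hg hfc hgc
    have h2 := fk_contig_psd B hHB (fun k hk f g hf hg => (hB k hk f g hf hg).le)
      hk f g hf hg hfc hgc
    have h3 : (B.submatrix f g).PosDef := by
      rw [h2.posDef_iff_isUnit, Matrix.isUnit_iff_isUnit_det]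
      exact (hB k hk f g hf hg).ne'.isUnit
    exact (Matrix.PosDef.posSemidef_add h1 h3).det_pos
end

section
/- For every n ≥ 1 and every r with 1 ≤ r ≤ n, the n-by-n TP_r Hankel matrices are dense in the n-by-n TN_r Hankel matrices: for every TN_r Hankel matrix A and every ε > 0 there exists a TP_r Hankel matrix B with |a_{ij} − b_{ij}| < ε for all entries. -/
theorem psd_of_minors {k : ℕ} (M : Matrix (Fin k) (Fin k) ℝ) (hs : M.IsHermitian)
    (h : ∀ (l : ℕ) (f : Fin l → Fin k), StrictMono f → 0 ≤ (M.submatrix f f).det) :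
    M.PosSemidef := by
  rw [hs.posSemidef_iff_eigenvalues_nonneg]
  intro i
  by_contra hneg
  simp only [Pi.zero_apply, not_le] at hneg
  set t := hs.eigenvalues i with ht
  set q : Polynomial ℝ := Matrix.det (1 + (Polynomial.X : Polynomial ℝ) • M.map Polynomial.C)
    with hq
  have hcoef : ∀ l, 0 ≤ q.coeff l := by
    intro l
    rw [hq, Matrix.coeff_det_one_add_X_smul_eq_sum_minors]
    refine Finset.sum_nonneg fun s hs' => ?_
    have hc := (Finset.mem_powersetCard.mp hs').2
    have := h l (s.orderEmbOfFin hc) (s.orderEmbOfFin hc).strictMono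
    have e := Matrix.det_submatrix_equiv_self (s.orderIsoOfFin hc).toEquiv
      (M.submatrix (Subtype.val : s → Fin k) (Subtype.val : s → Fin k))
    rw [← e]
    exact this
  have h0 : q.coeff 0 = 1 := by
    rw [hq, Matrix.coeff_det_one_add_X_smul_eq_sum_minors]
    simp
  have heval : q.eval (-t⁻¹) = (1 + (-t⁻¹) • M).det := by
    rw [hq, ← Polynomial.coe_evalRingHom, RingHom.map_det]
    congr 1
    ext a b
    simp [Matrix.one_apply, apply_ite]
    ring
  have hpos : 0 < q.eval (-t⁻¹) := by
    have hti : 0 < -t⁻¹ := by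
      have := inv_lt_zero.mpr hneg
      linarith
    rw [Polynomial.eval_eq_sum_range]
    refine Finset.sum_pos' (fun j _ => mul_nonneg (hcoef j) (pow_nonneg hti.le _))
      ⟨0, by simp, by simp [h0]⟩
  have hv := hs.mulVec_eigenvectorBasis i
  have hne : (⇑(hs.eigenvectorBasis i) : Fin k → ℝ) ≠ 0 := by
    intro h0
    have := hs.eigenvectorBasis.orthonormal.ne_zero i
    apply this
    ext j
    exact congrFun h0 j
  have hz : (1 + (-t⁻¹) • M).det = 0 := by
    apply Matrix.exists_mulVec_eq_zero_iff.mp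
    refine ⟨_, hne, ?_⟩
    rw [Matrix.add_mulVec, Matrix.smul_mulVec, hv, ← ht, smul_smul]
    rw [neg_mul, inv_mul_cancel₀ hneg.ne]
    simp
  linarith

theorem moment_posDef (n k a : ℕ) (hk : k ≤ n) :
    (Matrix.of fun i j : Fin k => ∑ x : Fin n, ((x : ℝ) + 1) ^ (a + (i : ℕ) + (j : ℕ))).PosDef := by
  apply Matrix.PosDef.of_dotProduct_mulVec_pos
  · ext i j
    simp [Matrix.conjTranspose_apply, add_right_comm]
  · intro v hv
    have e : star v ⬝ᵥ (Matrix.of fun i j : Fin k =>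
        ∑ x : Fin n, ((x : ℝ) + 1) ^ (a + (i : ℕ) + (j : ℕ))).mulVec v
        = ∑ x : Fin n, ((x : ℝ) + 1) ^ a * (∑ i : Fin k, ((x : ℝ) + 1) ^ (i : ℕ) * v i) ^ 2 := by
      simp only [dotProduct, Matrix.mulVec, Matrix.of_apply, Pi.star_apply, star_trivial,
        Finset.sum_mul, Finset.mul_sum, sq]
      simp only [Finset.sum_comm (s := (Finset.univ : Finset (Fin k))) (t := (Finset.univ : Finset (Fin n)))]
      refine Finset.sum_congr rfl fun x _ => ?_
      refine Finset.sum_congr rfl fun i _ => ?_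
      refine Finset.sum_congr rfl fun j _ => ?_
      ring
    rw [e]
    have hnn : ∀ x : Fin n, 0 ≤ ((x : ℝ) + 1) ^ a * (∑ i : Fin k, ((x : ℝ) + 1) ^ (i : ℕ) * v i) ^ 2 :=
      fun x => by positivity
    refine lt_of_le_of_ne (Finset.sum_nonneg fun x _ => hnn x) fun h0 => hv ?_
    have h1 := (Finset.sum_eq_zero_iff_of_nonneg (fun x _ => hnn x)).mp h0.symm
    have hdet : (Matrix.vandermonde (fun x : Fin k => ((x : ℕ) : ℝ) + 1)).det ≠ 0 := by
      rw [Matrix.det_vandermonde_ne_zero_iff]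
      intro x y hxy
      simpa [Fin.ext_iff] using hxy
    by_contra hv0
    apply hdet
    apply Matrix.exists_mulVec_eq_zero_iff.mp
    refine ⟨v, hv0, ?_⟩
    ext x
    have h2 := h1 (Fin.castLE hk x) (Finset.mem_univ _)
    have hp : ((((Fin.castLE hk x : Fin n) : ℕ) : ℝ) + 1) ^ a ≠ 0 := by positivity
    have h3 := pow_eq_zero_iff (two_ne_zero) |>.mp ((mul_eq_zero.mp h2).resolve_left hp)
    simpa [Matrix.mulVec, dotProduct, Matrix.vandermonde_apply] using h3

/-- Linear dependence of the rows of a `(k+1) × k` matrix with minor coefficients. -/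
theorem rows_dep {k : ℕ} (W : Matrix (Fin (k + 1)) (Fin k) ℝ) (j : Fin k) :
    ∑ i : Fin (k + 1), (-1) ^ (i : ℕ) * W i j * (W.submatrix i.succAbove id).det = 0 := by
  have h0 : (Matrix.of fun i : Fin (k + 1) => (Fin.cons (W i j) (W i) : Fin (k + 1) → ℝ)).det = 0 := by
    apply Matrix.det_zero_of_column_eq (i := 0) (j := j.succ) (Fin.succ_ne_zero j).symm
    intro i
    simp
  rw [Matrix.det_succ_column_zero] at h0
  rw [← h0]
  refine Finset.sum_congr rfl fun i _ => ?_
  simp only [Matrix.of_apply, Fin.cons_zero]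
  congr 1

/-- The linear functional `v ↦ det (v, J)`. -/
noncomputable def wedge {m : ℕ} (J : Matrix (Fin m) (Fin (m + 1)) ℝ) (v : Fin (m + 1) → ℝ) : ℝ :=
  ∑ j : Fin (m + 1), (-1) ^ (j : ℕ) * v j * (J.submatrix id j.succAbove).det

theorem det_insert {m : ℕ} (M : Matrix (Fin (m + 1)) (Fin (m + 1)) ℝ) (s : Fin (m + 1)) :
    M.det = (-1) ^ (s : ℕ) * wedge (M.submatrix s.succAbove id) (M s) := by
  rw [Matrix.det_succ_row M s, wedge, Finset.mul_sum]
  refine Finset.sum_congr rfl fun j _ => ?_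
  rw [pow_add]
  simp only [Matrix.submatrix_submatrix, Function.comp_id, Function.id_comp]
  ring

theorem wedge_row {m : ℕ} (J : Matrix (Fin m) (Fin (m + 1)) ℝ) (s : Fin m) :
    wedge J (J s) = 0 := by
  have h := det_insert (Matrix.of (Fin.cons (J s) J : Fin (m + 1) → Fin (m + 1) → ℝ)) 0
  have h0 : (Matrix.of (Fin.cons (J s) J : Fin (m + 1) → Fin (m + 1) → ℝ)).det = 0 := by
    apply Matrix.det_zero_of_row_eq (i := 0) (j := s.succ) (Fin.succ_ne_zero s).symm
    ext i
    rfl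
  rw [h0] at h
  simp only [Fin.val_zero, pow_zero, one_mul] at h
  rw [h]
  congr 1

theorem wedge_sum {m : ℕ} (J : Matrix (Fin m) (Fin (m + 1)) ℝ) {ι : Type*} (s : Finset ι)
    (c : ι → ℝ) (v : ι → Fin (m + 1) → ℝ) :
    wedge J (fun j => ∑ i ∈ s, c i * v i j) = ∑ i ∈ s, c i * wedge J (v i) := by
  simp only [wedge, Finset.mul_sum, Finset.sum_mul]
  rw [Finset.sum_comm]
  refine Finset.sum_congr rfl fun i _ => Finset.sum_congr rfl fun j _ => ?_
  ring

/-- Three-term relation, in the form of a positivity criterion. -/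
theorem three_term {m : ℕ} (W : Matrix (Fin (m + 3)) (Fin (m + 2)) ℝ) (t : Fin (m + 1))
    (h0 : 0 < (W.submatrix (Fin.succAbove 0) id).det)
    (hl : 0 < (W.submatrix (Fin.succAbove (Fin.last _)) id).det)
    (hs : ∀ f : Fin (m + 1) → Fin (m + 3), StrictMono f →
      0 < (W.submatrix f Fin.castSucc).det) :
    0 < (W.submatrix (Fin.succAbove t.succ.castSucc) id).det := by
  set ι : Fin m → Fin (m + 3) := fun x => (t.succAbove x).succ.castSucc with hι
  have hιm : StrictMono ι := fun x y hxy => by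
    simp only [hι]
    have := (Fin.strictMono_succAbove t) hxy
    simpa using this
  set J : Matrix (Fin m) (Fin (m + 1)) ℝ := W.submatrix ι Fin.castSucc with hJ
  have key : ∀ (f : Fin (m + 1) → Fin (m + 3)) (s : Fin (m + 1)),
      (∀ x, f (s.succAbove x) = ι x) →
      (W.submatrix f Fin.castSucc).det =
        (-1) ^ (s : ℕ) * wedge J (fun j => W (f s) j.castSucc) := by
    intro f s hf
    rw [det_insert _ s]
    congr 2
    ext x j
    simp [hJ, hf]
  -- the linear relation
  have hrel : ∑ i : Fin (m + 3), ((-1) ^ (i : ℕ) * (W.submatrix i.succAbove id).det) *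
      wedge J (fun j => W i j.castSucc) = 0 := by
    rw [← wedge_sum J Finset.univ
      (fun i : Fin (m + 3) => (-1) ^ (i : ℕ) * (W.submatrix i.succAbove id).det)
      (fun i j => W i j.castSucc)]
    have : (fun j : Fin (m + 1) => ∑ i : Fin (m + 3),
        ((-1) ^ (i : ℕ) * (W.submatrix i.succAbove id).det) * W i j.castSucc) = 0 := by
      ext j
      rw [Pi.zero_apply, ← rows_dep W j.castSucc]
      refine Finset.sum_congr rfl fun i _ => ?_
      ring
    rw [this]
    simp [wedge]
  rw [Fin.sum_univ_succ, Fin.sum_univ_castSucc, Fin.sum_univ_succAbove _ t] at hrel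
  have hz : ∑ x : Fin m, ((-1) ^ (((t.succAbove x).castSucc.succ : Fin (m + 3)) : ℕ) *
      (W.submatrix ((t.succAbove x).castSucc.succ).succAbove id).det) *
      wedge J (fun j => W (t.succAbove x).castSucc.succ j.castSucc) = 0 := by
    refine Finset.sum_eq_zero fun x _ => ?_
    have : wedge J (fun j => W (t.succAbove x).castSucc.succ j.castSucc) = 0 := wedge_row J x
    rw [this, mul_zero]
  rw [hz, add_zero] at hrel
  -- the three minors
  have k1 := key (Fin.cons 0 ι) 0 (fun x => by simp)
  have k2 := key (fun y => y.succ.castSucc) t (fun x => rfl)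
  have k3 := key (Fin.snoc ι (Fin.last _)) (Fin.last _) (fun x => by simp)
  have p1 := hs (Fin.cons 0 ι) (by
    intro x y hxy
    induction x using Fin.cases with
    | zero =>
      induction y using Fin.cases with
      | zero => simp at hxy
      | succ y => simp [hι, Fin.lt_def]
    | succ x =>
      induction y using Fin.cases with
      | zero => simp at hxy
      | succ y => simpa using hιm (by simpa using hxy))
  have p2 := hs (fun y => y.succ.castSucc) (by intro x y hxy; simpa using hxy)
  have p3 := hs (Fin.snoc ι (Fin.last _)) (by
    intro x y hxy
    induction y using Fin.lastCases with
    | last =>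
      induction x using Fin.lastCases with
      | last => simp at hxy
      | cast x =>
        simp only [hι, Fin.lt_def, Fin.snoc_castSucc, Fin.snoc_last, Fin.val_castSucc, Fin.val_succ,
          Fin.val_last]
        omega
    | cast y =>
      induction x using Fin.lastCases with
      | last => exact absurd hxy (by simp [Fin.lt_def])
      | cast x => simpa using hιm (by simpa using hxy))
  rw [k1] at p1
  rw [k2] at p2
  rw [k3] at p3
  simp only [Fin.cons_zero, Fin.val_zero, pow_zero, one_mul] at p1
  simp only [Fin.snoc_last, Fin.val_last] at p3
  simp only [Fin.val_zero, pow_zero, one_mul, Fin.val_succ, Fin.val_castSucc, Fin.val_last,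
    Fin.succ_last, Fin.succ_castSucc] at hrel
  set D0 := (W.submatrix (Fin.succAbove 0) id).det
  set Dt := (W.submatrix (Fin.succAbove t.succ.castSucc) id).det
  set Dl := (W.submatrix (Fin.succAbove (Fin.last _)) id).det
  set L0 := wedge J (fun j => W 0 j.castSucc)
  set Lt := wedge J (fun j => W t.succ.castSucc j.castSucc)
  set Ll := wedge J (fun j => W (Fin.last _) j.castSucc)
  have hrel2 : D0 * L0 + Dl * ((-1) ^ m * Ll) = Dt * ((-1) ^ (t : ℕ) * Lt) := by
    rw [pow_succ, pow_succ, pow_succ] at hrel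
    linear_combination hrel
  have : 0 < Dt * ((-1) ^ (t : ℕ) * Lt) := by
    rw [← hrel2]
    positivity
  exact (pos_iff_pos_of_mul_pos this).mpr p2

theorem fekete_step (m N : ℕ) (V : ℕ → Fin (m + 2) → ℝ)
    (hc : ∀ c, c + (m + 2) ≤ N → 0 < (Matrix.of fun i : Fin (m + 2) => V (c + i)).det)
    (hs : ∀ f : Fin (m + 1) → ℕ, StrictMono f → (∀ i, f i < N) →
      0 < (Matrix.of fun i j : Fin (m + 1) => V (f i) j.castSucc).det) :
    ∀ (d : ℕ) (f : Fin (m + 2) → ℕ), StrictMono f → (∀ i, f i < N) →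
      f (Fin.last _) - f 0 ≤ d → 0 < (Matrix.of fun i : Fin (m + 2) => V (f i)).det := by
  intro d
  induction d with
  | zero =>
    intro f hf hN hd
    have : f 0 < f (Fin.last _) := hf (by simp [Fin.lt_def])
    omega
  | succ d ih =>
    intro f hf hN hd
    by_cases hcon : ∀ i : Fin (m + 1), f i.succ = f i.castSucc + 1
    · have hval : ∀ i : Fin (m + 2), f i = f 0 + i := by
        intro i
        induction i using Fin.induction with
        | zero => simp
        | succ i ih =>
          rw [hcon i, ih]
          simp [add_assoc]
      have h := hc (f 0) (by
        have h1 := hval (Fin.last _)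
        have h2 := hN (Fin.last _)
        simp only [Fin.val_last] at h1
        omega)
      have e : (fun i : Fin (m + 2) => V (f i)) = fun i : Fin (m + 2) => V (f 0 + i) := by
        ext i
        rw [hval i]
      rw [e]
      exact h
    · push Not at hcon
      obtain ⟨t, ht⟩ := hcon
      have hlt : f t.castSucc < f t.succ := hf (by simp [Fin.lt_def])
      set p := f t.castSucc + 1 with hp
      set g : Fin (m + 3) → ℕ := Fin.insertNth t.succ.castSucc p f with hg
      have hgf : ∀ x, g (t.succ.castSucc.succAbove x) = f x := fun x => by simp [hg]
      have hgp : g t.succ.castSucc = p := by simp [hg]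
      have hgm : StrictMono g := by
        have hlow : ∀ x, f x < p ∨ p < f x := by
          intro x
          rcases le_or_gt x t.castSucc with h | h
          · left
            have := hf.monotone h
            omega
          · right
            have : t.succ ≤ x := by
              simp only [Fin.le_def, Fin.lt_def, Fin.val_succ, Fin.val_castSucc] at h ⊢
              omega
            have := hf.monotone this
            omega
        have hfx : ∀ x : Fin (m + 2), (x : ℕ) ≤ t → f x < p := by
          intro x h
          have := hf.monotone (show x ≤ t.castSucc by simpa [Fin.le_def] using h)
          omega
        have hfy : ∀ x : Fin (m + 2), (t : ℕ) < x → p < f x := by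
          intro x h
          have := hf.monotone (show t.succ ≤ x by simp [Fin.le_def]; omega)
          omega
        intro x y hxy
        rcases Fin.eq_self_or_eq_succAbove t.succ.castSucc x with hx | ⟨x', hx⟩
        · rcases Fin.eq_self_or_eq_succAbove t.succ.castSucc y with hy | ⟨y', hy⟩
          · rw [hx, hy] at hxy
            simp at hxy
          · rw [hx, hy, hgf, hgp]
            apply hfy
            rw [hx, hy, Fin.lt_succAbove_iff_le_castSucc] at hxy
            simp [Fin.le_def] at hxy
            omega
        · rcases Fin.eq_self_or_eq_succAbove t.succ.castSucc y with hy | ⟨y', hy⟩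
          · rw [hx, hy, hgf, hgp]
            apply hfx
            rw [hx, hy, Fin.succAbove_lt_iff_castSucc_lt] at hxy
            simp [Fin.lt_def] at hxy
            omega
          · rw [hx, hy, hgf, hgf]
            apply hf
            rw [hx, hy] at hxy
            simpa using hxy
      have hg0 : g 0 = f 0 := by
        have := hgf 0
        rwa [Fin.succAbove_of_castSucc_lt _ _ (by simp [Fin.lt_def])] at this
      have hgl : g (Fin.last _) = f (Fin.last _) := by
        have := hgf (Fin.last _)
        rwa [Fin.succAbove_of_le_castSucc _ _ (by simp [Fin.le_def]; omega)] at this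
      have hgN : ∀ i, g i < N := fun i =>
        lt_of_le_of_lt (hgm.monotone (Fin.le_last i)) (hgl ▸ hN _)
      have hfin := three_term (Matrix.of fun i => V (g i)) t
        (ih (fun i => g (Fin.succAbove 0 i)) (hgm.comp (Fin.strictMono_succAbove _))
          (fun i => hgN _) (by
            have h1 : g 0 < g (Fin.succAbove 0 0) := hgm (by simp [Fin.lt_def])
            have h2 : g (Fin.succAbove 0 (Fin.last _)) ≤ g (Fin.last _) :=
              hgm.monotone (Fin.le_last _)
            omega))
        (ih (fun i => g (Fin.succAbove (Fin.last _) i)) (hgm.comp (Fin.strictMono_succAbove _))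
          (fun i => hgN _) (by
            have h1 : g (Fin.succAbove (Fin.last _) (Fin.last _)) < g (Fin.last _) :=
              hgm (by simp [Fin.lt_def])
            have h2 : g 0 ≤ g (Fin.succAbove (Fin.last _) 0) :=
              hgm.monotone (Fin.zero_le _)
            have h3 : f 0 < f (Fin.last _) := hf (by simp [Fin.lt_def])
            omega))
        (fun f' hf' => hs (fun i => g (f' i)) (hgm.comp hf') (fun i => hgN _))
      have e : (Matrix.of fun i : Fin (m + 2) => V (f i)) =
          (Matrix.of fun i => V (g i)).submatrix (Fin.succAbove t.succ.castSucc) id := by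
        ext i j
        simp only [Matrix.submatrix_apply, Matrix.of_apply, hgf, id]
      rw [e]
      exact hfin

/-- Fekete: arbitrary rows, contiguous columns. -/
theorem fekete_rows (n r : ℕ) (M : ℕ → ℕ → ℝ)
    (hc : ∀ k, k ≤ r → ∀ a b, a + k ≤ n → b + k ≤ n →
      0 < (Matrix.of fun i j : Fin k => M (a + i) (b + j)).det) :
    ∀ k, k ≤ r → ∀ (b : ℕ) (f : Fin k → ℕ), b + k ≤ n → StrictMono f → (∀ i, f i < n) →
      0 < (Matrix.of fun i j : Fin k => M (f i) (b + j)).det := by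
  intro k
  induction k with
  | zero => intros; simp
  | succ k ih =>
    intro hk b f hb hf hN
    match k, ih, hk, hb, f, hf, hN with
    | 0, ih, hk, hb, f, hf, hN =>
      have := hc 1 hk (f 0) b (hN 0) hb
      simpa using this
    | m + 1, ih, hk, hb, f, hf, hN =>
      exact fekete_step m n (fun i j => M i (b + j)) (fun c hcn => hc _ hk c b hcn hb)
        (fun f' hf' hN' => ih (by omega) b f' (by omega) hf' hN') _ f hf hN le_rfl

theorem fekete (n r : ℕ) (M : ℕ → ℕ → ℝ)
    (hc : ∀ k, k ≤ r → ∀ a b, a + k ≤ n → b + k ≤ n →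
      0 < (Matrix.of fun i j : Fin k => M (a + i) (b + j)).det) :
    ∀ k, k ≤ r → ∀ (f g : Fin k → ℕ), StrictMono f → (∀ i, f i < n) → StrictMono g →
      (∀ i, g i < n) → 0 < (Matrix.of fun i j : Fin k => M (f i) (g j)).det := by
  have hrows := fekete_rows n r M hc
  intro k
  induction k with
  | zero => intros; simp
  | succ k ih =>
    intro hk f g hf hN hg hgN
    match k, ih, hk, f, hf, hN, g, hg, hgN with
    | 0, ih, hk, f, hf, hN, g, hg, hgN =>
      have := hrows 1 hk (g 0) f (hgN 0) hf hN
      simpa using this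
    | m + 1, ih, hk, f, hf, hN, g, hg, hgN =>
      rw [← Matrix.det_transpose]
      exact fekete_step m n (fun i j => M (f j) i)
        (fun c hcn => by
          rw [← Matrix.det_transpose]
          exact hrows _ hk c f hcn hf hN)
        (fun f' hf' hN' => by
          rw [← Matrix.det_transpose]
          exact ih (by omega) (fun i => f i.castSucc) f' (hf.comp (Fin.strictMono_castSucc))
            (fun i => hN _) hf' hN') _ g hg hgN le_rfl

/-- Corollary 3.4. The TP_r Hankel matrices are dense in the
TN_r Hankel matrices. -/
theorem hankel_TPr_dense_in_TNr {n : ℕ} (hn : 1 ≤ n)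
    (r : ℕ) (hr1 : 1 ≤ r) (hr : r ≤ n)
    (A : Matrix (Fin n) (Fin n) ℝ) (hH : IsHankel A) (hA : IsTNr A r)
    (ε : ℝ) (hε : 0 < ε) :
    ∃ B : Matrix (Fin n) (Fin n) ℝ, IsHankel B ∧ IsTPr B r ∧
      ∀ i j, |A i j - B i j| < ε := by
  set c : ℕ → ℝ := fun s => ∑ x : Fin n, ((x : ℝ) + 1) ^ s with hcdef
  have hc0 : ∀ s, 0 ≤ c s := fun s => Finset.sum_nonneg fun x _ => by positivity
  set S : ℝ := ∑ s ∈ Finset.range (2 * n), c s with hS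
  have hS0 : 0 ≤ S := Finset.sum_nonneg fun s _ => hc0 s
  set δ : ℝ := ε / (1 + S) with hδ
  have hδ0 : 0 < δ := by positivity
  set B : Matrix (Fin n) (Fin n) ℝ := Matrix.of fun i j => A i j + δ * c ((i : ℕ) + j) with hB
  refine ⟨B, ?_, ?_, ?_⟩
  · intro i i' j j' h
    simp only [hB, Matrix.of_apply, h, hH i i' j j' h]
  · set M : ℕ → ℕ → ℝ := fun i j => if h : i < n ∧ j < n then B ⟨i, h.1⟩ ⟨j, h.2⟩ else 0 with hM
    have hfek := fekete n r M (by
      intro k hk a b ha hb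
      set P : Matrix (Fin k) (Fin k) ℝ := ctgSub A k a b ha hb with hP
      have hPpsd : P.PosSemidef := by
        apply psd_of_minors
        · ext i j
          simp only [Matrix.conjTranspose_apply, star_trivial, hP, ctgSub, Matrix.of_apply]
          apply hH
          simp only
          omega
        · intro l f hf
          have hl : l ≤ k := by
            simpa using Fintype.card_le_of_injective f hf.injective
          exact hA l (hl.trans hk) (fun i => ⟨a + (f i : ℕ), by omega⟩)
            (fun i => ⟨b + (f i : ℕ), by omega⟩)
            (fun x y hxy => by have := hf hxy; simp only [Fin.lt_def] at this ⊢; omega)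
            (fun x y hxy => by have := hf hxy; simp only [Fin.lt_def] at this ⊢; omega)
      have hQ := (moment_posDef n k (a + b) (hk.trans hr)).smul hδ0
      have e : (Matrix.of fun i j : Fin k => M (a + i) (b + j)) =
          δ • (Matrix.of fun i j : Fin k =>
            ∑ x : Fin n, ((x : ℝ) + 1) ^ (a + b + (i : ℕ) + (j : ℕ))) + P := by
        ext i j
        have h1 : a + (i : ℕ) < n ∧ b + (j : ℕ) < n := by omega
        have h2 : a + (i : ℕ) + (b + j) = a + b + i + j := by omega
        simp only [hM, hB, hP, ctgSub, Matrix.of_apply, Matrix.add_apply, Matrix.smul_apply,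
          dif_pos h1, smul_eq_mul, hcdef, h2]
        ring
      rw [e]
      exact (hQ.add_posSemidef hPpsd).det_pos)
    intro k hk f g hf hg
    have h := hfek k hk (fun i => f i) (fun i => g i) (fun x y h => hf h) (fun i => (f i).2)
      (fun x y h => hg h) (fun i => (g i).2)
    have e : (Matrix.of fun i j : Fin k => M (f i) (g j)) = B.submatrix f g := by
      ext i j
      simp [hM]
    rwa [e] at h
  · intro i j
    have hle : c ((i : ℕ) + j) ≤ S :=
      Finset.single_le_sum (f := c) (fun s _ => hc0 s) (Finset.mem_range.mpr (by omega))
    have e : A i j - B i j = -(δ * c ((i : ℕ) + j)) := by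
      simp [hB]
    rw [e, abs_neg, abs_of_nonneg (mul_nonneg hδ0.le (hc0 _))]
    calc δ * c ((i : ℕ) + j) ≤ δ * S := by gcongr
      _ < δ * (1 + S) := by nlinarith
      _ = ε := by rw [hδ]; field_simp
end

section
/- Let A = (a_{i+j})_{0≤i,j≤n−1} be an n-by-n Hankel matrix of real numbers with n ≥ 2, and define A' = (a_{i+j+1})_{0≤i,j≤n−2}. Then A is TN_r (resp. TP_r) if and only if every principal minor of A of size at most r and every principal minor of A' of size at most r is nonnegative (resp. positive). -/
open Matrix in
/-- Row scaling and differencing identity. -/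
lemma hk_det_diff (k : ℕ) (v : ℕ → ℕ → ℝ) (g : Fin (k + 1) → ℕ)
    (h0 : ∀ s, v (g s) 0 ≠ 0) :
    (Matrix.of fun s t : Fin (k + 1) => v (g s) t).det =
      (∏ s, v (g s) 0) * (Matrix.of fun s t : Fin k =>
        v (g s.succ) (t + 1) / v (g s.succ) 0
          - v (g s.castSucc) (t + 1) / v (g s.castSucc) 0).det := by
  have h1 : (Matrix.of fun s t : Fin (k + 1) => v (g s) t) =
      Matrix.of fun s t : Fin (k + 1) => v (g s) 0 *
        (Matrix.of fun s t : Fin (k + 1) => v (g s) t / v (g s) 0) s t := by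
    ext s t
    simp only [Matrix.of_apply]
    have := h0 s
    field_simp
  rw [h1, Matrix.det_mul_column]
  congr 1
  let B : Matrix (Fin (k + 1)) (Fin (k + 1)) ℝ := Matrix.of fun s t =>
    Fin.cases (v (g 0) t / v (g 0) 0)
      (fun i => v (g i.succ) t / v (g i.succ) 0 - v (g i.castSucc) t / v (g i.castSucc) 0) s
  have h2 : (Matrix.of fun s t : Fin (k + 1) => v (g s) t / v (g s) 0).det = B.det := by
    apply Matrix.det_eq_of_forall_row_eq_smul_add_pred (fun _ => (1 : ℝ))
    · intro j
      simp [B]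
    · intro i j
      simp [B]
  rw [h2, Matrix.det_succ_column_zero, Fin.sum_univ_succ]
  have h3 : ∑ i : Fin k, (-1 : ℝ) ^ ((i.succ : Fin (k + 1)) : ℕ) * B i.succ 0 *
      (B.submatrix i.succ.succAbove Fin.succ).det = 0 := by
    apply Finset.sum_eq_zero
    intro i _
    have : B i.succ 0 = 0 := by
      simp [B, div_self (h0 _)]
    rw [this]; ring
  rw [h3]
  have h4 : B 0 0 = 1 := by simp [B, div_self (h0 _)]
  rw [h4]
  simp only [Fin.val_zero, pow_zero, one_mul, add_zero]
  congr 1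

lemma hk_consec (k : ℕ) : ∀ (N : ℕ) (v : ℕ → ℕ → ℝ),
    (∀ j ≤ k, ∀ p, p + j ≤ N → 0 < (Matrix.of fun s t : Fin j => v (p + s) t).det) →
    ∀ g : Fin k → ℕ, StrictMono g → (∀ s, g s < N) →
      0 < (Matrix.of fun s t : Fin k => v (g s) t).det := by
  induction k with
  | zero => intro N v _ g _ _; simp
  | succ k ih =>
    intro N v hv g hg hgN
    obtain ⟨N, rfl⟩ : ∃ N', N = N' + 1 := ⟨N - 1, by have := hgN 0; omega⟩
    have hpos : ∀ i < N + 1, 0 < v i 0 := by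
      intro i hi
      have := hv 1 (by omega) i (by omega)
      simpa [Matrix.det_fin_one] using this
    have hne : ∀ s, v (g s) 0 ≠ 0 := fun s => (hpos _ (hgN s)).ne'
    rw [hk_det_diff k v g hne]
    refine mul_pos (Finset.prod_pos fun s _ => hpos _ (hgN s)) ?_
    let w : ℕ → ℕ → ℝ := fun i t => v (i + 1) (t + 1) / v (i + 1) 0 - v i (t + 1) / v i 0
    have hw : ∀ g' : Fin k → ℕ, StrictMono g' → (∀ s, g' s < N) →
        0 < (Matrix.of fun s t : Fin k => w (g' s) t).det := by
      apply ih N w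
      intro j hj p hp
      have h1 := hv (j + 1) (by omega) p (by omega)
      have hb : ∀ s : Fin (j + 1), 0 < v (p + s) 0 := fun s => hpos _ (by omega)
      rw [hk_det_diff j v (fun s => p + s) (fun s => (hb s).ne')] at h1
      exact (mul_pos_iff_of_pos_left (Finset.prod_pos fun s _ => hb s)).1 h1
    have hrow : (Matrix.of fun s t : Fin k =>
        v (g s.succ) (t + 1) / v (g s.succ) 0
          - v (g s.castSucc) (t + 1) / v (g s.castSucc) 0) =
        fun s => ∑ i ∈ Finset.Ico (g s.castSucc) (g s.succ), (fun t : Fin k => w i t) := by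
      ext s t
      rw [Finset.sum_apply]
      exact (Finset.sum_Ico_sub (fun i => v i (t + 1) / v i 0)
        (hg (Fin.castSucc_lt_succ (i := s))).le).symm
    have hexp := MultilinearMap.map_sum_finset
      (Matrix.detRowAlternating (R := ℝ) (n := Fin k)).toMultilinearMap
      (fun (_ : Fin k) (i : ℕ) => (fun t : Fin k => w i t))
      (fun s => Finset.Ico (g s.castSucc) (g s.succ))
    rw [hrow]
    refine lt_of_lt_of_eq ?_ hexp.symm
    apply Finset.sum_pos
    · intro q hq
      rw [Fintype.mem_piFinset] at hq
      simp only [Finset.mem_Ico] at hq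
      apply hw q
      · intro s s' hss
        have h1 := (hq s).2
        have h2 := (hq s').1
        have h3 : g s.succ ≤ g s'.castSucc := hg.monotone (by
          rw [Fin.le_def]; simp; omega)
        omega
      · intro s
        have := (hq s).2
        have := hgN s.succ
        omega
    · refine ⟨fun s => g s.castSucc, ?_⟩
      rw [Fintype.mem_piFinset]
      intro s
      simp only [Finset.mem_Ico, le_refl, true_and]
      exact hg (Fin.castSucc_lt_succ (i := s))

/-- Fekete's criterion. -/
lemma hk_fekete (r m n : ℕ) (a : ℕ → ℕ → ℝ)
    (h : ∀ k ≤ r, ∀ p q, p + k ≤ m → q + k ≤ n →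
      0 < (Matrix.of fun s t : Fin k => a (p + s) (q + t)).det)
    (k : ℕ) (hk : k ≤ r) (f g : Fin k → ℕ) (hf : StrictMono f) (hg : StrictMono g)
    (hfm : ∀ s, f s < m) (hgn : ∀ s, g s < n) :
    0 < (Matrix.of fun s t : Fin k => a (f s) (g t)).det := by
  have hA : ∀ k ≤ r, ∀ f : Fin k → ℕ, StrictMono f → (∀ s, f s < m) → ∀ q, q + k ≤ n →
      0 < (Matrix.of fun s t : Fin k => a (f s) (q + t)).det := by
    intro k hk f hf hfm q hq
    apply hk_consec k m (fun i t => a i (q + t)) _ f hf hfm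
    intro j hj p hp
    exact h j (by omega) p q hp (by omega)
  have hB := hk_consec k n (fun i t => if ht : t < k then a (f ⟨t, ht⟩) i else 0) ?_ g hg hgn
  · rw [← Matrix.det_transpose]
    convert hB using 2
    ext s t
    simp
  · intro j hj p hp
    have := hA j (by omega) (fun s => f (Fin.castLE hj s))
      (fun s t hst => hf (by simpa using hst)) (fun s => hfm _) p (by omega)
    rw [← Matrix.det_transpose] at this
    convert this using 2
    ext s t
    have : (t : ℕ) < k := by omega
    simp [this]
    rfl

lemma hk_det_add_single (k : ℕ) (M : Matrix (Fin (k + 1)) (Fin (k + 1)) ℝ)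
    (i : Fin (k + 1)) (t : ℝ) :
    (M + Matrix.diagonal (Pi.single i t)).det =
      M.det + t * (M.submatrix i.succAbove i.succAbove).det := by
  have h1 : M + Matrix.diagonal (Pi.single i t) = M.updateRow i (M i + t • Pi.single i 1) := by
    ext a b
    by_cases ha : a = i
    · subst ha
      by_cases hb : b = a
      · subst hb; simp
      · simp [hb, Matrix.diagonal_apply_ne _ (Ne.symm hb)]
    · rw [Matrix.updateRow_ne ha]
      by_cases hb : a = b
      · subst hb; simp [ha]
      · simp [Matrix.diagonal_apply_ne _ hb]
  rw [h1, Matrix.det_updateRow_add, Matrix.det_updateRow_smul, Matrix.updateRow_eq_self]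
  have h2 := Matrix.adjugate_fin_succ_eq_det_submatrix M i i
  rw [Matrix.adjugate_apply] at h2
  rw [h2, ← two_mul, pow_mul]
  simp

lemma hk_det_add_diag (k : ℕ) : ∀ (M : Matrix (Fin k) (Fin k) ℝ),
    (∀ m, ∀ f : Fin m → Fin k, StrictMono f → 0 ≤ (M.submatrix f f).det) →
    (∀ d : Fin k → ℝ, (∀ i, 0 ≤ d i) → 0 ≤ (M + Matrix.diagonal d).det) ∧
    (∀ d : Fin k → ℝ, (∀ i, 0 < d i) → 0 < (M + Matrix.diagonal d).det) := by
  induction k with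
  | zero => intro M _; simp
  | succ k ih =>
    intro M hM
    have hsub : ∀ (d : Fin (k + 1) → ℝ) (i : Fin (k + 1)),
        (M + Matrix.diagonal d).submatrix i.succAbove i.succAbove =
        M.submatrix i.succAbove i.succAbove + Matrix.diagonal (fun j => d (i.succAbove j)) := by
      intro d i
      rw [Matrix.submatrix_add]
      simp only [Pi.add_apply]
      rw [Matrix.submatrix_diagonal _ _ Fin.succAbove_right_injective]
      rfl
    have ih' := fun i : Fin (k + 1) => ih (M.submatrix i.succAbove i.succAbove)
      (fun m f hf => by
        rw [Matrix.submatrix_submatrix]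
        exact hM m _ ((Fin.strictMono_succAbove i).comp hf))
    have hstep : ∀ (d : Fin (k + 1) → ℝ) (i : Fin (k + 1)),
        (M + Matrix.diagonal d).det = (M + Matrix.diagonal (Function.update d i 0)).det +
          d i * (M.submatrix i.succAbove i.succAbove +
            Matrix.diagonal (fun j => d (i.succAbove j))).det := by
      intro d i
      have h1 : d = Function.update d i 0 + Pi.single i (d i) := by
        ext j
        by_cases hj : j = i
        · subst hj; simp
        · simp [hj]
      have h2 : M + Matrix.diagonal d = (M + Matrix.diagonal (Function.update d i 0)) +
          Matrix.diagonal (Pi.single i (d i)) := by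
        rw [add_assoc, Matrix.diagonal_add]
        congr 2
      rw [h2, hk_det_add_single, hsub]
      simp
    have hnn : ∀ (S : Finset (Fin (k + 1))) (d : Fin (k + 1) → ℝ), (∀ i, 0 ≤ d i) →
        (∀ i ∉ S, d i = 0) → 0 ≤ (M + Matrix.diagonal d).det := by
      intro S
      induction S using Finset.induction_on with
      | empty =>
        intro d _ h0
        have : d = 0 := by ext i; exact h0 i (by simp)
        subst this
        have := hM (k + 1) id strictMono_id
        simpa using this
      | insert i S hi ihS =>
        intro d hd h0
        rw [hstep d i]
        refine add_nonneg (ihS _ ?_ ?_) (mul_nonneg (hd i) ((ih' i).1 _ fun j => hd _))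
        · intro j
          by_cases hj : j = i
          · subst hj; simp
          · simp [hj, hd]
        · intro j hjS
          by_cases hj : j = i
          · subst hj; simp
          · simp [hj, h0 j (by simp [hj, hjS])]
    refine ⟨fun d hd => hnn Finset.univ d hd (by simp), fun d hd => ?_⟩
    rw [hstep d 0]
    refine add_pos_of_nonneg_of_pos (hnn Finset.univ _ ?_ (by simp))
      (mul_pos (hd 0) ((ih' 0).2 _ fun j => hd _))
    intro j
    by_cases hj : j = 0
    · subst hj; simp
    · simp [hj, (hd j).le]

lemma hk_posSemidef (k : ℕ) (M : Matrix (Fin k) (Fin k) ℝ) (hs : M.IsHermitian)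
    (hM : ∀ m, ∀ f : Fin m → Fin k, StrictMono f → 0 ≤ (M.submatrix f f).det) :
    M.PosSemidef := by
  rw [hs.posSemidef_iff_eigenvalues_nonneg]
  intro i
  by_contra hneg
  have hneg : hs.eigenvalues i < 0 := by simpa using hneg
  have h1 := (hk_det_add_diag k M hM).2 (fun _ => - hs.eigenvalues i) (fun _ => by linarith)
  have hv := hs.mulVec_eigenvectorBasis i
  have hne : (hs.eigenvectorBasis i).ofLp ≠ 0 := by
    intro h0
    apply hs.eigenvectorBasis.orthonormal.ne_zero i
    ext j
    exact congrFun h0 j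
  have h2 : (M + Matrix.diagonal fun _ => - hs.eigenvalues i).det = 0 := by
    apply Matrix.exists_mulVec_eq_zero_iff.1
    refine ⟨_, hne, ?_⟩
    rw [Matrix.add_mulVec, hv]
    ext j
    simp
  linarith

/-- Auxiliary moment sequence. -/
noncomputable def hkB (n : ℕ) (m : ℕ) : ℝ := ∑ x : Fin n, ((x : ℝ) + 1) ^ m

lemma hk_B_posDef (n k e : ℕ) (hk : k ≤ n) :
    (Matrix.of fun s t : Fin k => hkB n (e + s + t)).PosDef := by
  apply Matrix.PosDef.of_dotProduct_mulVec_pos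
  · ext s t
    simp [hkB, add_right_comm]
  · intro c hc
    have h1 : star c ⬝ᵥ (Matrix.of fun s t : Fin k => hkB n (e + s + t)).mulVec c =
        ∑ x : Fin n, ((x : ℝ) + 1) ^ e * (∑ i : Fin k, ((x : ℝ) + 1) ^ (i : ℕ) * c i) ^ 2 := by
      have h2 : ∀ x : Fin n, ((x : ℝ) + 1) ^ e *
          (∑ i : Fin k, ((x : ℝ) + 1) ^ (i : ℕ) * c i) ^ 2 =
          ∑ i : Fin k, ∑ j : Fin k, c i * (((x : ℝ) + 1) ^ (e + i + j : ℕ) * c j) := by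
        intro x
        rw [sq, Finset.sum_mul_sum, Finset.mul_sum]
        refine Finset.sum_congr rfl fun i _ => ?_
        rw [Finset.mul_sum]
        refine Finset.sum_congr rfl fun j _ => ?_
        rw [pow_add, pow_add]
        ring
      simp only [h2]
      rw [Finset.sum_comm]
      simp only [dotProduct, Matrix.mulVec, Matrix.of_apply, hkB, star_trivial]
      refine Finset.sum_congr rfl fun i _ => ?_
      rw [Finset.sum_comm, Finset.mul_sum]
      refine Finset.sum_congr rfl fun j _ => ?_
      rw [← Finset.mul_sum, Finset.sum_mul]
    rw [h1]
    apply Finset.sum_pos'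
    · intro x _; positivity
    · by_contra hcon
      push Not at hcon
      apply hc
      apply Matrix.eq_zero_of_forall_index_sum_pow_mul_eq_zero
        (f := fun j : Fin k => ((j : ℕ) : ℝ) + 1)
      · intro i j hij
        ext
        simpa using hij
      · intro j
        have h2 := hcon (Fin.castLE hk j) (Finset.mem_univ _)
        simp only [Fin.val_castLE] at h2
        have h3 : (0 : ℝ) < ((j : ℕ) + 1) ^ e := by positivity
        have h4 := nonpos_of_mul_nonpos_right h2 h3
        exact pow_eq_zero_iff (two_ne_zero) |>.1 (le_antisymm h4 (sq_nonneg _))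

lemma hk_principal (Q : ℝ → Prop) {n : ℕ} (r : ℕ) (a : ℕ → ℝ)
    (h1 : ∀ (k : ℕ), k ≤ r → ∀ f : Fin k → Fin n, StrictMono f →
          Q ((Matrix.of fun i j : Fin n => a (i.1 + j.1)).submatrix f f).det)
    (h2 : ∀ (k : ℕ), k ≤ r → ∀ f : Fin k → Fin (n - 1), StrictMono f →
          Q ((Matrix.of fun i j : Fin (n - 1) => a (i.1 + j.1 + 1)).submatrix f f).det)
    (k e : ℕ) (hk : k ≤ r) (he : e + 2 * k ≤ 2 * n) (m : ℕ) (f : Fin m → Fin k)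
    (hf : StrictMono f) :
    Q ((Matrix.of fun s t : Fin k => a (e + s + t)).submatrix f f).det := by
  have hm : m ≤ k := by simpa using Fintype.card_le_of_injective f hf.injective
  rcases Nat.even_or_odd' e with ⟨p, rfl | rfl⟩
  · have := h1 m (by omega) (fun s => ⟨p + f s, by omega⟩) (fun s t hst => by
      have := hf hst
      simp only [Fin.lt_def] at this ⊢
      omega)
    convert this using 2
    ext s t
    simp only [Matrix.submatrix_apply, Matrix.of_apply]
    congr 1
    omega
  · have := h2 m (by omega) (fun s => ⟨p + f s, by omega⟩) (fun s t hst => by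
      have := hf hst
      simp only [Fin.lt_def] at this ⊢
      omega)
    convert this using 2
    ext s t
    simp only [Matrix.submatrix_apply, Matrix.of_apply]
    congr 1
    omega

lemma hk_TP {n : ℕ} (r : ℕ) (a : ℕ → ℝ)
    (h : ∀ k e : ℕ, k ≤ r → k ≤ n → e + 2 * k ≤ 2 * n →
      0 < (Matrix.of fun s t : Fin k => a (e + s + t)).det) :
    IsTPr (Matrix.of fun i j : Fin n => a (i.1 + j.1)) r := by
  intro k hk f g hf hg
  refine hk_fekete r n n (fun i j => a (i + j)) ?_ k hk (fun s => f s) (fun s => g s)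
    hf hg (fun s => (f s).2) (fun s => (g s).2)
  intro k hk p q hp hq
  convert h k (p + q) hk (by omega) (by omega) using 2
  ext s t
  simp only [Matrix.of_apply]
  congr 1
  omega

/-- Corollary 3.5. Let `A = (a_{i+j})` be an `n`-by-`n` Hankel matrix
(`n ≥ 2`) and `A' = (a_{i+j+1})` its `(n-1)`-by-`(n-1)` shifted submatrix. Then `A` is
TN_r (resp. TP_r) iff every principal minor of `A` and of `A'` of size at most `r` is
nonnegative (resp. positive). -/
theorem hankel_TNr_TPr_iff_principal_minors {n : ℕ} (hn : 2 ≤ n) (r : ℕ) (a : ℕ → ℝ) :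
    (IsTNr (Matrix.of fun i j : Fin n => a (i.1 + j.1)) r ↔
      ((∀ (k : ℕ), k ≤ r → ∀ f : Fin k → Fin n, StrictMono f →
          0 ≤ ((Matrix.of fun i j : Fin n => a (i.1 + j.1)).submatrix f f).det) ∧
       (∀ (k : ℕ), k ≤ r → ∀ f : Fin k → Fin (n - 1), StrictMono f →
          0 ≤ ((Matrix.of fun i j : Fin (n - 1) => a (i.1 + j.1 + 1)).submatrix f f).det))) ∧
    (IsTPr (Matrix.of fun i j : Fin n => a (i.1 + j.1)) r ↔
      ((∀ (k : ℕ), k ≤ r → ∀ f : Fin k → Fin n, StrictMono f →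
          0 < ((Matrix.of fun i j : Fin n => a (i.1 + j.1)).submatrix f f).det) ∧
       (∀ (k : ℕ), k ≤ r → ∀ f : Fin k → Fin (n - 1), StrictMono f →
          0 < ((Matrix.of fun i j : Fin (n - 1) => a (i.1 + j.1 + 1)).submatrix f f).det))) := by
  have fwd : ∀ Q : ℝ → Prop, (∀ (k : ℕ), k ≤ r → ∀ (f g : Fin k → Fin n),
      StrictMono f → StrictMono g →
        Q ((Matrix.of fun i j : Fin n => a (i.1 + j.1)).submatrix f g).det) →
      ((∀ (k : ℕ), k ≤ r → ∀ f : Fin k → Fin n, StrictMono f →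
          Q ((Matrix.of fun i j : Fin n => a (i.1 + j.1)).submatrix f f).det) ∧
       (∀ (k : ℕ), k ≤ r → ∀ f : Fin k → Fin (n - 1), StrictMono f →
          Q ((Matrix.of fun i j : Fin (n - 1) => a (i.1 + j.1 + 1)).submatrix f f).det)) := by
    intro Q h
    refine ⟨fun k hk f hf => h k hk f f hf hf, fun k hk f hf => ?_⟩
    exact h k hk (fun s => ⟨f s, by omega⟩) (fun s => ⟨f s + 1, by omega⟩)
      (fun s t hst => by
        have := hf hst
        simp only [Fin.lt_def] at this ⊢
        omega)
      (fun s t hst => by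
        have := hf hst
        simp only [Fin.lt_def] at this ⊢
        omega)
  refine ⟨⟨fun h => fwd (fun x => 0 ≤ x) h, ?_⟩, ⟨fun h => fwd (fun x => 0 < x) h, ?_⟩⟩
  · rintro ⟨h1, h2⟩ k hk f g hf hg
    have hp : ∀ ε : ℝ, 0 < ε →
        IsTPr (Matrix.of fun i j : Fin n => (fun m => a m + ε * hkB n m) (i.1 + j.1)) r := by
      intro ε hε
      apply hk_TP r (fun m => a m + ε * hkB n m)
      intro k e hk hkn he
      have hM := hk_posSemidef k (Matrix.of fun s t : Fin k => a (e + s + t))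
        (by ext s t; simp [add_right_comm])
        (fun m f hf => hk_principal (fun x => 0 ≤ x) r a h1 h2 k e hk he m f hf)
      have hB := (hk_B_posDef n k e hkn).smul hε
      exact (Matrix.PosDef.posSemidef_add hM hB).det_pos
    have hc : Continuous fun ε : ℝ => ((Matrix.of fun i j : Fin n =>
        (fun m => a m + ε * hkB n m) (i.1 + j.1)).submatrix f g).det := by
      apply Continuous.matrix_det
      apply continuous_matrix
      intro i j
      simp only [Matrix.submatrix_apply, Matrix.of_apply]
      fun_prop
    have hlim := (hc.tendsto 0).mono_left (nhdsWithin_le_nhds (s := Set.Ioi (0 : ℝ)))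
    simp only [zero_mul, add_zero] at hlim
    refine ge_of_tendsto hlim ?_
    filter_upwards [self_mem_nhdsWithin] with ε hε
    exact (hp ε hε k hk f g hf hg).le
  · rintro ⟨h1, h2⟩
    apply hk_TP
    intro k e hk hkn he
    exact hk_principal (fun x => 0 < x) r a h1 h2 k e hk he k id strictMono_id
end
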